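/- arXiv:math/0608173 — 7 statements merged into one kernel-verified Lean document; each statement's English description precedes it below -/
import Mathlib

section
/- There exists a positive integer ℓ₀ such that for every ℓ ≥ ℓ₀ the following holds: if (𝒜, ℬ) is an ℓ-cross-intersecting pair of families of subsets of [n] with |𝒜|·|ℬ| = binom(2ℓ,ℓ)·2^(n−2ℓ), then there exist parameters κ ∈ {2ℓ−1, 2ℓ}, τ ∈ {0,…,κ}, and n' with κ+τ ≤ n' ≤ n, such that, after applying some permutation of the elements of [n] and possibly swapping the roles of 𝒜 and ℬ, the pair has the following form. Let T be the collection consisting of the τ pairs {1, κ+1}, …, {τ, κ+τ} together with the κ−τ singletons {τ+1}, …, {κ}, let X = {κ+τ+1,…,n'} and Y = {n'+1,…,n}. Then 𝒜 = { (∪_{T∈J} T) ∪ S : J ⊆ T, |J| = ℓ, S ⊆ X }, and ℬ = { L ∪ {τ+1,…,κ} ∪ S' : L ⊆ {1,…,τ} ∪ {κ+1,…,κ+τ} with |L ∩ {i, κ+i}| = 1 for every i ∈ {1,…,τ}, S' ⊆ Y }. -/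
namespace CrossIntersecting

open Finset

/-- The density of the middle layer of the `r`-dimensional cube. -/
noncomputable def midDensity (r : ℕ) : ℝ := (r.choose (r / 2) : ℝ) / 2 ^ r

lemma midDensity_pos (r : ℕ) : 0 < midDensity r := by
  have : 0 < r.choose (r / 2) := Nat.choose_pos (Nat.div_le_self _ _)
  unfold midDensity
  positivity

lemma midDensity_two_mul (m : ℕ) : midDensity (2 * m) = m.centralBinom / 4 ^ m := by
  unfold midDensity
  rw [Nat.mul_div_cancel_left _ two_pos, ← Nat.centralBinom_eq_two_mul_choose, pow_mul]
  norm_num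

lemma midDensity_two_mul_add_two (m : ℕ) :
    midDensity (2 * (m + 1)) = midDensity (2 * m) * ((2 * m + 1) / (2 * m + 2)) := by
  have h : ((m : ℝ) + 1) * (m + 1).centralBinom = 2 * (2 * m + 1) * m.centralBinom := by
    exact_mod_cast Nat.succ_mul_centralBinom_succ m
  have hm : (m : ℝ) + 1 ≠ 0 := by positivity
  have h2 : (2 * m + 2 : ℝ) ≠ 0 := by positivity
  rw [midDensity_two_mul, midDensity_two_mul, div_mul_div_comm, div_eq_div_iff (by positivity)
    (by positivity), pow_succ]
  linear_combination 2 * 4 ^ m * h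

lemma midDensity_odd (m : ℕ) : midDensity (2 * m + 1) = midDensity (2 * (m + 1)) := by
  have h : (2 * (m + 1)).choose (m + 1) = 2 * (2 * m + 1).choose m := by
    rw [show 2 * (m + 1) = (2 * m + 1) + 1 by ring, Nat.choose_succ_succ,
      Nat.choose_symm_half]
    ring
  unfold midDensity
  rw [show (2 * m + 1) / 2 = m by omega, show 2 * (m + 1) / 2 = m + 1 by omega, h,
    show 2 * (m + 1) = (2 * m + 1) + 1 by ring, pow_succ]
  push_cast
  field_simp
  ring

lemma midDensity_antitone : Antitone midDensity := by
  refine antitone_nat_of_succ_le fun r => ?_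
  obtain ⟨m, rfl | rfl⟩ := r.even_or_odd'
  · rw [midDensity_odd, midDensity_two_mul_add_two]
    refine mul_le_of_le_one_right (midDensity_pos _).le ?_
    rw [div_le_one (by positivity)]
    linarith
  · rw [midDensity_odd, show 2 * m + 1 + 1 = 2 * (m + 1) by ring]

lemma midDensity_sq_mul_two_mul_add_one_le (m : ℕ) : midDensity (2 * m) ^ 2 * (2 * m + 1) ≤ 1 := by
  induction m with
  | zero => simp [midDensity]
  | succ m ih =>
    rw [midDensity_two_mul_add_two, mul_pow, div_pow]
    have h : ((2 * m + 1 : ℝ) ^ 2 / (2 * m + 2) ^ 2) * (2 * ((m + 1 : ℕ) : ℝ) + 1) ≤ 2 * m + 1 := by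
      rw [div_mul_eq_mul_div, div_le_iff₀ (by positivity)]
      push_cast
      have : (0 : ℝ) ≤ m := by positivity
      nlinarith
    calc _ = midDensity (2 * m) ^ 2 *
          (((2 * m + 1 : ℝ) ^ 2 / (2 * m + 2) ^ 2) * (2 * ((m + 1 : ℕ) : ℝ) + 1)) := by ring
      _ ≤ midDensity (2 * m) ^ 2 * (2 * m + 1) := by gcongr
      _ ≤ 1 := ih

lemma midDensity_sq_mul_succ_le (r : ℕ) : midDensity r ^ 2 * (r + 1) ≤ 1 := by
  obtain ⟨m, rfl | rfl⟩ := r.even_or_odd'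
  · exact_mod_cast midDensity_sq_mul_two_mul_add_one_le m
  · rw [midDensity_odd]
    refine le_trans ?_ (midDensity_sq_mul_two_mul_add_one_le (m + 1))
    gcongr
    push_cast
    linarith

lemma midDensity_sq_mul_two_mul_mono :
    Monotone fun m : ℕ => midDensity (2 * m) ^ 2 * (2 * m) := by
  refine monotone_nat_of_le_succ fun m => ?_
  have h : (2 * m : ℝ) ≤ ((2 * m + 1 : ℝ) ^ 2 / (2 * m + 2) ^ 2) * (2 * ((m + 1 : ℕ) : ℝ)) := by
    rw [div_mul_eq_mul_div, le_div_iff₀ (by positivity)]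
    push_cast
    have : (0 : ℝ) ≤ m := by positivity
    nlinarith
  calc midDensity (2 * m) ^ 2 * (2 * m) ≤ midDensity (2 * m) ^ 2 *
        (((2 * m + 1 : ℝ) ^ 2 / (2 * m + 2) ^ 2) * (2 * ((m + 1 : ℕ) : ℝ))) := by gcongr
    _ = _ := by rw [midDensity_two_mul_add_two, mul_pow, div_pow]; ring

lemma midDensity_sq_mul_le {t ℓ : ℕ} (h : t ≤ 2 * ℓ) :
    midDensity t ^ 2 * t ≤ midDensity (2 * ℓ) ^ 2 * (2 * ℓ) := by
  obtain ⟨m, rfl | rfl⟩ := t.even_or_odd'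
  · exact_mod_cast midDensity_sq_mul_two_mul_mono (show m ≤ ℓ by omega)
  · rw [midDensity_odd]
    refine le_trans (mul_le_mul_of_nonneg_left ?_ (sq_nonneg _))
      (midDensity_sq_mul_two_mul_mono (show m + 1 ≤ ℓ by omega))
    push_cast
    linarith

lemma one_le_midDensity_sq_mul {ℓ : ℕ} (h : 1 ≤ ℓ) : 1 ≤ midDensity (2 * ℓ) ^ 2 * (4 * ℓ) := by
  have h1 := midDensity_sq_mul_two_mul_mono h
  have h2 : midDensity (2 * 1) = 1 / 2 := by
    rw [midDensity_two_mul]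
    norm_num [Nat.centralBinom, Nat.choose]
  simp only [h2] at h1
  push_cast at h1
  linarith

/-- Among the densities `binom(t, ℓ) / 2 ^ t`, only `t = 2ℓ - 1` and `t = 2ℓ` reach the value at
`2ℓ`. -/
lemma choose_div_two_pow_lt {ℓ t : ℕ} (h1 : t ≠ 2 * ℓ - 1) (h2 : t ≠ 2 * ℓ) :
    (t.choose ℓ : ℝ) / 2 ^ t < midDensity (2 * ℓ) := by
  have hratio : ∀ t : ℕ, ((t + 1).choose ℓ : ℝ) / 2 ^ (t + 1) * (2 * (t + 1 - ℓ)) =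
      (t.choose ℓ : ℝ) / 2 ^ t * (t + 1) := by
    intro t
    rcases le_or_gt ℓ (t + 1) with h | h
    · have h := Nat.choose_mul_succ_eq t ℓ
      have h' : ((t.choose ℓ : ℝ)) * (t + 1) = (t + 1).choose ℓ * (t + 1 - ℓ) := by
        have := congrArg (Nat.cast (R := ℝ)) h
        push_cast [Nat.cast_sub ‹ℓ ≤ t + 1›] at this
        exact this
      rw [pow_succ, div_mul_eq_mul_div, div_mul_eq_mul_div, div_eq_div_iff (by positivity)
        (by positivity), h']
      ring
    · simp [Nat.choose_eq_zero_of_lt h, Nat.choose_eq_zero_of_lt (show t < ℓ by omega)]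
  have hmid : midDensity (2 * ℓ) = ((2 * ℓ).choose ℓ : ℝ) / 2 ^ (2 * ℓ) := by
    unfold midDensity
    rw [Nat.mul_div_cancel_left _ two_pos]
  have hpos : ∀ t, ℓ ≤ t → 0 < (t.choose ℓ : ℝ) / 2 ^ t := fun t h => by
    have := Nat.choose_pos h
    positivity
  rcases lt_or_gt_of_ne h2 with h2 | h2
  · rcases lt_or_ge t ℓ with h | h
    · simp [Nat.choose_eq_zero_of_lt h, midDensity_pos]
    have key : ∀ k, ℓ ≤ k → k + 1 < 2 * ℓ →
        (k.choose ℓ : ℝ) / 2 ^ k < ((k + 1).choose ℓ : ℝ) / 2 ^ (k + 1) := by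
      intro k hk hk2
      have hk' : (ℓ : ℝ) ≤ k := by exact_mod_cast hk
      have hk2' : (k : ℝ) + 1 < 2 * ℓ := by exact_mod_cast hk2
      have := hratio k
      have h3 := hpos (k + 1) (by omega)
      have h4 := hpos k hk
      by_contra! hc
      nlinarith
    have key2 : ∀ k, t < k → k < 2 * ℓ →
        (t.choose ℓ : ℝ) / 2 ^ t < (k.choose ℓ : ℝ) / 2 ^ k := by
      intro k hk
      induction k, hk using Nat.le_induction with
      | base => exact fun hk2 => key t h hk2
      | succ k hk ih => exact fun hk2 => (ih (by omega)).trans (key k (by omega) hk2)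
    have h5 := key2 (2 * ℓ - 1) (by omega) (by omega)
    have h6 := hratio (2 * ℓ - 1)
    rw [show 2 * ℓ - 1 + 1 = 2 * ℓ by omega] at h6
    have h7 : ((2 * ℓ - 1 : ℕ) : ℝ) = 2 * ℓ - 1 := by
      rw [Nat.cast_sub (by omega)]; push_cast; ring
    rw [h7] at h6
    have hl : (0 : ℝ) < ℓ := by exact_mod_cast (show 0 < ℓ by omega)
    rw [hmid]
    nlinarith
  · have key : ∀ k, 2 * ℓ ≤ k →
        ((k + 1).choose ℓ : ℝ) / 2 ^ (k + 1) < (k.choose ℓ : ℝ) / 2 ^ k := by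
      intro k hk
      have hk' : (2 * ℓ : ℝ) ≤ k := by exact_mod_cast hk
      have := hratio k
      have h3 := hpos (k + 1) (by omega)
      have h4 := hpos k (by omega)
      by_contra! hc
      nlinarith
    rw [hmid]
    induction t, h2 using Nat.le_induction with
    | base => exact key _ le_rfl
    | succ k hk ih =>
      have hk : 2 * ℓ < k := hk
      exact (key k (by omega)).trans (ih (by omega) (by omega))

variable {α : Type*} [DecidableEq α]

/-- A family of subsets of `D₁ ∪ D₂` is bounded by the number of traces on `D₁` times the largest
number of extensions of a trace to `D₂`. -/
lemma card_le_mul_of_traces {D₁ D₂ : Finset α} {𝒳 𝒯 : Finset (Finset α)} {K : ℝ}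
    (h𝒳 : ∀ x ∈ 𝒳, x ⊆ D₁ ∪ D₂) (h𝒯 : ∀ x ∈ 𝒳, x ∩ D₁ ∈ 𝒯)
    (hK : ∀ u ∈ 𝒯, (#{v ∈ D₂.powerset | u ∪ v ∈ 𝒳} : ℝ) ≤ K) : (#𝒳 : ℝ) ≤ #𝒯 * K := by
  rw [card_eq_sum_card_fiberwise h𝒯, ← nsmul_eq_mul]
  push_cast
  refine sum_le_card_nsmul _ _ _ fun u hu => le_trans ?_ (hK u hu)
  have hdec : ∀ x ∈ 𝒳, x ∩ D₁ ∪ x ∩ D₂ = x := fun x hx => by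
    rw [← inter_union_distrib_left, inter_eq_left.2 (h𝒳 x hx)]
  norm_cast
  refine card_le_card_of_injOn (fun x => x ∩ D₂) ?_ ?_
  · intro x hx
    obtain ⟨hx', rfl⟩ := mem_filter.1 hx
    simp [hdec x hx', hx']
  · intro x hx y hy hxy
    obtain ⟨hx, hxu⟩ := mem_filter.1 hx
    obtain ⟨hy, hyu⟩ := mem_filter.1 hy
    simp only at hxy
    rw [← hdec x hx, ← hdec y hy, hxu, hyu, hxy]

/-- The Littlewood-Offord bound of Erdős for nonzero weights. -/
lemma card_sum_eq_le_choose {D : Finset α} {m : α → ℝ} (hm : ∀ i ∈ D, m i ≠ 0) (v : ℝ) :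
    #{x ∈ D.powerset | ∑ i ∈ x, m i = v} ≤ (#D).choose (#D / 2) := by
  set N := {i ∈ D | m i < 0} with hN
  set 𝒞 : Finset (Finset {i // i ∈ D}) := {s | ∑ i ∈ s, |m i| = v - ∑ i ∈ N, m i} with h𝒞
  have hanti : IsAntichain (· ⊆ ·) (𝒞 : Set (Finset {i // i ∈ D})) := by
    intro s hs t ht hst hsub
    simp only [h𝒞, mem_coe, mem_filter, mem_univ, true_and] at hs ht
    obtain ⟨i, hit, his⟩ := exists_of_ssubset (hsub.ssubset_of_ne hst)
    have := sum_lt_sum_of_subset (f := fun i : {i // i ∈ D} => |m i|) hsub hit his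
      (abs_pos.2 (hm i i.2)) (fun j _ _ => abs_nonneg _)
    linarith
  have hcard := hanti.sperner
  rw [Fintype.card_coe] at hcard
  refine le_trans (card_le_card_of_injOn (fun x => (symmDiff x N).subtype (· ∈ D)) ?_ ?_) hcard
  · intro x hx
    obtain ⟨hxD, hxv⟩ := mem_filter.1 hx
    rw [mem_powerset] at hxD
    have hsub : symmDiff x N ⊆ D := fun i hi => by
      rcases mem_symmDiff.1 hi with h | h
      · exact hxD h.1
      · exact (mem_filter.1 h.1).1
    have hite : ∀ s ⊆ D, ∀ f : α → ℝ, ∑ i ∈ s, f i = ∑ i ∈ D, if i ∈ s then f i else 0 :=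
      fun s hs f => by rw [sum_ite_mem, inter_eq_right.2 hs]
    rw [mem_coe, mem_filter]
    refine ⟨mem_univ _, ?_⟩
    rw [sum_subtype_of_mem (fun i => |m i|) hsub, eq_sub_iff_add_eq, ← hxv, hite _ hsub,
      hite _ (filter_subset _ D), hite _ hxD, ← sum_add_distrib]
    refine sum_congr rfl fun i hi => ?_
    simp only [mem_symmDiff, hN, mem_filter, hi, true_and]
    rcases lt_or_ge (m i) 0 with h | h
    · rw [abs_of_neg h]
      split_ifs <;> grind
    · rw [abs_of_nonneg h]
      split_ifs <;> grind
  · intro x hx y hy hxy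
    have hxD := mem_powerset.1 (mem_filter.1 hx).1
    have hyD := mem_powerset.1 (mem_filter.1 hy).1
    have h : ∀ i ∈ D, (i ∈ symmDiff x N ↔ i ∈ symmDiff y N) := fun i hi => by
      have := congrArg (fun s => (⟨i, hi⟩ : {i // i ∈ D}) ∈ s) hxy
      simpa using this
    ext i
    by_cases hi : i ∈ D
    · have := h i hi
      simp only [mem_symmDiff] at this
      tauto
    · exact ⟨fun h => absurd (hxD h) hi, fun h => absurd (hyD h) hi⟩

/-- The Littlewood-Offord bound in density form. -/
lemma card_sum_eq_le {D E : Finset α} (hE : E ⊆ D) {m : α → ℝ} (hm : ∀ i ∈ E, m i ≠ 0) (v : ℝ) :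
    (#{x ∈ D.powerset | ∑ i ∈ x, m i = v} : ℝ) ≤ midDensity #E * 2 ^ #D := by
  have hD : #D = #(D \ E) + #E := (card_sdiff_add_card_eq_card hE).symm
  refine (card_le_mul_of_traces (D₁ := D \ E) (D₂ := E) (𝒯 := (D \ E).powerset)
    (K := midDensity #E * 2 ^ #E) ?_ ?_ ?_).trans_eq ?_
  · intro x hx
    rw [sdiff_union_of_subset hE]
    exact mem_powerset.1 (mem_filter.1 hx).1
  · intro x _
    exact mem_powerset.2 inter_subset_right
  · intro u hu
    have hu := mem_powerset.1 hu
    have h := card_sum_eq_le_choose hm (v - ∑ i ∈ u, m i)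
    have hsub : {w ∈ E.powerset | u ∪ w ∈ {x ∈ D.powerset | ∑ i ∈ x, m i = v}} ⊆
        {w ∈ E.powerset | ∑ i ∈ w, m i = v - ∑ i ∈ u, m i} := by
      intro w hw
      simp only [mem_filter, mem_powerset] at hw ⊢
      refine ⟨hw.1, ?_⟩
      rw [← hw.2.2, sum_union (disjoint_of_subset_left hu
        (disjoint_of_subset_right hw.1 sdiff_disjoint))]
      ring
    rw [midDensity, div_mul_cancel₀ _ (by positivity)]
    exact_mod_cast (card_le_card hsub).trans h
  · rw [card_powerset, hD, pow_add]
    push_cast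
    ring

lemma card_sum_eq_or_eq_le {D E : Finset α} (hE : E ⊆ D) {m : α → ℝ} (hm : ∀ i ∈ E, m i ≠ 0)
    (v w : ℝ) :
    (#{x ∈ D.powerset | ∑ i ∈ x, m i = v ∨ ∑ i ∈ x, m i = w} : ℝ) ≤
      2 * midDensity #E * 2 ^ #D := by
  have h1 := card_sum_eq_le hE hm v
  have h2 := card_sum_eq_le hE hm w
  rw [filter_or]
  have h3 := card_union_le {x ∈ D.powerset | ∑ i ∈ x, m i = v} {x ∈ D.powerset | ∑ i ∈ x, m i = w}
  have h3' : (#({x ∈ D.powerset | ∑ i ∈ x, m i = v} ∪ {x ∈ D.powerset | ∑ i ∈ x, m i = w}) : ℝ) ≤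
    #{x ∈ D.powerset | ∑ i ∈ x, m i = v} + #{x ∈ D.powerset | ∑ i ∈ x, m i = w} := by
    exact_mod_cast h3
  linarith

/-- At most three quarters of the subsets have a weight in a two-element set `{v, v + 1}`. -/
lemma card_sum_eq_or_eq_le_three_quarters {D : Finset α} (hD : 2 ≤ #D) {m : α → ℝ}
    (hm : ∀ i ∈ D, m i ≠ 0) (v : ℝ) :
    (#{x ∈ D.powerset | v - ∑ i ∈ x, m i = 0 ∨ v - ∑ i ∈ x, m i = 1} : ℝ) ≤ 3 / 4 * 2 ^ #D := by
  obtain ⟨p, q, hp, hq, hpq⟩ := one_lt_card_iff.1 (show 1 < #D by omega)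
  have hE : {p, q} ⊆ D := by simp [insert_subset_iff, hp, hq]
  have hcE : #({p, q} : Finset α) = 2 := card_pair hpq
  have hcD : #D = #(D \ {p, q}) + 2 := by
    rw [← hcE, card_sdiff_add_card_eq_card hE]
  refine (card_le_mul_of_traces (D₁ := D \ {p, q}) (D₂ := {p, q}) (𝒯 := (D \ {p, q}).powerset)
    (K := 3) ?_ ?_ ?_).trans_eq ?_
  · intro x hx
    rw [sdiff_union_of_subset hE]
    exact mem_powerset.1 (mem_filter.1 hx).1
  · intro x _
    exact mem_powerset.2 inter_subset_right
  · intro u hu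
    have hu := mem_powerset.1 hu
    set 𝒳 := {x ∈ D.powerset | v - ∑ i ∈ x, m i = 0 ∨ v - ∑ i ∈ x, m i = 1} with h𝒳
    have hlt : #{w ∈ ({p, q} : Finset α).powerset | u ∪ w ∈ 𝒳} <
        #({p, q} : Finset α).powerset := by
      refine card_lt_card (ssubset_of_subset_of_ne (filter_subset _ _) fun heq => ?_)
      rw [filter_eq_self] at heq
      have hval : ∀ w ⊆ ({p, q} : Finset α),
          v - ∑ i ∈ u, m i - ∑ i ∈ w, m i = 0 ∨ v - ∑ i ∈ u, m i - ∑ i ∈ w, m i = 1 := by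
        intro w hw
        have := (mem_filter.1 (heq w (mem_powerset.2 hw))).2
        rwa [sum_union (disjoint_of_subset_left hu (disjoint_of_subset_right hw sdiff_disjoint)),
          ← sub_sub] at this
      have h0 := hval ∅ (empty_subset _)
      have h1 := hval {p} (by simp)
      have h2 := hval {q} (by simp)
      have h3 := hval {p, q} subset_rfl
      rw [sum_pair hpq] at h3
      simp only [sum_empty, sum_singleton] at h0 h1 h2
      have hmp := hm p hp
      have hmq := hm q hq
      grind
    rw [card_powerset, hcE] at hlt
    exact_mod_cast (show _ ≤ 3 by omega)
  · rw [card_powerset, hcD, pow_add]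
    push_cast
    ring

/-- Chebyshev's inequality for the size of the trace of a random set. -/
lemma card_trace_deviation_le {I G : Finset α} (hG : G ⊆ I) {d : ℝ} (hd : 0 ≤ d) :
    (#{x ∈ I.powerset | d ≤ 2 * (#(x ∩ G) : ℝ) - #G} : ℝ) * d ^ 2 ≤ (#G : ℝ) * 2 ^ #I := by
  have hvar : ∀ G : Finset α, ∑ x ∈ G.powerset, (2 * (#x : ℝ) - #G) ^ 2 = (#G : ℝ) * 2 ^ #G := by
    intro G
    have : ∀ G : Finset α, ∑ x ∈ G.powerset, (2 * (#x : ℝ) - #G) = 0 ∧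
        ∑ x ∈ G.powerset, (2 * (#x : ℝ) - #G) ^ 2 = (#G : ℝ) * 2 ^ #G := by
      intro G
      induction G using Finset.induction_on with
      | empty => simp
      | insert a G ha ih =>
        have hins : ∀ x ∈ G.powerset, (#(insert a x) : ℝ) = #x + 1 := fun x hx => by
          rw [card_insert_of_notMem fun h => ha (mem_powerset.1 hx h)]
          push_cast
          ring
        rw [sum_powerset_insert ha, sum_powerset_insert ha, card_insert_of_notMem ha]
        constructor
        · rw [← sum_add_distrib]
          calc _ = ∑ x ∈ G.powerset, 2 * (2 * (#x : ℝ) - #G) :=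
                sum_congr rfl fun x hx => by rw [hins x hx]; push_cast; ring
            _ = 0 := by rw [← mul_sum, ih.1, mul_zero]
        · rw [← sum_add_distrib]
          calc _ = ∑ x ∈ G.powerset, (2 * (2 * (#x : ℝ) - #G) ^ 2 + 2) :=
                sum_congr rfl fun x hx => by rw [hins x hx]; push_cast; ring
            _ = _ := by
                rw [sum_add_distrib, ← mul_sum, ih.2, sum_const, card_powerset, nsmul_eq_mul]
                push_cast
                ring
    exact (this G).2
  set 𝒯 := {y ∈ G.powerset | d ≤ 2 * (#y : ℝ) - #G} with h𝒯
  have h1 : (#𝒯 : ℝ) * d ^ 2 ≤ (#G : ℝ) * 2 ^ #G := by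
    rw [← hvar, ← nsmul_eq_mul]
    refine (card_nsmul_le_sum 𝒯 _ _ fun y hy => ?_).trans
      (sum_le_sum_of_subset_of_nonneg (filter_subset _ _) fun _ _ _ => sq_nonneg _)
    exact pow_le_pow_left₀ hd (mem_filter.1 hy).2 2
  have h2 := card_le_mul_of_traces (D₁ := G) (D₂ := I \ G) (𝒯 := 𝒯) (K := 2 ^ #(I \ G))
    (𝒳 := {x ∈ I.powerset | d ≤ 2 * (#(x ∩ G) : ℝ) - #G})
    (fun x hx => by
      rw [union_sdiff_of_subset hG]
      exact mem_powerset.1 (mem_filter.1 hx).1)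
    (fun x hx => mem_filter.2 ⟨mem_powerset.2 inter_subset_right, (mem_filter.1 hx).2⟩)
    (fun u _ => by
      have := card_le_card (filter_subset (fun v => u ∪ v ∈
        {x ∈ I.powerset | d ≤ 2 * (#(x ∩ G) : ℝ) - #G}) (I \ G).powerset)
      rw [card_powerset] at this
      exact_mod_cast this)
  rw [← card_sdiff_add_card_eq_card hG, pow_add]
  calc _ ≤ (#𝒯 * 2 ^ #(I \ G)) * d ^ 2 := by gcongr
    _ = (#𝒯 * d ^ 2) * 2 ^ #(I \ G) := by ring
    _ ≤ (#G * 2 ^ #G) * 2 ^ #(I \ G) := by gcongr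
    _ = _ := by ring

/-- The number of points of a cube at which an affine function depending on all coordinates takes
a value in `{0, 1}`. -/
lemma card_zero_or_one_sq_mul_le {D : Finset α} (hD : D.Nonempty) {m : α → ℝ}
    (hm : ∀ i ∈ D, m i ≠ 0) (v : ℝ)
    (h1 : ∀ i, D = {i} → ¬ ((v = 0 ∨ v = 1) ∧ (v - m i = 0 ∨ v - m i = 1))) :
    (#{x ∈ D.powerset | v - ∑ i ∈ x, m i = 0 ∨ v - ∑ i ∈ x, m i = 1} : ℝ) ^ 2 * (16 + #D) ≤
      16 * (2 ^ #D) ^ 2 := by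
  set 𝒢 := {x ∈ D.powerset | v - ∑ i ∈ x, m i = 0 ∨ v - ∑ i ∈ x, m i = 1} with h𝒢
  have hpos := hD.card_pos
  have hp : (0 : ℝ) ≤ (2 ^ #D) ^ 2 := by positivity
  rcases (show #D = 1 ∨ 2 ≤ #D by omega) with hD1 | hD2
  · obtain ⟨i, rfl⟩ := card_eq_one.1 hD1
    have hlt : #𝒢 < #({i} : Finset α).powerset := by
      refine card_lt_card (ssubset_of_subset_of_ne (filter_subset _ _) fun heq => h1 i rfl ?_)
      rw [filter_eq_self] at heq
      have ha := heq ∅ (by simp)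
      have hb := heq {i} (by simp)
      rw [sum_empty, sub_zero] at ha
      rw [sum_singleton] at hb
      exact ⟨ha, hb⟩
    rw [card_powerset, card_singleton] at hlt
    have hle : (#𝒢 : ℝ) ≤ 1 := by exact_mod_cast (show #𝒢 ≤ 1 by omega)
    have h0 : (0 : ℝ) ≤ #𝒢 := Nat.cast_nonneg _
    rw [card_singleton]
    push_cast
    nlinarith
  · have hg0 : (0 : ℝ) ≤ #𝒢 := Nat.cast_nonneg _
    by_cases hD12 : #D ≤ 12
    · have hg := card_sum_eq_or_eq_le_three_quarters hD2 hm v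
      have hg2 : (#𝒢 : ℝ) ^ 2 ≤ 9 / 16 * (2 ^ #D) ^ 2 :=
        (pow_le_pow_left₀ hg0 hg 2).trans_eq (by ring)
      have hr : (#D : ℝ) ≤ 12 := by exact_mod_cast hD12
      nlinarith [mul_nonneg hp (sub_nonneg.2 hr), Nat.cast_nonneg (α := ℝ) #D]
    · have hg : (#𝒢 : ℝ) ≤ 2 * midDensity #D * 2 ^ #D := by
        refine le_trans ?_ (card_sum_eq_or_eq_le subset_rfl hm v (v - 1))
        refine Nat.cast_le.2 (card_le_card fun x hx => ?_)
        obtain ⟨hx, hv⟩ := mem_filter.1 hx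
        refine mem_filter.2 ⟨hx, hv.imp (fun h => ?_) fun h => ?_⟩ <;> linarith
      have hg2 : (#𝒢 : ℝ) ^ 2 ≤ 4 * midDensity #D ^ 2 * (2 ^ #D) ^ 2 :=
        (pow_le_pow_left₀ hg0 hg 2).trans_eq (by ring)
      have hw := midDensity_sq_mul_succ_le #D
      have hr : (12 : ℝ) ≤ #D := by exact_mod_cast (show 12 ≤ #D by omega)
      have hw0 := sq_nonneg (midDensity #D)
      calc (#𝒢 : ℝ) ^ 2 * (16 + #D) ≤ 4 * midDensity #D ^ 2 * (2 ^ #D) ^ 2 * (16 + #D) := by gcongr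
        _ = (midDensity #D ^ 2 * (64 + 4 * #D)) * (2 ^ #D) ^ 2 := by ring
        _ ≤ 16 * (2 ^ #D) ^ 2 := by
            gcongr
            nlinarith

/-- A dense family on which some affine functions take only the values `0` and `1` admits a small
set of coordinates and a restriction to them after which each of the functions depends on at most
one further coordinate. -/
lemma exists_restriction {ι : Type*} {D : Finset α} {𝒴 : Finset (Finset α)} (hne : 𝒴.Nonempty)
    (h𝒴 : ∀ y ∈ 𝒴, y ⊆ D) (ℛ : Set ι) (M : ι → α → ℝ) (c : ι → ℝ)
    (hM : ∀ r ∈ ℛ, ∀ y ∈ 𝒴, c r - ∑ j ∈ y, M r j = 0 ∨ c r - ∑ j ∈ y, M r j = 1) :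
    ∃ S ⊆ D, ∃ η ⊆ S, (#𝒴 : ℝ) ^ 2 * (16 + #S) ≤ 16 * (2 ^ #D) ^ 2 ∧ ∀ r ∈ ℛ,
      (c r - ∑ j ∈ η, M r j = 0 ∨ c r - ∑ j ∈ η, M r j = 1) ∧
      ∀ i ∈ D \ S, M r i ≠ 0 →
        (c r - ∑ j ∈ η, M r j - M r i = 0 ∨ c r - ∑ j ∈ η, M r j - M r i = 1) ∧
        ∀ i' ∈ D \ S, M r i' ≠ 0 → i' = i := by
  classical
  let F : Finset α × Finset α → Finset (Finset α) := fun p => {y ∈ 𝒴 | y ∩ p.1 = p.2}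
  set 𝒞 := {p ∈ D.powerset ×ˢ D.powerset | p.2 ⊆ p.1 ∧
    (#𝒴 : ℝ) ^ 2 * (16 + #p.1) ≤ 16 * (#(F p) * 2 ^ #p.1) ^ 2} with h𝒞
  have hemp : (∅, ∅) ∈ 𝒞 := by
    have : F (∅, ∅) = 𝒴 := filter_eq_self.2 fun y _ => by simp
    simp only [h𝒞, mem_filter, mem_product, mem_powerset, empty_subset, and_self, true_and, this]
    simp
    linarith
  obtain ⟨⟨S, η⟩, hmem, hmax⟩ := exists_max_image 𝒞 (fun p => #p.1) ⟨_, hemp⟩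
  simp only [h𝒞, mem_filter, mem_product, mem_powerset] at hmem
  obtain ⟨⟨hSD, -⟩, hηS, hcard⟩ := hmem
  have hY : (0 : ℝ) < #𝒴 := by exact_mod_cast hne.card_pos
  have hF0 : (0 : ℝ) < #(F (S, η)) := by
    rcases (Nat.cast_nonneg (α := ℝ) #(F (S, η))).eq_or_lt with h | h
    · rw [← h] at hcard
      have : (0 : ℝ) < (#𝒴 : ℝ) ^ 2 * (16 + #S) := by positivity
      norm_num at hcard
      linarith
    · exact h
  have hFne : (F (S, η)).Nonempty := card_pos.1 (by exact_mod_cast hF0)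
  have hFsub : ∀ y ∈ F (S, η), y ∈ 𝒴 ∧ y ⊆ D ∧ y ∩ S = η := fun y hy =>
    ⟨(mem_filter.1 hy).1, h𝒴 y (mem_filter.1 hy).1, (mem_filter.1 hy).2⟩
  refine ⟨S, hSD, η, hηS, ?_, ?_⟩
  · refine hcard.trans ?_
    have h : #(F (S, η)) ≤ 2 ^ #(D \ S) := by
      rw [← card_powerset]
      refine card_le_card_of_injOn (fun y => y \ S) (fun y hy => ?_) fun y hy z hz hyz => ?_
      · exact mem_coe.2 (mem_powerset.2 (sdiff_subset_sdiff (hFsub y hy).2.1 subset_rfl))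
      · simp only at hyz
        rw [← sdiff_union_inter y S, ← sdiff_union_inter z S, hyz, (hFsub y hy).2.2,
          (hFsub z hz).2.2]
    have h' : (#(F (S, η)) : ℝ) ≤ 2 ^ #(D \ S) := by exact_mod_cast h
    rw [← card_sdiff_add_card_eq_card hSD, pow_add]
    gcongr
  · intro r hr
    set D' := {j ∈ D \ S | M r j ≠ 0} with hD'
    set γ := c r - ∑ j ∈ η, M r j with hγ
    have hD'D : D' ⊆ D := (filter_subset _ _).trans sdiff_subset
    have hD'S : Disjoint S D' := disjoint_of_subset_right (filter_subset _ _) disjoint_sdiff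
    have hval : ∀ y ∈ F (S, η), γ - ∑ j ∈ y ∩ D', M r j = 0 ∨ γ - ∑ j ∈ y ∩ D', M r j = 1 := by
      intro y hy
      obtain ⟨hy, hyD, hyS⟩ := hFsub y hy
      have h1 : ∑ j ∈ y, M r j = ∑ j ∈ η, M r j + ∑ j ∈ y ∩ D', M r j := by
        rw [← sum_inter_add_sum_sdiff y S, hyS]
        congr 1
        refine (sum_subset (fun j hj => ?_) fun j hj hj' => ?_).symm
        · rw [mem_inter] at hj
          exact mem_sdiff.2 ⟨hj.1, fun h => disjoint_left.1 hD'S h hj.2⟩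
        · rw [mem_sdiff] at hj
          by_contra h
          exact hj' (mem_inter.2 ⟨hj.1, mem_filter.2 ⟨mem_sdiff.2 ⟨hyD hj.1, hj.2⟩, h⟩⟩)
      have := hM r hr y hy
      rwa [h1, ← sub_sub] at this
    by_contra hbad
    have hD'ne : D'.Nonempty := by
      rw [nonempty_iff_ne_empty]
      intro hempty
      apply hbad
      obtain ⟨y, hy⟩ := hFne
      have := hval y hy
      rw [hempty] at this
      refine ⟨by simpa using this, fun i hi hMi => ?_⟩
      exact absurd (hempty ▸ mem_filter.2 ⟨hi, hMi⟩ : i ∈ (∅ : Finset α)) (notMem_empty i)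
    have hsingle : ∀ i, D' = {i} →
        ¬ ((γ = 0 ∨ γ = 1) ∧ (γ - M r i = 0 ∨ γ - M r i = 1)) := by
      rintro i hi ⟨h1, h2⟩
      have hmem' : ∀ j ∈ D \ S, M r j ≠ 0 → j = i := fun j hj hMj =>
        mem_singleton.1 (hi ▸ mem_filter.2 ⟨hj, hMj⟩)
      refine hbad ⟨h1, fun j hj hMj => ?_⟩
      obtain rfl := hmem' j hj hMj
      exact ⟨h2, hmem'⟩
    have hgood := card_zero_or_one_sq_mul_le hD'ne (fun i hi => (mem_filter.1 hi).2) γ hsingle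
    set 𝒢 := {x ∈ D'.powerset | γ - ∑ i ∈ x, M r i = 0 ∨ γ - ∑ i ∈ x, M r i = 1} with h𝒢
    have hmaps : ∀ y ∈ F (S, η), y ∩ D' ∈ 𝒢 := fun y hy =>
      mem_filter.2 ⟨mem_powerset.2 inter_subset_right, hval y hy⟩
    have h𝒢ne : 𝒢.Nonempty := hFne.elim fun y hy => ⟨_, hmaps y hy⟩
    have hg0 : (0 : ℝ) < #𝒢 := by exact_mod_cast h𝒢ne.card_pos
    obtain ⟨u, hu, hle⟩ := exists_le_card_fiber_of_nsmul_le_card_of_maps_to hmaps h𝒢ne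
      (b := (#(F (S, η)) : ℝ) / #𝒢) (by rw [nsmul_eq_mul, mul_div_cancel₀ _ hg0.ne'])
    have huD' := mem_powerset.1 (mem_filter.1 hu).1
    have hsub : {y ∈ F (S, η) | y ∩ D' = u} ⊆ F (S ∪ D', η ∪ u) := by
      intro y hy
      obtain ⟨hyF, hyu⟩ := mem_filter.1 hy
      refine mem_filter.2 ⟨(hFsub y hyF).1, ?_⟩
      rw [inter_union_distrib_left, (hFsub y hyF).2.2, hyu]
    have hle' : (#(F (S, η)) : ℝ) / #𝒢 ≤ #(F (S ∪ D', η ∪ u)) :=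
      hle.trans (Nat.cast_le.2 (card_le_card hsub))
    rw [div_le_iff₀ hg0] at hle'
    have hcardS : #(S ∪ D') = #S + #D' := card_union_of_disjoint hD'S
    have hnew : (S ∪ D', η ∪ u) ∈ 𝒞 := by
      simp only [h𝒞, mem_filter, mem_product, mem_powerset]
      refine ⟨⟨union_subset hSD hD'D, union_subset (hηS.trans hSD) (huD'.trans hD'D)⟩,
        union_subset_union hηS huD', ?_⟩
      rw [hcardS, pow_add]
      push_cast
      have hsq : (#(F (S, η)) : ℝ) ^ 2 ≤ (#(F (S ∪ D', η ∪ u)) * #𝒢) ^ 2 :=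
        pow_le_pow_left₀ hF0.le hle' 2
      set f := (#(F (S, η)) : ℝ)
      set f' := (#(F (S ∪ D', η ∪ u)) : ℝ)
      set g := (#𝒢 : ℝ)
      set s := (#S : ℝ)
      set q := (#D' : ℝ)
      set P := (2 : ℝ) ^ #S
      set Q := (2 : ℝ) ^ #D'
      have hs : 0 ≤ s := Nat.cast_nonneg _
      have hq : 0 ≤ q := Nat.cast_nonneg _
      have hg2 : 0 < g ^ 2 := by positivity
      refine le_of_mul_le_mul_right ?_ hg2
      calc (#𝒴 : ℝ) ^ 2 * (16 + (s + q)) * g ^ 2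
          ≤ (#𝒴 : ℝ) ^ 2 * ((16 + s) * (16 + q) / 16) * g ^ 2 := by
            gcongr
            nlinarith [mul_nonneg hs hq]
        _ = ((#𝒴 : ℝ) ^ 2 * (16 + s)) * (g ^ 2 * (16 + q)) / 16 := by ring
        _ ≤ (16 * (f * P) ^ 2) * (16 * Q ^ 2) / 16 := by gcongr
        _ = f ^ 2 * (16 * (P * Q) ^ 2) := by ring
        _ ≤ (f' * g) ^ 2 * (16 * (P * Q) ^ 2) := by gcongr
        _ = _ := by ring
    have := hmax _ hnew
    simp only [hcardS] at this
    have := hD'ne.card_pos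
    omega

lemma card_sum_mem_le {D E : Finset α} (hE : E ⊆ D) {m : α → ℝ} (hm : ∀ i ∈ E, m i ≠ 0)
    (V : Finset ℝ) :
    (#{x ∈ D.powerset | ∑ i ∈ x, m i ∈ V} : ℝ) ≤ #V * (midDensity #E * 2 ^ #D) := by
  have hsub : {x ∈ D.powerset | ∑ i ∈ x, m i ∈ V} ⊆
      V.biUnion fun v => {x ∈ D.powerset | ∑ i ∈ x, m i = v} := by
    intro x hx
    obtain ⟨hx, hv⟩ := mem_filter.1 hx
    exact mem_biUnion.2 ⟨_, hv, mem_filter.2 ⟨hx, rfl⟩⟩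
  have h := (card_le_card hsub).trans card_biUnion_le
  have h' : (#{x ∈ D.powerset | ∑ i ∈ x, m i ∈ V} : ℝ) ≤
      ∑ v ∈ V, (#{x ∈ D.powerset | ∑ i ∈ x, m i = v} : ℝ) := by exact_mod_cast h
  refine h'.trans ((sum_le_card_nsmul _ _ _ fun v _ => card_sum_eq_le hE hm v).trans_eq ?_)
  rw [nsmul_eq_mul]

/-- If no value is taken by `m` on almost all of `G`, then `G` contains many disjoint pairs of
points at which `m` takes distinct values. -/
lemma exists_disjoint_pairs (m : α → ℝ) (N : ℕ) :
    ∀ G : Finset α, (∀ v, 2 * N ≤ #{i ∈ G | m i ≠ v}) →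
      ∃ H ⊆ G, #H = N ∧ ∃ u : α → α, Set.InjOn u H ∧ (∀ i ∈ H, u i ∈ G \ H) ∧
        ∀ i ∈ H, m i ≠ m (u i) := by
  induction N with
  | zero => exact fun G _ => ⟨∅, by simp, rfl, id, by simp, by simp, by simp⟩
  | succ N ih =>
    intro G hG
    obtain ⟨i, hi⟩ : {i ∈ G | m i ≠ 0}.Nonempty := card_pos.1 (by have := hG 0; omega)
    obtain ⟨j, hj⟩ : {j ∈ G | m j ≠ m i}.Nonempty := card_pos.1 (by have := hG (m i); omega)
    have hiG := (mem_filter.1 hi).1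
    obtain ⟨hjG, hji⟩ := mem_filter.1 hj
    have hij : i ≠ j := fun h => hji (by rw [h])
    obtain ⟨H, hH, hcard, u, hinj, hmaps, hne⟩ := ih (G \ {i, j}) fun v => by
      have h1 := hG v
      have h2 : #{k ∈ G | m k ≠ v} ≤ #{k ∈ G \ {i, j} | m k ≠ v} + #({i, j} : Finset α) := by
        refine (card_le_card fun k hk => ?_).trans (card_union_le _ _)
        obtain ⟨hk, hkv⟩ := mem_filter.1 hk
        by_cases h : k ∈ ({i, j} : Finset α)
        · exact mem_union_right _ h
        · exact mem_union_left _ (mem_filter.2 ⟨mem_sdiff.2 ⟨hk, h⟩, hkv⟩)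
      rw [card_pair hij] at h2
      omega
    have hout : ∀ k ∈ G \ {i, j}, k ∈ G ∧ k ≠ i ∧ k ≠ j := fun k hk => by
      simpa using hk
    have hiH : i ∉ H := fun h => (hout i (hH h)).2.1 rfl
    have hjH : j ∉ H := fun h => (hout j (hH h)).2.2 rfl
    have hu : ∀ k ∈ H, u k ∈ G ∧ u k ≠ i ∧ u k ≠ j ∧ u k ∉ H := fun k hk => by
      obtain ⟨h1, h2⟩ := mem_sdiff.1 (hmaps k hk)
      obtain ⟨h3, h4, h5⟩ := hout _ h1
      exact ⟨h3, h4, h5, h2⟩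
    have hki : ∀ k ∈ H, k ≠ i := fun k hk h => hiH (h ▸ hk)
    refine ⟨insert i H, insert_subset hiG fun k hk => (hout k (hH hk)).1, ?_,
      Function.update u i j, ?_, ?_, ?_⟩
    · rw [card_insert_of_notMem hiH, hcard]
    · intro a ha b hb hab
      rw [coe_insert, Set.mem_insert_iff, mem_coe] at ha hb
      rcases ha with rfl | ha <;> rcases hb with rfl | hb
      · rfl
      · rw [Function.update_self, Function.update_of_ne (hki b hb)] at hab
        exact absurd hab.symm (hu b hb).2.2.1
      · rw [Function.update_self, Function.update_of_ne (hki a ha)] at hab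
        exact absurd hab (hu a ha).2.2.1
      · rw [Function.update_of_ne (hki a ha), Function.update_of_ne (hki b hb)] at hab
        exact hinj ha hb hab
    · intro k hk
      rcases mem_insert.1 hk with rfl | hk
      · rw [Function.update_self]
        simp [hjG, hij.symm, hjH]
      · rw [Function.update_of_ne (hki k hk)]
        obtain ⟨h1, h2, -, h4⟩ := hu k hk
        simp [h1, h2, h4]
    · intro k hk
      rcases mem_insert.1 hk with rfl | hk
      · rw [Function.update_self]
        exact hji.symm
      · rw [Function.update_of_ne (hki k hk)]
        exact hne k hk

lemma sum_powerset_midDensity_sq_le {β : Type*} (H : Finset β) :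
    (∑ s ∈ H.powerset, midDensity #s) ^ 2 * (#H + 1) ≤ 2 * (2 ^ #H) ^ 2 := by
  have h1 : ∑ s ∈ H.powerset, midDensity #s ^ 2 ≤ ∑ s ∈ H.powerset, 1 / ((#s : ℝ) + 1) := by
    refine sum_le_sum fun s _ => ?_
    rw [le_div_iff₀ (by positivity)]
    exact midDensity_sq_mul_succ_le _
  have h2 : (∑ s ∈ H.powerset, 1 / ((#s : ℝ) + 1)) * (#H + 1) ≤ 2 * 2 ^ #H := by
    rw [sum_powerset_apply_card fun k => 1 / ((k : ℝ) + 1), sum_mul]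
    calc _ = ∑ k ∈ range (#H + 1), ((#H + 1).choose (k + 1) : ℝ) := by
          refine sum_congr rfl fun k _ => ?_
          have := Nat.add_one_mul_choose_eq #H k
          have h : ((#H : ℝ) + 1) * (#H).choose k = (#H + 1).choose (k + 1) * (k + 1) := by
            exact_mod_cast this
          rw [nsmul_eq_mul]
          field_simp
          linarith
      _ ≤ ∑ k ∈ range (#H + 1 + 1), ((#H + 1).choose k : ℝ) := by
          rw [sum_range_succ' _ (#H + 1)]
          simp
      _ = 2 * 2 ^ #H := by
          have := Nat.sum_range_choose (#H + 1)
          rw [← pow_succ']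
          exact_mod_cast this
  have h3 := sq_sum_le_card_mul_sum_sq (s := H.powerset) (f := fun s => midDensity #s)
  rw [card_powerset] at h3
  push_cast at h3
  calc _ ≤ (2 ^ #H * ∑ s ∈ H.powerset, 1 / ((#s : ℝ) + 1)) * (#H + 1) := by
        gcongr
        exact h3.trans (by gcongr)
    _ = 2 ^ #H * ((∑ s ∈ H.powerset, 1 / ((#s : ℝ) + 1)) * (#H + 1)) := by ring
    _ ≤ 2 ^ #H * (2 * 2 ^ #H) := by gcongr
    _ = _ := by ring

/-- The weights obtained from `f` when exactly one element of `{i, u i}` is chosen for `i ∈ s` and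
both or none for `i ∈ H \ s`. -/
def foldWeight (H s : Finset α) (u : α → α) (f : α → ℝ) (i : α) : ℝ :=
  f i + if i ∈ H then (if i ∈ s then -f (u i) else f (u i)) else 0

lemma sum_eq_sum_foldWeight {H x : Finset α} {u : α → α} (hu : Set.InjOn u H)
    (hd : ∀ i ∈ H, u i ∉ H) (f : α → ℝ) :
    ∑ i ∈ x, f i =
      ∑ i ∈ x \ H.image u, foldWeight H {i ∈ H | ¬ (i ∈ x ↔ u i ∈ x)} u f i +
        ∑ i ∈ H with ¬ (i ∈ x ↔ u i ∈ x), f (u i) := by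
  set s := {i ∈ H | ¬ (i ∈ x ↔ u i ∈ x)} with hs
  have h1 : ∑ i ∈ x ∩ H.image u, f i = ∑ i ∈ H, if u i ∈ x then f (u i) else 0 := by
    rw [← sum_filter, ← sum_image (f := f) (hu.mono (filter_subset _ _))]
    refine sum_congr ?_ fun _ _ => rfl
    ext i
    simp only [mem_inter, mem_image, mem_filter]
    constructor
    · rintro ⟨hi, j, hj, rfl⟩
      exact ⟨j, ⟨hj, hi⟩, rfl⟩
    · rintro ⟨j, ⟨hj, hi⟩, rfl⟩
      exact ⟨hi, j, hj, rfl⟩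
  have h2 : (x \ H.image u) ∩ H = {i ∈ H | i ∈ x} := by
    ext i
    simp only [mem_inter, mem_sdiff, mem_image, mem_filter, not_exists, not_and]
    constructor
    · exact fun h => ⟨h.2, h.1.1⟩
    · rintro ⟨h, h'⟩
      refine ⟨⟨h', fun j hj hji => hd j hj (hji ▸ h)⟩, h⟩
  simp only [foldWeight]
  rw [← sum_inter_add_sum_sdiff x (H.image u) f, h1, sum_add_distrib, sum_ite_mem, h2, sum_filter,
    sum_filter, add_comm, add_assoc, add_right_inj, ← sum_add_distrib]
  refine sum_congr rfl fun i hi => ?_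
  simp only [hs, mem_filter, hi, true_and]
  by_cases hx : i ∈ x <;> by_cases hux : u i ∈ x <;> simp [hx, hux]

lemma card_sq_mul_le_of_disjoint_pairs {I G H : Finset α} (hG : G ⊆ I) (hH : H ⊆ G) {u : α → α}
    (hu : Set.InjOn u H) (hmaps : ∀ i ∈ H, u i ∈ G \ H) {m : α → ℝ}
    (hm : ∀ i ∈ H, m i ≠ m (u i)) {𝒳 : Finset (Finset α)} (h𝒳 : ∀ x ∈ 𝒳, x ⊆ I) {V : Finset ℝ}
    (hwin : ∀ x ∈ 𝒳, (#(x ∩ G) : ℝ) ∈ V)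
    (hval : ∀ x ∈ 𝒳, ∑ i ∈ x, m i = 0 ∨ ∑ i ∈ x, m i = 1) :
    (#𝒳 : ℝ) ^ 2 * (#H + 1) ≤ 8 * (#V : ℝ) ^ 2 * midDensity (#G - 2 * #H) ^ 2 * (2 ^ #I) ^ 2 := by
  set s : Finset α → Finset α := fun x => {i ∈ H | ¬ (i ∈ x ↔ u i ∈ x)} with hs
  have hd : ∀ i ∈ H, u i ∉ H := fun i hi => (mem_sdiff.1 (hmaps i hi)).2
  have hHI := hH.trans hG
  have huG : H.image u ⊆ G := fun i hi => by
    obtain ⟨j, hj, rfl⟩ := mem_image.1 hi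
    exact (mem_sdiff.1 (hmaps j hj)).1
  have hHu : Disjoint H (H.image u) := disjoint_right.2 fun i hi => by
    obtain ⟨j, hj, rfl⟩ := mem_image.1 hi
    exact hd j hj
  have hcu : #(H.image u) = #H := card_image_of_injOn hu
  set w := midDensity (#G - 2 * #H) with hw
  have hfib : ∀ t ∈ H.powerset, (#{x ∈ 𝒳 | s x = t} : ℝ) ≤
      2 * #V * w * 2 ^ (#I - #H) * midDensity #t := by
    intro t ht
    have htH := mem_powerset.1 ht
    have hinj : Set.InjOn (fun x => x \ H.image u) ({x ∈ 𝒳 | s x = t} : Finset (Finset α)) := by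
      intro x hx y hy hxy
      have hx := (mem_filter.1 hx).2
      have hy := (mem_filter.1 hy).2
      simp only at hxy
      have hout : ∀ i, i ∉ H.image u → (i ∈ x ↔ i ∈ y) := fun i hi => by
        have := congrArg (i ∈ ·) hxy
        simpa [mem_sdiff, -mem_image, hi] using this
      ext i
      by_cases hi : i ∈ H.image u
      · obtain ⟨j, hj, rfl⟩ := mem_image.1 hi
        have h1 := hout j (disjoint_left.1 hHu hj)
        have h2 : j ∈ s x ↔ j ∈ s y := by rw [hx, hy]
        simp only [hs, mem_filter, hj, true_and] at h2
        tauto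
      · exact hout i hi
    rw [← card_image_of_injOn hinj]
    have htD : t ⊆ I \ H.image u := fun i hi => mem_sdiff.2 ⟨hHI (htH hi),
      disjoint_left.1 hHu (htH hi)⟩
    have hdec : ((I \ H.image u) \ t) ∪ t = I \ H.image u := sdiff_union_of_subset htD
    set c := ∑ i ∈ t, (fun i => if i ∈ G then (1 : ℝ) else 0) (u i) with hc
    set c' := ∑ i ∈ t, m (u i) with hc'
    set 𝒯 := {y ∈ ((I \ H.image u) \ t).powerset |
      ∑ i ∈ y, foldWeight H t u (fun i => if i ∈ G then 1 else 0) i ∈ V.image (· - c)} with h𝒯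
    have hzero : ∀ i ∈ t, foldWeight H t u (fun i => if i ∈ G then 1 else 0) i = 0 := by
      intro i hi
      simp [foldWeight, htH hi, hi, hH (htH hi), (mem_sdiff.1 (hmaps i (htH hi))).1]
    have hmain := card_le_mul_of_traces (D₁ := (I \ H.image u) \ t) (D₂ := t)
      (𝒳 := {x ∈ 𝒳 | s x = t}.image fun x => x \ H.image u) (𝒯 := 𝒯)
      (K := 2 * midDensity #t * 2 ^ #t) ?_ ?_ ?_
    · have hT : (#𝒯 : ℝ) ≤ #V * (w * 2 ^ (#I - #H - #t)) := by
        have hE : G \ (H ∪ H.image u) ⊆ (I \ H.image u) \ t := by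
          intro i hi
          simp only [mem_sdiff, mem_union, not_or] at hi ⊢
          exact ⟨⟨hG hi.1, hi.2.2⟩, fun h => hi.2.1 (htH h)⟩
        have := card_sum_mem_le hE
          (m := foldWeight H t u (fun i => if i ∈ G then 1 else 0)) (fun i hi => by
            simp only [mem_sdiff, mem_union, not_or] at hi
            simp [foldWeight, hi.1, hi.2.1]) (V.image (· - c))
        rw [card_sdiff_of_subset htD, card_sdiff_of_subset (huG.trans hG), hcu,
          card_sdiff_of_subset (union_subset hH huG), card_union_of_disjoint hHu, hcu,
          ← two_mul] at this
        refine this.trans ?_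
        have hV : (#(V.image (· - c)) : ℝ) ≤ #V := Nat.cast_le.2 card_image_le
        have hw0 := midDensity_pos (#G - 2 * #H)
        gcongr
      refine hmain.trans ?_
      have hct : #t ≤ #I - #H := by
        have := card_le_card htD
        rwa [card_sdiff_of_subset (huG.trans hG), hcu] at this
      calc (#𝒯 : ℝ) * (2 * midDensity #t * 2 ^ #t)
          ≤ (#V * (w * 2 ^ (#I - #H - #t))) * (2 * midDensity #t * 2 ^ #t) := by
            have := midDensity_pos #t
            gcongr
        _ = 2 * #V * w * (2 ^ (#I - #H - #t) * 2 ^ #t) * midDensity #t := by ring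
        _ = _ := by rw [← pow_add, Nat.sub_add_cancel hct]
    · intro y hy
      obtain ⟨x, hx, rfl⟩ := mem_image.1 hy
      rw [hdec]
      exact sdiff_subset_sdiff (h𝒳 x (mem_filter.1 hx).1) subset_rfl
    · intro y hy
      obtain ⟨x, hx, rfl⟩ := mem_image.1 hy
      obtain ⟨hx, hxt⟩ := mem_filter.1 hx
      refine mem_filter.2 ⟨mem_powerset.2 inter_subset_right, ?_⟩
      refine mem_image.2 ⟨_, hwin x hx, ?_⟩
      have h1 := sum_eq_sum_foldWeight (x := x) hu hd (fun i => if i ∈ G then (1 : ℝ) else 0)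
      rw [show {i ∈ H | ¬ (i ∈ x ↔ u i ∈ x)} = t from hxt] at h1
      have h2 : ∑ i ∈ x, (if i ∈ G then (1 : ℝ) else 0) = #(x ∩ G) := by
        rw [sum_ite_mem, sum_const, nsmul_eq_mul, mul_one]
      have h3 : ∑ i ∈ (x \ H.image u) ∩ ((I \ H.image u) \ t),
          foldWeight H t u (fun i => if i ∈ G then 1 else 0) i =
          ∑ i ∈ x \ H.image u, foldWeight H t u (fun i => if i ∈ G then 1 else 0) i := by
        refine sum_subset inter_subset_left fun i hi hi' => hzero i ?_
        by_contra hit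
        exact hi' (mem_inter.2 ⟨hi, mem_sdiff.2 ⟨sdiff_subset_sdiff (h𝒳 x hx) subset_rfl hi, hit⟩⟩)
      rw [h3]
      linarith
    · intro z hz
      have hz := mem_powerset.1 (mem_filter.1 hz).1
      refine le_trans ?_ (card_sum_eq_or_eq_le subset_rfl
        (m := fun i => m i - m (u i)) (fun i hi => sub_ne_zero.2 (hm i (htH hi)))
        (0 - c' - ∑ i ∈ z, foldWeight H t u m i) (1 - c' - ∑ i ∈ z, foldWeight H t u m i))
      refine Nat.cast_le.2 (card_le_card fun o ho => ?_)
      obtain ⟨ho, hx⟩ := mem_filter.1 ho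
      refine mem_filter.2 ⟨ho, ?_⟩
      have ho := mem_powerset.1 ho
      obtain ⟨x, hx, hxz⟩ := mem_image.1 hx
      obtain ⟨hx, hxt⟩ := mem_filter.1 hx
      have h1 := sum_eq_sum_foldWeight (x := x) hu hd m
      rw [show {i ∈ H | ¬ (i ∈ x ↔ u i ∈ x)} = t from hxt, hxz, sum_union
        (disjoint_of_subset_left hz (disjoint_of_subset_right ho sdiff_disjoint))] at h1
      have h2 : ∑ i ∈ o, foldWeight H t u m i = ∑ i ∈ o, (m i - m (u i)) := by
        refine sum_congr rfl fun i hi => ?_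
        simp [foldWeight, ho hi, htH (ho hi), sub_eq_add_neg]
      refine (hval x hx).imp (fun h => ?_) fun h => ?_ <;> linarith
  have hsum : (#𝒳 : ℝ) ≤ 2 * #V * w * 2 ^ (#I - #H) * ∑ t ∈ H.powerset, midDensity #t := by
    rw [card_eq_sum_card_fiberwise (f := s) (t := H.powerset)
      (fun x _ => mem_coe.2 (mem_powerset.2 (filter_subset _ _))), mul_sum]
    push_cast
    exact sum_le_sum hfib
  have h2 := sum_powerset_midDensity_sq_le H
  calc (#𝒳 : ℝ) ^ 2 * (#H + 1)
      ≤ (2 * #V * w * 2 ^ (#I - #H) * ∑ t ∈ H.powerset, midDensity #t) ^ 2 * (#H + 1) := by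
        gcongr
    _ = 4 * (#V : ℝ) ^ 2 * w ^ 2 * (2 ^ (#I - #H)) ^ 2 *
        ((∑ t ∈ H.powerset, midDensity #t) ^ 2 * (#H + 1)) := by ring
    _ ≤ 4 * (#V : ℝ) ^ 2 * w ^ 2 * (2 ^ (#I - #H)) ^ 2 * (2 * (2 ^ #H) ^ 2) := by gcongr
    _ = 8 * (#V : ℝ) ^ 2 * w ^ 2 * (2 ^ (#I - #H) * 2 ^ #H) ^ 2 := by ring
    _ = _ := by rw [← pow_add, Nat.sub_add_cancel (card_le_card hHI)]

/-- Concentration: if `m` restricted to a dense family takes only the values `0` and `1`, and the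
sizes of the traces on `G` lie in a short window, then `m` is almost constant on `G`. -/
lemma exists_almost_constant_or_card_le {I G : Finset α} (hG : G ⊆ I) (m : α → ℝ) (N : ℕ)
    {𝒳 : Finset (Finset α)} (h𝒳 : ∀ x ∈ 𝒳, x ⊆ I) {V : Finset ℝ}
    (hwin : ∀ x ∈ 𝒳, (#(x ∩ G) : ℝ) ∈ V)
    (hval : ∀ x ∈ 𝒳, ∑ i ∈ x, m i = 0 ∨ ∑ i ∈ x, m i = 1) :
    (∃ c, #{i ∈ G | m i ≠ c} < 2 * N) ∨
      (#𝒳 : ℝ) ^ 2 * (N + 1) ≤ 8 * (#V : ℝ) ^ 2 * midDensity (#G - 2 * N) ^ 2 * (2 ^ #I) ^ 2 := by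
  by_cases h : ∃ c, #{i ∈ G | m i ≠ c} < 2 * N
  · exact Or.inl h
  · push Not at h
    obtain ⟨H, hH, hcard, u, hu, hmaps, hm⟩ := exists_disjoint_pairs m N G h
    have := card_sq_mul_le_of_disjoint_pairs hG hH hu hmaps hm h𝒳 hwin hval
    rw [hcard] at this
    exact Or.inr this

lemma false_of_card_le_midDensity {ℓ t n X : ℕ} {f : ℝ} (hℓ : 1 ≤ ℓ) (hf0 : 0 < f)
    (hf : 17 * f ^ 2 ≤ 16) (hX : (X : ℝ) * f = midDensity (2 * ℓ) * 2 ^ n) (ht : 31 * ℓ ≤ 16 * t)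
    (h : (X : ℝ) ≤ midDensity t * 2 ^ n) : False := by
  have hμ := midDensity_pos (2 * ℓ)
  have hw := midDensity_pos t
  have hp : (0 : ℝ) < 2 ^ n := by positivity
  have h1 : midDensity (2 * ℓ) ≤ midDensity t * f := by
    have := mul_le_mul_of_nonneg_right h hf0.le
    rw [hX] at this
    exact le_of_mul_le_mul_right (by linarith) hp
  have h2 : midDensity (2 * ℓ) ^ 2 ≤ midDensity t ^ 2 * f ^ 2 := by
    rw [← mul_pow]
    exact pow_le_pow_left₀ hμ.le h1 2
  have h3 : 17 * midDensity (2 * ℓ) ^ 2 ≤ 16 * midDensity t ^ 2 := by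
    nlinarith [mul_le_mul_of_nonneg_left hf (sq_nonneg (midDensity t))]
  have hμ2 : 0 < midDensity (2 * ℓ) ^ 2 := by positivity
  rcases le_or_gt t (2 * ℓ) with htl | htl
  · have h4 := midDensity_sq_mul_le htl
    have ht' : (31 : ℝ) * ℓ ≤ 16 * t := by exact_mod_cast ht
    have hℓ' : (1 : ℝ) ≤ ℓ := by exact_mod_cast hℓ
    have ht0 : (0 : ℝ) ≤ t := by linarith
    have h5 : 17 * midDensity (2 * ℓ) ^ 2 * t ≤ 16 * (midDensity (2 * ℓ) ^ 2 * (2 * ℓ)) :=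
      (mul_le_mul_of_nonneg_right h3 ht0).trans (by linarith)
    have h6 : 17 * (t : ℝ) ≤ 32 * ℓ := by
      refine le_of_mul_le_mul_left ?_ hμ2
      linarith
    linarith
  · have h4 := pow_le_pow_left₀ hw.le (midDensity_antitone htl.le) 2
    linarith

/-- The data attached to a restriction of `ℬ`: an upper bound for the set `η` of chosen
coordinates and the linear constraints satisfied by the traces `𝒳` of the members of `𝒜`. -/
structure Constrained (ℓ : ℕ) (I G η : Finset α) (M : α → α → ℝ) (𝒳 : Finset (Finset α))
    (f : ℝ) : Prop where
  subset : G ⊆ I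
  mem_subset : ∀ x ∈ 𝒳, x ⊆ I
  column : ∀ x ∈ 𝒳, ∀ j ∈ η, ∑ i ∈ x, M i j = 0 ∨ ∑ i ∈ x, M i j = 1
  total : ∀ x ∈ 𝒳, (#(x ∩ G) : ℝ) + ∑ j ∈ η, ∑ i ∈ x, M i j = ℓ
  card_sq_le : #η ^ 2 ≤ 1024 * ℓ
  pos : 0 < f
  sq_le : 17 * f ^ 2 ≤ 16
  sq_mul_card_le : f ^ 2 * #η ≤ 16
  card_mul : (#𝒳 : ℝ) * f = midDensity (2 * ℓ) * 2 ^ #I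

namespace Constrained

variable {ℓ : ℕ} {I G η : Finset α} {M : α → α → ℝ} {𝒳 : Finset (Finset α)} {f : ℝ}

lemma card_le (h : Constrained ℓ I G η M 𝒳 f) (hℓ : 2 ^ 61 ≤ ℓ) : 128 * #η ≤ ℓ := by
  have := h.card_sq_le
  by_contra! hlt
  nlinarith

lemma sum_mem (h : Constrained ℓ I G η M 𝒳 f) {x : Finset α} (hx : x ∈ 𝒳) :
    ∃ k ≤ #η, ∑ j ∈ η, ∑ i ∈ x, M i j = k := by
  refine ⟨#{j ∈ η | ∑ i ∈ x, M i j = 1}, card_filter_le _ _, ?_⟩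
  rw [card_filter]
  push_cast
  refine sum_congr rfl fun j hj => ?_
  rcases h.column x hx j hj with h | h <;> simp [h]

lemma sum_weight (h : Constrained ℓ I G η M 𝒳 f) {x : Finset α} (hx : x ∈ 𝒳) :
    ∑ i ∈ x, ((if i ∈ G then (1 : ℝ) else 0) + ∑ j ∈ η, M i j) = ℓ := by
  rw [sum_add_distrib, sum_ite_mem, sum_const, nsmul_eq_mul, mul_one, sum_comm]
  exact h.total x hx

lemma le_card (h : Constrained ℓ I G η M 𝒳 f) (hℓ : 2 ^ 61 ≤ ℓ) : 126 * ℓ ≤ 64 * #G := by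
  by_contra! hlt
  have hη : 128 * (#η : ℝ) ≤ ℓ := by exact_mod_cast h.card_le hℓ
  have hlt' : 64 * (#G : ℝ) < 126 * ℓ := by exact_mod_cast hlt
  have hℓ' : (2 : ℝ) ^ 61 ≤ ℓ := by exact_mod_cast hℓ
  have hℓ0 : (0 : ℝ) < ℓ := lt_of_lt_of_le (by positivity) hℓ'
  have hcheb := card_trace_deviation_le h.subset (d := (ℓ : ℝ) / 64) (by positivity)
  have hsub : 𝒳 ⊆ {x ∈ I.powerset | (ℓ : ℝ) / 64 ≤ 2 * (#(x ∩ G) : ℝ) - #G} := by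
    intro x hx
    refine mem_filter.2 ⟨mem_powerset.2 (h.mem_subset x hx), ?_⟩
    obtain ⟨k, hk, hsum⟩ := h.sum_mem hx
    have := h.total x hx
    have hk' : (k : ℝ) ≤ #η := by exact_mod_cast hk
    linarith
  have hcard : (#𝒳 : ℝ) ≤ #{x ∈ I.powerset | (ℓ : ℝ) / 64 ≤ 2 * (#(x ∩ G) : ℝ) - #G} := by
    exact_mod_cast card_le_card hsub
  have hμ := midDensity_pos (2 * ℓ)
  have hone := one_le_midDensity_sq_mul (ℓ := ℓ) (by omega)
  have hf1 : f ≤ 1 := by nlinarith [h.sq_le, h.pos]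
  have hp : (0 : ℝ) < 2 ^ #I := by positivity
  have hlow : midDensity (2 * ℓ) * 2 ^ #I ≤ #𝒳 := by
    rw [← h.card_mul]
    exact mul_le_of_le_one_right (Nat.cast_nonneg _) hf1
  have h1 : midDensity (2 * ℓ) * ((ℓ : ℝ) / 64) ^ 2 ≤ 2 * ℓ := by
    refine le_of_mul_le_mul_right ?_ hp
    calc _ = (midDensity (2 * ℓ) * 2 ^ #I) * ((ℓ : ℝ) / 64) ^ 2 := by ring
      _ ≤ #{x ∈ I.powerset | (ℓ : ℝ) / 64 ≤ 2 * (#(x ∩ G) : ℝ) - #G} * ((ℓ : ℝ) / 64) ^ 2 := by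
          gcongr
          exact hlow.trans hcard
      _ ≤ #G * 2 ^ #I := hcheb
      _ ≤ _ := by
          gcongr
          linarith
  have h2 : midDensity (2 * ℓ) * ℓ ≤ 8192 := by
    refine le_of_mul_le_mul_right ?_ hℓ0
    linarith
  have h3 : (midDensity (2 * ℓ) * ℓ) ^ 2 ≤ 8192 ^ 2 := pow_le_pow_left₀ (by positivity) h2 2
  have h4 : (ℓ : ℝ) ≤ 4 * (midDensity (2 * ℓ) * ℓ) ^ 2 := by
    calc (ℓ : ℝ) = 1 * ℓ := by ring
      _ ≤ midDensity (2 * ℓ) ^ 2 * (4 * ℓ) * ℓ := by gcongr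
      _ = _ := by ring
  linarith [show (4 : ℝ) * 8192 ^ 2 < 2 ^ 61 by norm_num]

/-- A linear equation with many nonzero coefficients is too restrictive. -/
lemma false_of_weight_ne_zero (h : Constrained ℓ I G η M 𝒳 f) (hℓ : 2 ^ 61 ≤ ℓ) {E : Finset α}
    (hE : E ⊆ I) (hcard : 31 * ℓ ≤ 16 * #E)
    (hne : ∀ i ∈ E, (if i ∈ G then (1 : ℝ) else 0) + ∑ j ∈ η, M i j ≠ 0) : False := by
  refine false_of_card_le_midDensity (by omega) h.pos h.sq_le h.card_mul hcard ?_
  refine le_trans ?_ (card_sum_eq_le hE hne ℓ)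
  refine Nat.cast_le.2 (card_le_card fun x hx => ?_)
  exact mem_filter.2 ⟨mem_powerset.2 (h.mem_subset x hx), h.sum_weight hx⟩

lemma nonempty (h : Constrained ℓ I G η M 𝒳 f) : 𝒳.Nonempty := by
  rw [nonempty_iff_ne_empty]
  rintro rfl
  have := h.card_mul
  have hμ := midDensity_pos (2 * ℓ)
  have : (0 : ℝ) < midDensity (2 * ℓ) * 2 ^ #I := by positivity
  simp_all

lemma false_of_small (h : Constrained ℓ I G η M 𝒳 f) (hℓ : 2 ^ 61 ≤ ℓ) {R : Finset α}
    (hR : 64 * #R ≤ ℓ)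
    (hclean : ∀ j ∈ η, ∀ i ∈ I \ R, M i j ≠ 0 → ∀ i' ∈ I \ R, M i' j ≠ 0 → i' = i) : False := by
  set E := {i ∈ G \ R | ∀ j ∈ η, M i j = 0} with hE
  have hsub : G ⊆ E ∪ R ∪ η.biUnion fun j => {i ∈ I \ R | M i j ≠ 0} := by
    intro i hi
    by_cases hiR : i ∈ R
    · simp [hiR]
    by_cases hz : ∀ j ∈ η, M i j = 0
    · exact mem_union_left _ (mem_union_left _ (mem_filter.2 ⟨mem_sdiff.2 ⟨hi, hiR⟩, hz⟩))
    · push Not at hz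
      obtain ⟨j, hj, hne⟩ := hz
      refine mem_union_right _ (mem_biUnion.2 ⟨j, hj, mem_filter.2 ⟨?_, hne⟩⟩)
      exact mem_sdiff.2 ⟨h.subset hi, hiR⟩
  have h1 : #(η.biUnion fun j => {i ∈ I \ R | M i j ≠ 0}) ≤ #η * 1 := by
    refine card_biUnion_le_card_mul _ _ _ fun j hj => card_le_one.2 fun a ha b hb => ?_
    obtain ⟨ha, ha'⟩ := mem_filter.1 ha
    obtain ⟨hb, hb'⟩ := mem_filter.1 hb
    exact (hclean j hj a ha ha' b hb hb').symm
  have h2 := card_le_card hsub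
  have h3 := card_union_le (E ∪ R) (η.biUnion fun j => {i ∈ I \ R | M i j ≠ 0})
  have h4 := card_union_le E R
  have h5 := h.le_card hℓ
  have h6 := h.card_le hℓ
  refine h.false_of_weight_ne_zero hℓ (E := E)
    ((filter_subset _ _).trans (sdiff_subset.trans h.subset)) (by omega) fun i hi => ?_
  obtain ⟨hi, hz⟩ := mem_filter.1 hi
  rw [if_pos (mem_sdiff.1 hi).1, sum_eq_zero hz]
  norm_num

lemma exists_almost_constant (h : Constrained ℓ I G η M 𝒳 f) (hℓ : 2 ^ 61 ≤ ℓ)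
    (hη : #η ≤ 2 ^ 16) : ∀ j ∈ η, ∃ v, #{i ∈ G | M i j ≠ v} < 2 * 2 ^ 39 := by
  intro j hj
  rcases exists_almost_constant_or_card_le h.subset (fun i => M i j) (2 ^ 39) h.mem_subset
    (V := (range (#η + 1)).image fun k : ℕ => (ℓ : ℝ) - k) (fun x hx => by
      obtain ⟨k, hk, hsum⟩ := h.sum_mem hx
      have := h.total x hx
      exact mem_image.2 ⟨k, mem_range.2 (by omega), by linarith⟩)
    (fun x hx => h.column x hx j hj) with h1 | h1
  · exact h1
  exfalso
  have hV : (#((range (#η + 1)).image fun k : ℕ => (ℓ : ℝ) - k) : ℝ) ≤ 2 ^ 17 := by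
    have := (card_image_le (s := range (#η + 1)) (f := fun k : ℕ => (ℓ : ℝ) - k)).trans_eq
      (card_range _)
    exact_mod_cast this.trans (by omega)
  have hG := h.le_card hℓ
  have hw := midDensity_sq_mul_succ_le (#G - 2 * 2 ^ 39)
  have hGℓ : (ℓ : ℝ) ≤ ((#G - 2 * 2 ^ 39 : ℕ) : ℝ) := by exact_mod_cast (by omega)
  have hone := one_le_midDensity_sq_mul (ℓ := ℓ) (by omega)
  set w := midDensity (#G - 2 * 2 ^ 39)
  set μ := midDensity (2 * ℓ)
  set g := (#𝒳 : ℝ)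
  set V := (#((range (#η + 1)).image fun k : ℕ => (ℓ : ℝ) - k) : ℝ)
  have hw' : w ^ 2 * ℓ ≤ 1 := by nlinarith [sq_nonneg w]
  have hf1 : f ^ 2 ≤ 1 := by linarith [h.sq_le]
  have hμ2 : μ ^ 2 * (2 ^ #I) ^ 2 ≤ g ^ 2 := by
    rw [← mul_pow, ← h.card_mul, mul_pow]
    exact mul_le_of_le_one_right (sq_nonneg _) hf1
  have hV0 : 0 ≤ V := Nat.cast_nonneg _
  have hp : (0 : ℝ) < (2 ^ #I) ^ 2 := by positivity
  have h2 : μ ^ 2 * (2 ^ 39 + 1) ≤ 8 * (2 ^ 17) ^ 2 * w ^ 2 := by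
    refine le_of_mul_le_mul_right ?_ hp
    calc μ ^ 2 * (2 ^ 39 + 1) * (2 ^ #I) ^ 2 = (μ ^ 2 * (2 ^ #I) ^ 2) * (2 ^ 39 + 1) := by ring
      _ ≤ g ^ 2 * (2 ^ 39 + 1) := by gcongr
      _ ≤ 8 * V ^ 2 * w ^ 2 * (2 ^ #I) ^ 2 := by exact_mod_cast h1
      _ ≤ _ := by gcongr
  have h3 : μ ^ 2 * (4 * ℓ) * (2 ^ 39 + 1) ≤ 8 * (2 ^ 17) ^ 2 * 4 := by
    calc _ = μ ^ 2 * (2 ^ 39 + 1) * (4 * ℓ) := by ring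
      _ ≤ 8 * (2 ^ 17) ^ 2 * w ^ 2 * (4 * ℓ) := by gcongr
      _ = 8 * (2 ^ 17) ^ 2 * 4 * (w ^ 2 * ℓ) := by ring
      _ ≤ 8 * (2 ^ 17) ^ 2 * 4 * 1 := by gcongr
      _ = _ := by ring
  norm_num at h3
  linarith

lemma false_of_cancel (h : Constrained ℓ I G η M 𝒳 f) (hℓ : 2 ^ 61 ≤ ℓ) {G' : Finset α}
    (hG' : G' ⊆ G) (hcard : 31 * ℓ ≤ 16 * #G') {c : α → ℝ}
    (hc : ∀ i ∈ G', ∀ j ∈ η, M i j = c j) (hsum : 1 + ∑ j ∈ η, c j = 0) : False := by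
  set W : α → ℝ := fun i => (if i ∈ G then (1 : ℝ) else 0) + ∑ j ∈ η, M i j with hW
  have hWG : ∀ i ∈ G', W i = 0 := fun i hi => by
    rw [← hsum, hW]
    simp only [if_pos (hG' hi)]
    rw [sum_congr rfl (hc i hi)]
  have hG'I := hG'.trans h.subset
  have hout : ∀ x ∈ 𝒳, ∑ i ∈ x ∩ (I \ G'), W i = ℓ := fun x hx => by
    rw [← h.sum_weight hx]
    refine sum_subset inter_subset_left fun i hi hi' => hWG i ?_
    by_contra hne
    exact hi' (mem_inter.2 ⟨hi, mem_sdiff.2 ⟨h.mem_subset x hx hi, hne⟩⟩)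
  have hℓ0 : (ℓ : ℝ) ≠ 0 := by
    have : 0 < ℓ := by omega
    exact_mod_cast this.ne'
  obtain ⟨x₀, hx₀⟩ := h.nonempty
  obtain ⟨i₀, hi₀, hWi₀⟩ := exists_ne_zero_of_sum_ne_zero ((hout x₀ hx₀).trans_ne hℓ0)
  obtain ⟨j₀, hj₀, hcj₀⟩ := exists_ne_zero_of_sum_ne_zero
    (show ∑ j ∈ η, c j ≠ 0 by intro h0; rw [h0] at hsum; norm_num at hsum)
  have h1 := card_sum_eq_le (D := I \ G') (E := {i₀})
    (singleton_subset_iff.2 (mem_inter.1 hi₀).2) (m := W) (by simpa using hWi₀) ℓ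
  have h2 := card_le_mul_of_traces (D₁ := I \ G') (D₂ := G') (𝒳 := 𝒳)
    (𝒯 := {x ∈ (I \ G').powerset | ∑ i ∈ x, W i = ℓ})
    (K := 2 * midDensity #G' * 2 ^ #G')
    (fun x hx => by
      rw [sdiff_union_of_subset hG'I]
      exact h.mem_subset x hx)
    (fun x hx => mem_filter.2 ⟨mem_powerset.2 inter_subset_right, hout x hx⟩)
    (fun y hy => by
      have hy := mem_powerset.1 (mem_filter.1 hy).1
      refine le_trans ?_ (card_sum_eq_or_eq_le subset_rfl (m := fun i => M i j₀)
        (fun i hi => by rwa [hc i hi j₀ hj₀]) (0 - ∑ i ∈ y, M i j₀) (1 - ∑ i ∈ y, M i j₀))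
      refine Nat.cast_le.2 (card_le_card fun z hz => ?_)
      obtain ⟨hz, hx⟩ := mem_filter.1 hz
      refine mem_filter.2 ⟨hz, ?_⟩
      have hcol := h.column _ hx j₀ hj₀
      rw [sum_union (disjoint_of_subset_left hy
        (disjoint_of_subset_right (mem_powerset.1 hz) sdiff_disjoint))] at hcol
      refine hcol.imp (fun h => ?_) fun h => ?_ <;> linarith)
  refine false_of_card_le_midDensity (by omega) h.pos h.sq_le h.card_mul hcard ?_
  have hw1 : midDensity #({i₀} : Finset α) = 1 / 2 := by simp [midDensity]
  rw [hw1] at h1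
  have hw := midDensity_pos #G'
  calc (#𝒳 : ℝ) ≤ _ := h2
    _ ≤ (1 / 2 * 2 ^ #(I \ G')) * (2 * midDensity #G' * 2 ^ #G') := by gcongr
    _ = midDensity #G' * (2 ^ #(I \ G') * 2 ^ #G') := by ring
    _ = _ := by rw [← pow_add, card_sdiff_add_card_eq_card hG'I]

theorem false (h : Constrained ℓ I G η M 𝒳 f) (hℓ : 2 ^ 61 ≤ ℓ) : False := by
  obtain ⟨R, -, ρ, -, hcard, hclean⟩ := exists_restriction h.nonempty h.mem_subset (η : Set α)
    (fun j i => -M i j) (fun _ => 0) (fun j hj x hx => by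
      rw [sum_neg_distrib, zero_sub, neg_neg]
      exact h.column x hx j hj)
  by_cases hR : 64 * #R ≤ ℓ
  · exact h.false_of_small hℓ hR fun j hj i hi hne i' hi' hne' =>
      ((hclean j hj).2 i hi (neg_ne_zero.2 hne)).2 i' hi' (neg_ne_zero.2 hne')
  have hη : #η ≤ 2 ^ 16 := by
    have hR' : (ℓ : ℝ) ≤ 64 * #R := by exact_mod_cast (not_le.1 hR).le
    have hone := one_le_midDensity_sq_mul (ℓ := ℓ) (by omega)
    set μ := midDensity (2 * ℓ)
    have hp : (0 : ℝ) < (2 ^ #I) ^ 2 := by positivity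
    have h1 : (#𝒳 : ℝ) ^ 2 * ℓ ≤ 1024 * (2 ^ #I) ^ 2 := by
      nlinarith [sq_nonneg (#𝒳 : ℝ)]
    have h2 : μ ^ 2 * (2 ^ #I) ^ 2 = (#𝒳 : ℝ) ^ 2 * f ^ 2 := by
      rw [← mul_pow, ← h.card_mul, mul_pow]
    have h3 : (1 : ℝ) ≤ 4096 * f ^ 2 := by
      refine le_of_mul_le_mul_right ?_ hp
      calc 1 * ((2 : ℝ) ^ #I) ^ 2 ≤ μ ^ 2 * (4 * ℓ) * (2 ^ #I) ^ 2 := by gcongr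
        _ = (μ ^ 2 * (2 ^ #I) ^ 2) * (4 * ℓ) := by ring
        _ = 4 * f ^ 2 * ((#𝒳 : ℝ) ^ 2 * ℓ) := by rw [h2]; ring
        _ ≤ 4 * f ^ 2 * (1024 * (2 ^ #I) ^ 2) := by gcongr
        _ = _ := by ring
    have h4 := h.sq_mul_card_le
    have h5 : (#η : ℝ) ≤ 2 ^ 16 := by
      nlinarith [Nat.cast_nonneg (α := ℝ) #η]
    exact_mod_cast h5
  choose! c hc using h.exists_almost_constant hℓ hη
  set E := η.biUnion fun j => {i ∈ G | M i j ≠ c j} with hE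
  have hEcard : #E ≤ 2 ^ 16 * (2 * 2 ^ 39) :=
    (card_biUnion_le_card_mul _ _ _ fun j hj => (hc j hj).le).trans (by gcongr)
  have hG := h.le_card hℓ
  have hG' : 31 * ℓ ≤ 16 * #(G \ E) := by
    have := le_card_sdiff E G
    omega
  have hconst : ∀ i ∈ G \ E, ∀ j ∈ η, M i j = c j := by
    intro i hi j hj
    by_contra hne
    exact (mem_sdiff.1 hi).2 (mem_biUnion.2 ⟨j, hj, mem_filter.2 ⟨(mem_sdiff.1 hi).1, hne⟩⟩)
  by_cases hθ : 1 + ∑ j ∈ η, c j = 0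
  · exact h.false_of_cancel hℓ sdiff_subset hG' hconst hθ
  · refine h.false_of_weight_ne_zero hℓ (sdiff_subset.trans h.subset) hG' fun i hi => ?_
    rwa [if_pos (mem_sdiff.1 hi).1, sum_congr rfl (hconst i hi)]

end Constrained

/-- On the family `ℬ` the indicators of the elements outside `J` are affine functions, with
coefficients `M` and constants `c`, of the indicators of the elements of `J`. -/
def Determines (Ω : Finset α) (ℬ : Finset (Finset α)) (J : Finset α) (M : α → α → ℝ)
    (c : α → ℝ) : Prop :=
  ∀ i ∈ Ω \ J, ∀ b ∈ ℬ, (if i ∈ b then (1 : ℝ) else 0) = c i - ∑ j ∈ b ∩ J, M i j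

lemma sum_inter_eq (b J : Finset α) (m : α → ℝ) :
    ∑ j ∈ b ∩ J, m j = ∑ j ∈ J, m j * if j ∈ b then 1 else 0 := by
  simp_rw [mul_ite, mul_one, mul_zero]
  rw [sum_ite_mem, inter_comm]

lemma Determines.erase {Ω J : Finset α} {ℬ : Finset (Finset α)} {M : α → α → ℝ} {c : α → ℝ}
    (h : Determines Ω ℬ J M c) {j₀ : α} (hj₀ : j₀ ∈ J) {C : ℝ} {e : α → ℝ} (he : e j₀ ≠ 0)
    (hrel : ∀ b ∈ ℬ, C + ∑ j ∈ b ∩ J, e j = 0) :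
    ∃ M' c', Determines Ω ℬ (J.erase j₀) M' c' := by
  refine ⟨fun i j => if i = j₀ then e j / e j₀ else M i j - M i j₀ * (e j / e j₀),
    fun i => if i = j₀ then -(C / e j₀) else c i - M i j₀ * -(C / e j₀), fun i hi b hb => ?_⟩
  have h₀ : (if j₀ ∈ b then (1 : ℝ) else 0) = -(C / e j₀) - ∑ j ∈ b ∩ J.erase j₀, e j / e j₀ := by
    have := hrel b hb
    rw [sum_inter_eq, ← add_sum_erase _ _ hj₀, ← sum_inter_eq] at this
    rw [← sum_div]
    field_simp
    linarith
  by_cases hij : i = j₀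
  · subst hij
    simpa using h₀
  · simp only [if_neg hij]
    have hiJ : i ∈ Ω \ J := by
      rw [mem_sdiff] at hi ⊢
      exact ⟨hi.1, fun h => hi.2 (mem_erase.2 ⟨hij, h⟩)⟩
    rw [h i hiJ b hb, sum_inter_eq, ← add_sum_erase _ _ hj₀, ← sum_inter_eq, h₀, sum_sub_distrib,
      ← mul_sum]
    ring

/-- A determining set of coordinates for `ℬ` on which the relations imposed by the
cross-intersection property can be read off. -/
structure IsFrame (ℓ : ℕ) (Ω : Finset α) (𝒜 ℬ : Finset (Finset α)) (J : Finset α)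
    (M : α → α → ℝ) (c : α → ℝ) : Prop where
  subset : J ⊆ Ω
  row : Determines Ω ℬ J M c
  column : ∀ a ∈ 𝒜, ∀ j ∈ J, (if j ∈ a then (1 : ℝ) else 0) = ∑ i ∈ a \ J, M i j
  total : ∀ a ∈ 𝒜, ∑ i ∈ a \ J, c i = ℓ

lemma exists_isFrame {ℓ : ℕ} {Ω J₀ : Finset α} {𝒜 ℬ : Finset (Finset α)} (hℬ : ℬ.Nonempty)
    (h𝒜Ω : ∀ a ∈ 𝒜, a ⊆ Ω) (hint : ∀ a ∈ 𝒜, ∀ b ∈ ℬ, #(a ∩ b) = ℓ) (hJ₀ : J₀ ⊆ Ω)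
    {M₀ : α → α → ℝ} {c₀ : α → ℝ} (h₀ : Determines Ω ℬ J₀ M₀ c₀) :
    ∃ J ⊆ J₀, ∃ M c, IsFrame ℓ Ω 𝒜 ℬ J M c := by
  classical
  obtain ⟨J, hJ, hmin⟩ := exists_min_image {J ∈ J₀.powerset | ∃ M c, Determines Ω ℬ J M c} card
    ⟨J₀, mem_filter.2 ⟨mem_powerset.2 subset_rfl, M₀, c₀, h₀⟩⟩
  obtain ⟨hJJ₀, M, c, hdet⟩ := mem_filter.1 hJ
  rw [mem_powerset] at hJJ₀
  have hrel : ∀ a ∈ 𝒜, ∀ b ∈ ℬ, (∑ i ∈ a \ J, c i - ℓ) +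
      ∑ j ∈ b ∩ J, ((if j ∈ a then (1 : ℝ) else 0) - ∑ i ∈ a \ J, M i j) = 0 := by
    intro a ha b hb
    have h1 : (ℓ : ℝ) = ∑ i ∈ a, if i ∈ b then (1 : ℝ) else 0 := by
      rw [← hint a ha b hb, sum_ite_mem, sum_const, nsmul_eq_mul, mul_one]
    have h2 : ∑ i ∈ a \ J, (if i ∈ b then (1 : ℝ) else 0) =
        ∑ i ∈ a \ J, c i - ∑ j ∈ b ∩ J, ∑ i ∈ a \ J, M i j := by
      rw [sum_comm, ← sum_sub_distrib]
      exact sum_congr rfl fun i hi => hdet i (sdiff_subset_sdiff (h𝒜Ω a ha) subset_rfl hi) b hb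
    have h3 : ∑ i ∈ a ∩ J, (if i ∈ b then (1 : ℝ) else 0) =
        ∑ j ∈ b ∩ J, if j ∈ a then (1 : ℝ) else 0 := by
      rw [sum_ite_mem, sum_ite_mem]
      congr 1
      ext i
      simp only [mem_inter]
      tauto
    rw [← sum_inter_add_sum_sdiff a J, h2, h3] at h1
    rw [sum_sub_distrib]
    linarith
  have hcol : ∀ a ∈ 𝒜, ∀ j ∈ J, (if j ∈ a then (1 : ℝ) else 0) = ∑ i ∈ a \ J, M i j := by
    intro a ha j hj
    by_contra hne
    obtain ⟨M', c', hdet'⟩ := hdet.erase hj (sub_ne_zero.2 hne) (hrel a ha)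
    have := hmin (J.erase j) (mem_filter.2
      ⟨mem_powerset.2 ((erase_subset _ _).trans hJJ₀), M', c', hdet'⟩)
    exact absurd this (not_le.2 (card_erase_lt_of_mem hj))
  refine ⟨J, hJJ₀, M, c, hJJ₀.trans hJ₀, hdet, hcol, fun a ha => ?_⟩
  obtain ⟨b, hb⟩ := hℬ
  have := hrel a ha b hb
  rw [sum_eq_zero fun j hj => sub_eq_zero.2 (hcol a ha j (mem_inter.1 hj).2)] at this
  linarith

/-- A frame together with a restriction after which its rows are supported on at most one
coordinate. -/
structure IsCleanFrame (ℓ : ℕ) (Ω : Finset α) (𝒜 ℬ : Finset (Finset α)) (J : Finset α)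
    (M : α → α → ℝ) (c : α → ℝ) (S η : Finset α) : Prop extends IsFrame ℓ Ω 𝒜 ℬ J M c where
  restriction_subset : S ⊆ J
  subset_restriction : η ⊆ S
  card_sq_le : (#ℬ : ℝ) ^ 2 * (16 + #S) ≤ 16 * (2 ^ #J) ^ 2
  value : ∀ i ∈ Ω \ J, c i - ∑ j ∈ η, M i j = 0 ∨ c i - ∑ j ∈ η, M i j = 1
  clean : ∀ i ∈ Ω \ J, ∀ j ∈ J \ S, M i j ≠ 0 →
    (c i - ∑ j ∈ η, M i j - M i j = 0 ∨ c i - ∑ j ∈ η, M i j - M i j = 1) ∧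
    ∀ j' ∈ J \ S, M i j' ≠ 0 → j' = j

lemma IsFrame.injOn_inter {ℓ : ℕ} {Ω J : Finset α} {𝒜 ℬ : Finset (Finset α)} {M : α → α → ℝ}
    {c : α → ℝ} (h : IsFrame ℓ Ω 𝒜 ℬ J M c) (hℬΩ : ∀ b ∈ ℬ, b ⊆ Ω) :
    Set.InjOn (fun b => b ∩ J) (ℬ : Set (Finset α)) := by
  intro b hb b' hb' hbb'
  simp only at hbb'
  ext i
  by_cases hiΩ : i ∈ Ω
  · by_cases hiJ : i ∈ J
    · have := congrArg (i ∈ ·) hbb'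
      simpa [hiJ] using this
    · have h1 := h.row i (mem_sdiff.2 ⟨hiΩ, hiJ⟩) b hb
      have h2 := h.row i (mem_sdiff.2 ⟨hiΩ, hiJ⟩) b' hb'
      rw [hbb', ← h2] at h1
      by_cases hb : i ∈ b <;> by_cases hb' : i ∈ b' <;> simp_all
  · exact ⟨fun h => absurd (hℬΩ b hb h) hiΩ, fun h => absurd (hℬΩ b' hb' h) hiΩ⟩

lemma IsFrame.injOn_sdiff {ℓ : ℕ} {Ω J : Finset α} {𝒜 ℬ : Finset (Finset α)} {M : α → α → ℝ}
    {c : α → ℝ} (h : IsFrame ℓ Ω 𝒜 ℬ J M c) :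
    Set.InjOn (fun a => a \ J) (𝒜 : Set (Finset α)) := by
  intro a ha a' ha' haa'
  simp only at haa'
  ext i
  by_cases hiJ : i ∈ J
  · have h1 := h.column a ha i hiJ
    have h2 := h.column a' ha' i hiJ
    rw [haa', ← h2] at h1
    by_cases ha : i ∈ a <;> by_cases ha' : i ∈ a' <;> simp_all
  · have := congrArg (i ∈ ·) haa'
    simpa [hiJ] using this

lemma IsFrame.exists_isCleanFrame {ℓ : ℕ} {Ω J : Finset α} {𝒜 ℬ : Finset (Finset α)}
    {M : α → α → ℝ} {c : α → ℝ} (h : IsFrame ℓ Ω 𝒜 ℬ J M c) (hℬ : ℬ.Nonempty)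
    (hℬΩ : ∀ b ∈ ℬ, b ⊆ Ω) : ∃ S η, IsCleanFrame ℓ Ω 𝒜 ℬ J M c S η := by
  obtain ⟨S, hSJ, η, hηS, hcard, hrow⟩ := exists_restriction (D := J)
    (𝒴 := ℬ.image fun b => b ∩ J) (hℬ.image _)
    (fun y hy => by
      obtain ⟨b, -, rfl⟩ := mem_image.1 hy
      exact inter_subset_right)
    ((Ω \ J : Finset α) : Set α) M c (fun i hi y hy => by
      obtain ⟨b, hb, rfl⟩ := mem_image.1 hy
      rw [← h.row i hi b hb]
      split_ifs <;> simp)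
  rw [card_image_of_injOn (h.injOn_inter hℬΩ)] at hcard
  exact ⟨S, η, h, hSJ, hηS, hcard, fun i hi => (hrow i hi).1, fun i hi => (hrow i hi).2⟩

/-- One of the two families has a clean frame with a short restriction. -/
lemma exists_isCleanFrame_card_le {ℓ : ℕ} (hℓ : 1 ≤ ℓ) {Ω : Finset α} {𝒜 ℬ : Finset (Finset α)}
    (h𝒜 : ∀ a ∈ 𝒜, a ⊆ Ω) (hℬ : ∀ b ∈ ℬ, b ⊆ Ω) (hint : ∀ a ∈ 𝒜, ∀ b ∈ ℬ, #(a ∩ b) = ℓ)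
    (hcard : (#𝒜 : ℝ) * #ℬ = midDensity (2 * ℓ) * 2 ^ #Ω) :
    (∃ J M c S η, IsCleanFrame ℓ Ω 𝒜 ℬ J M c S η ∧ #S ^ 2 ≤ 1024 * ℓ) ∨
      ∃ J M c S η, IsCleanFrame ℓ Ω ℬ 𝒜 J M c S η ∧ #S ^ 2 ≤ 1024 * ℓ := by
  have hμ := midDensity_pos (2 * ℓ)
  have hpos : (0 : ℝ) < midDensity (2 * ℓ) * 2 ^ #Ω := by positivity
  have h𝒜ne : 𝒜.Nonempty := by
    rw [nonempty_iff_ne_empty]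
    rintro rfl
    simp at hcard
    linarith
  have hℬne : ℬ.Nonempty := by
    rw [nonempty_iff_ne_empty]
    rintro rfl
    simp at hcard
    linarith
  obtain ⟨J, hJΩ, M, c, hF⟩ := exists_isFrame (J₀ := Ω) (M₀ := 0) (c₀ := 0) hℬne h𝒜 hint
    subset_rfl (fun i hi => by simp at hi)
  obtain ⟨S, η, hC⟩ := hF.exists_isCleanFrame hℬne hℬ
  have hdet : Determines Ω 𝒜 (Ω \ J) (fun j i => -M i j) 0 := by
    intro j hj a ha
    rw [sdiff_sdiff_right_self, inf_eq_inter, mem_inter] at hj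
    have : a ∩ (Ω \ J) = a \ J := by
      rw [← inter_sdiff_assoc, inter_eq_left.2 (h𝒜 a ha)]
    rw [this, hF.column a ha j hj.2, sum_neg_distrib, Pi.zero_apply, zero_sub, neg_neg]
  obtain ⟨J', hJ', M', c', hF'⟩ := exists_isFrame (ℓ := ℓ) (𝒜 := ℬ) h𝒜ne hℬ
    (fun b hb a ha => by rw [inter_comm]; exact hint a ha b hb) sdiff_subset hdet
  obtain ⟨S', η', hC'⟩ := hF'.exists_isCleanFrame h𝒜ne h𝒜
  have hJJ' : #J + #J' ≤ #Ω := by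
    have h1 := card_le_card hJ'
    have h2 := card_sdiff_add_card_eq_card hJΩ
    omega
  have h1 := hC.card_sq_le
  have h2 := hC'.card_sq_le
  have hone := one_le_midDensity_sq_mul hℓ
  have hp : (0 : ℝ) < (2 ^ #Ω) ^ 2 := by positivity
  have hprod : midDensity (2 * ℓ) ^ 2 * ((16 + #S) * (16 + #S')) ≤ 256 := by
    refine le_of_mul_le_mul_right ?_ hp
    calc _ = (midDensity (2 * ℓ) * 2 ^ #Ω) ^ 2 * ((16 + #S) * (16 + #S')) := by ring
      _ = ((#ℬ : ℝ) ^ 2 * (16 + #S)) * ((#𝒜 : ℝ) ^ 2 * (16 + #S')) := by rw [← hcard]; ring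
      _ ≤ (16 * (2 ^ #J) ^ 2) * (16 * (2 ^ #J') ^ 2) := by gcongr
      _ = 256 * (2 ^ (#J + #J')) ^ 2 := by rw [pow_add]; ring
      _ ≤ 256 * (2 ^ #Ω) ^ 2 := by
          gcongr
          norm_num
  have hSS : (#S : ℝ) * #S' ≤ 1024 * ℓ := by
    have hℓ0 : (0 : ℝ) ≤ 4 * ℓ := by positivity
    calc (#S : ℝ) * #S' ≤ 1 * ((16 + #S) * (16 + #S')) := by
          nlinarith [Nat.cast_nonneg (α := ℝ) #S, Nat.cast_nonneg (α := ℝ) #S']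
      _ ≤ (midDensity (2 * ℓ) ^ 2 * (4 * ℓ)) * ((16 + #S) * (16 + #S')) := by gcongr
      _ = (midDensity (2 * ℓ) ^ 2 * ((16 + #S) * (16 + #S'))) * (4 * ℓ) := by ring
      _ ≤ 256 * (4 * ℓ) := by gcongr
      _ = _ := by ring
  have hSS' : #S * #S' ≤ 1024 * ℓ := by exact_mod_cast hSS
  rcases le_total #S #S' with hle | hle
  · exact Or.inl ⟨J, M, c, S, η, hC, by nlinarith⟩
  · exact Or.inr ⟨J', M', c', S', η', hC', by nlinarith⟩

lemma IsCleanFrame.restriction_eq_empty {ℓ : ℕ} (hℓ : 2 ^ 61 ≤ ℓ) {Ω J S η : Finset α}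
    {𝒜 ℬ : Finset (Finset α)} {M : α → α → ℝ} {c : α → ℝ}
    (h : IsCleanFrame ℓ Ω 𝒜 ℬ J M c S η) (h𝒜 : ∀ a ∈ 𝒜, a ⊆ Ω)
    (hcard : (#𝒜 : ℝ) * #ℬ = midDensity (2 * ℓ) * 2 ^ #Ω) (hS : #S ^ 2 ≤ 1024 * ℓ) : S = ∅ := by
  by_contra hne
  have hS1 : (1 : ℝ) ≤ #S := by
    exact_mod_cast (nonempty_iff_ne_empty.2 hne).card_pos
  have hμ := midDensity_pos (2 * ℓ)
  have hℬ0 : (0 : ℝ) < #ℬ := by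
    rcases (Nat.cast_nonneg (α := ℝ) #ℬ).eq_or_lt with h0 | h0
    · rw [← h0, mul_zero] at hcard
      have : (0 : ℝ) < midDensity (2 * ℓ) * 2 ^ #Ω := by positivity
      linarith
    · exact h0
  have hηS := card_le_card h.subset_restriction
  have hηS' : (#η : ℝ) ≤ #S := by exact_mod_cast hηS
  have hp : (0 : ℝ) < (2 ^ #J) ^ 2 := by positivity
  have hf : ((#ℬ : ℝ) / 2 ^ #J) ^ 2 * (16 + #S) ≤ 16 := by
    rw [div_pow, div_mul_eq_mul_div, div_le_iff₀ hp]
    exact h.card_sq_le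
  have hsq := sq_nonneg ((#ℬ : ℝ) / 2 ^ #J)
  have hsub : ∀ x ∈ 𝒜.image fun a => a \ J, x ⊆ Ω \ J := fun x hx => by
    obtain ⟨a, ha, rfl⟩ := mem_image.1 hx
    exact sdiff_subset_sdiff (h𝒜 a ha) subset_rfl
  refine Constrained.false (ℓ := ℓ) (I := Ω \ J) (η := η) (M := M)
    (G := {i ∈ Ω \ J | c i - ∑ j ∈ η, M i j = 1}) (𝒳 := 𝒜.image fun a => a \ J)
    (f := #ℬ / 2 ^ #J) ⟨filter_subset _ _, hsub, fun x hx j hj => ?_, fun x hx => ?_,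
      (Nat.pow_le_pow_left hηS 2).trans hS, by positivity, by nlinarith, by nlinarith, ?_⟩ hℓ
  · obtain ⟨a, ha, rfl⟩ := mem_image.1 hx
    rw [← h.column a ha j (h.restriction_subset (h.subset_restriction hj))]
    split_ifs <;> simp
  · have hval : ∀ i ∈ x, (if i ∈ ({i ∈ Ω \ J | c i - ∑ j ∈ η, M i j = 1} : Finset α) then (1 : ℝ)
        else 0) = c i - ∑ j ∈ η, M i j := by
      intro i hi
      have hi := hsub x hx hi
      rcases h.value i hi with h0 | h1
      · rw [if_neg, h0]
        rw [mem_filter, h0]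
        norm_num
      · rw [if_pos (mem_filter.2 ⟨hi, h1⟩), h1]
    have h1 : (#(x ∩ {i ∈ Ω \ J | c i - ∑ j ∈ η, M i j = 1}) : ℝ) =
        ∑ i ∈ x, (c i - ∑ j ∈ η, M i j) := by
      rw [← sum_congr rfl hval, sum_ite_mem, sum_const, nsmul_eq_mul, mul_one]
    obtain ⟨a, ha, rfl⟩ := mem_image.1 hx
    rw [h1, sum_sub_distrib, h.total a ha, sum_comm]
    ring
  · rw [card_image_of_injOn h.injOn_sdiff, ← mul_div_assoc, hcard,
      ← card_sdiff_add_card_eq_card h.subset, pow_add, ← mul_assoc, mul_div_cancel_right₀]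
    positivity

lemma choose_div_two_pow_eq {ℓ t : ℕ} (hℓ : 1 ≤ ℓ) (ht : t = 2 * ℓ - 1 ∨ t = 2 * ℓ) :
    (t.choose ℓ : ℝ) / 2 ^ t = midDensity (2 * ℓ) := by
  rcases ht with rfl | rfl
  · obtain ⟨m, rfl⟩ : ∃ m, ℓ = m + 1 := ⟨ℓ - 1, by omega⟩
    rw [← midDensity_odd, midDensity, show 2 * (m + 1) - 1 = 2 * m + 1 by omega,
      show (2 * m + 1) / 2 = m by omega, Nat.choose_symm_half]
  · rw [midDensity, Nat.mul_div_cancel_left _ two_pos]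

lemma card_filter_card_inter_le {I G : Finset α} (hG : G ⊆ I) (ℓ : ℕ) :
    (#{x ∈ I.powerset | #(x ∩ G) = ℓ} : ℝ) ≤ (#G).choose ℓ / 2 ^ #G * 2 ^ #I := by
  refine (card_le_mul_of_traces (D₁ := G) (D₂ := I \ G) (𝒯 := powersetCard ℓ G)
    (K := 2 ^ #(I \ G)) (fun x hx => ?_) (fun x hx => ?_) fun u _ => ?_).trans_eq ?_
  · rw [union_sdiff_of_subset hG]
    exact mem_powerset.1 (mem_filter.1 hx).1
  · exact mem_powersetCard.2 ⟨inter_subset_right, (mem_filter.1 hx).2⟩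
  · have := card_filter_le (I \ G).powerset fun v => u ∪ v ∈ {x ∈ I.powerset | #(x ∩ G) = ℓ}
    rw [card_powerset] at this
    exact_mod_cast this
  · rw [card_powersetCard, ← card_sdiff_add_card_eq_card hG, pow_add]
    field_simp

/-- The extremal configurations: `G₁` is matched into `J` by `p`; members of `𝒜` contain exactly `ℓ`
elements of `G` and treat matched elements alike, members of `ℬ` separate them. -/
structure IsExtremal (ℓ : ℕ) (Ω : Finset α) (𝒜 ℬ : Finset (Finset α)) (G J G₁ : Finset α)
    (p : α → α) : Prop where
  subset_left : G ⊆ Ω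
  subset_right : J ⊆ Ω
  disjoint : Disjoint G J
  matched_subset : G₁ ⊆ G
  injOn : Set.InjOn p G₁
  mapsTo : ∀ g ∈ G₁, p g ∈ J
  card : #G = 2 * ℓ - 1 ∨ #G = 2 * ℓ
  mem_left : ∀ a, a ∈ 𝒜 ↔ a ⊆ Ω ∧ #(a ∩ G) = ℓ ∧ (∀ g ∈ G₁, p g ∈ a ↔ g ∈ a) ∧
    ∀ j ∈ J, j ∉ G₁.image p → j ∉ a
  mem_right : ∀ b, b ∈ ℬ ↔ b ⊆ Ω ∧ (∀ g ∈ G₁, g ∈ b ↔ p g ∉ b) ∧ (∀ i ∈ G, i ∉ G₁ → i ∈ b) ∧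
    ∀ i ∈ Ω, i ∉ G → i ∉ J → i ∉ b

section

variable {ℓ : ℕ} {Ω J : Finset α} {𝒜 ℬ : Finset (Finset α)} {M : α → α → ℝ} {c : α → ℝ}

lemma IsCleanFrame.const_eq (h : IsCleanFrame ℓ Ω 𝒜 ℬ J M c ∅ ∅) :
    ∀ i ∈ Ω \ J, c i = 0 ∨ c i = 1 := fun i hi => by simpa using h.value i hi

lemma IsCleanFrame.card_inter_eq (h : IsCleanFrame ℓ Ω 𝒜 ℬ J M c ∅ ∅) (h𝒜 : ∀ a ∈ 𝒜, a ⊆ Ω)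
    {a : Finset α} (ha : a ∈ 𝒜) : #((a \ J) ∩ {i ∈ Ω \ J | c i = 1}) = ℓ := by
  have h1 : (#((a \ J) ∩ {i ∈ Ω \ J | c i = 1}) : ℝ) = ∑ i ∈ a \ J, c i := by
    rw [← nsmul_one, ← sum_const, ← sum_ite_mem]
    refine sum_congr rfl fun i hi => ?_
    have hi := sdiff_subset_sdiff (h𝒜 a ha) (subset_refl J) hi
    rcases h.const_eq i hi with h0 | h1
    · simp [h0]
    · rw [if_pos (mem_filter.2 ⟨hi, h1⟩), h1]
  rw [h.total a ha] at h1
  exact_mod_cast h1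

/-- In the absence of a restriction all inequalities are equalities. -/
lemma IsCleanFrame.full (h : IsCleanFrame ℓ Ω 𝒜 ℬ J M c ∅ ∅) (hℓ : 1 ≤ ℓ) (h𝒜 : ∀ a ∈ 𝒜, a ⊆ Ω)
    (hℬ : ∀ b ∈ ℬ, b ⊆ Ω) (hcard : (#𝒜 : ℝ) * #ℬ = midDensity (2 * ℓ) * 2 ^ #Ω) :
    (#{i ∈ Ω \ J | c i = 1} = 2 * ℓ - 1 ∨ #{i ∈ Ω \ J | c i = 1} = 2 * ℓ) ∧
      (∀ x ⊆ Ω \ J, #(x ∩ {i ∈ Ω \ J | c i = 1}) = ℓ → ∃ a ∈ 𝒜, a \ J = x) ∧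
      ∀ y ⊆ J, ∃ b ∈ ℬ, b ∩ J = y := by
  set G := {i ∈ Ω \ J | c i = 1} with hG
  set 𝒳 := {x ∈ (Ω \ J).powerset | #(x ∩ G) = ℓ} with h𝒳
  have hμ := midDensity_pos (2 * ℓ)
  have hsubA : 𝒜.image (fun a => a \ J) ⊆ 𝒳 := fun x hx => by
    obtain ⟨a, ha, rfl⟩ := mem_image.1 hx
    exact mem_filter.2 ⟨mem_powerset.2 (sdiff_subset_sdiff (h𝒜 a ha) subset_rfl),
      h.card_inter_eq h𝒜 ha⟩
  have hsubB : ℬ.image (fun b => b ∩ J) ⊆ J.powerset := fun y hy => by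
    obtain ⟨b, -, rfl⟩ := mem_image.1 hy
    exact mem_powerset.2 inter_subset_right
  have hX : (#𝒳 : ℝ) ≤ (#G).choose ℓ / 2 ^ #G * 2 ^ #(Ω \ J) :=
    card_filter_card_inter_le (filter_subset _ _) ℓ
  have hA : #𝒜 ≤ #𝒳 := by
    rw [← card_image_of_injOn h.injOn_sdiff]
    exact card_le_card hsubA
  have hB : #ℬ ≤ 2 ^ #J := by
    rw [← card_image_of_injOn (h.injOn_inter hℬ), ← card_powerset]
    exact card_le_card hsubB
  have hA' : (#𝒜 : ℝ) ≤ #𝒳 := by exact_mod_cast hA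
  have hB' : (#ℬ : ℝ) ≤ 2 ^ #J := by exact_mod_cast hB
  have hpow : (2 : ℝ) ^ #Ω = 2 ^ #(Ω \ J) * 2 ^ #J := by
    rw [← pow_add, card_sdiff_add_card_eq_card h.subset]
  have hpI : (0 : ℝ) < 2 ^ #(Ω \ J) := by positivity
  have hpJ : (0 : ℝ) < 2 ^ #J := by positivity
  have hle : midDensity (2 * ℓ) ≤ (#G).choose ℓ / 2 ^ #G := by
    refine le_of_mul_le_mul_right ?_ (mul_pos hpI hpJ)
    calc _ = (#𝒜 : ℝ) * #ℬ := by rw [hcard, hpow]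
      _ ≤ ((#G).choose ℓ / 2 ^ #G * 2 ^ #(Ω \ J)) * 2 ^ #J :=
          mul_le_mul (hA'.trans hX) hB' (Nat.cast_nonneg _) (by positivity)
      _ = _ := by ring
  have ht : #G = 2 * ℓ - 1 ∨ #G = 2 * ℓ := by
    by_contra! hne
    exact absurd hle (not_le.2 (choose_div_two_pow_lt hne.1 hne.2))
  rw [choose_div_two_pow_eq hℓ ht] at hX
  have hAX : midDensity (2 * ℓ) * 2 ^ #(Ω \ J) ≤ #𝒜 := by
    refine le_of_mul_le_mul_right ?_ hpJ
    calc _ = (#𝒜 : ℝ) * #ℬ := by rw [hcard, hpow]; ring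
      _ ≤ #𝒜 * 2 ^ #J := by gcongr
  have hBX : (2 : ℝ) ^ #J ≤ #ℬ := by
    refine le_of_mul_le_mul_left ?_ (mul_pos hμ hpI)
    calc _ = (#𝒜 : ℝ) * #ℬ := by rw [hcard, hpow]; ring
      _ ≤ _ := by
          gcongr
          exact hA'.trans hX
  refine ⟨ht, fun x hx hxG => ?_, fun y hy => ?_⟩
  · have heq := eq_of_subset_of_card_le hsubA (by
      rw [card_image_of_injOn h.injOn_sdiff]
      exact_mod_cast hX.trans hAX)
    exact mem_image.1 (heq ▸ mem_filter.2 ⟨mem_powerset.2 hx, hxG⟩)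
  · have heq := eq_of_subset_of_card_le hsubB (by
      rw [card_image_of_injOn (h.injOn_inter hℬ), card_powerset]
      exact_mod_cast hBX)
    exact mem_image.1 (heq ▸ mem_powerset.2 hy)

/-- A function with values in `{0, 1}` on `G` and `{0, -1}` outside whose sum over each set with
exactly `ℓ` elements in `G` lies in `{0, 1}` is supported on at most one element, lying in `G`. -/
lemma support_of_sum_eq_zero_or_one {I G : Finset α} (hGI : G ⊆ I) (hℓ : 2 ≤ ℓ)
    (hG : 2 * ℓ - 1 ≤ #G) {m : α → ℝ} (hm : ∀ i ∈ G, m i = 0 ∨ m i = 1)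
    (hm' : ∀ i ∈ I, i ∉ G → m i = 0 ∨ m i = -1)
    (hsum : ∀ x ⊆ I, #(x ∩ G) = ℓ → ∑ i ∈ x, m i = 0 ∨ ∑ i ∈ x, m i = 1) :
    (∀ i ∈ I, m i ≠ 0 → i ∈ G) ∧ ∀ i ∈ I, m i ≠ 0 → ∀ i' ∈ I, m i' ≠ 0 → i = i' := by
  have hone : ∀ i ∈ G, m i ≠ 0 → m i = 1 := fun i hi hne => (hm i hi).resolve_left hne
  have huniq : ∀ i ∈ G, m i ≠ 0 → ∀ i' ∈ G, m i' ≠ 0 → i = i' := by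
    intro i hi hne i' hi' hne'
    by_contra hii'
    obtain ⟨y, hy, hyG, hcard⟩ := exists_subsuperset_card_eq (n := ℓ)
      (show {i, i'} ⊆ G by simp [insert_subset_iff, hi, hi']) (by rw [card_pair hii']; exact hℓ)
      (by omega)
    have hs := hsum y (hyG.trans hGI) (by rwa [inter_eq_left.2 hyG])
    have h2 : ∑ k ∈ ({i, i'} : Finset α), m k ≤ ∑ k ∈ y, m k :=
      sum_le_sum_of_subset_of_nonneg hy fun k hk _ => by
        rcases hm k (hyG hk) with h | h <;> simp [h]
    rw [sum_pair hii', hone i hi hne, hone i' hi' hne'] at h2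
    rcases hs with h | h <;> rw [h] at h2 <;> norm_num at h2
  have hsupp : ∀ i ∈ I, m i ≠ 0 → i ∈ G := by
    intro i hi hne
    by_contra hiG
    have hmi := (hm' i hi hiG).resolve_left hne
    have hcardQ : #{k ∈ G | m k ≠ 0} ≤ 1 := card_le_one.2 fun a ha b hb =>
      huniq a (mem_filter.1 ha).1 (mem_filter.1 ha).2 b (mem_filter.1 hb).1 (mem_filter.1 hb).2
    obtain ⟨y, hy, hcard⟩ := exists_subset_card_eq (n := ℓ) (s := {k ∈ G | ¬ m k ≠ 0}) (by
      have := card_filter_add_card_filter_not (s := G) (fun k => m k ≠ 0)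
      omega)
    have hyG := hy.trans (filter_subset _ _)
    have hs := hsum (insert i y) (insert_subset hi (hyG.trans hGI)) (by
      rwa [insert_inter_of_notMem hiG, inter_eq_left.2 hyG])
    rw [sum_insert fun h => hiG (hyG h), hmi,
      sum_eq_zero fun k hk => not_not.1 (mem_filter.1 (hy hk)).2] at hs
    norm_num at hs
  exact ⟨hsupp, fun i hi hne i' hi' hne' =>
    huniq i (hsupp i hi hne) hne i' (hsupp i' hi' hne') hne'⟩

theorem IsCleanFrame.exists_isExtremal (h : IsCleanFrame ℓ Ω 𝒜 ℬ J M c ∅ ∅) (hℓ : 2 ≤ ℓ)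
    (h𝒜 : ∀ a ∈ 𝒜, a ⊆ Ω) (hℬ : ∀ b ∈ ℬ, b ⊆ Ω)
    (hcard : (#𝒜 : ℝ) * #ℬ = midDensity (2 * ℓ) * 2 ^ #Ω) :
    ∃ G G₁ p, IsExtremal ℓ Ω 𝒜 ℬ G J G₁ p := by
  classical
  obtain ⟨hGcard, hfullA, hfullB⟩ := h.full (by omega) h𝒜 hℬ hcard
  have hGA := fun a ha => h.card_inter_eq h𝒜 (a := a) ha
  set G := {i ∈ Ω \ J | c i = 1} with hG
  have hGI : G ⊆ Ω \ J := filter_subset _ _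
  have hdisj : Disjoint G J := disjoint_of_subset_left hGI sdiff_disjoint
  have hclean : ∀ i ∈ Ω \ J, ∀ j ∈ J, M i j ≠ 0 →
      (c i - M i j = 0 ∨ c i - M i j = 1) ∧ ∀ j' ∈ J, M i j' ≠ 0 → j' = j := by
    simpa using h.clean
  have hMG : ∀ i ∈ G, ∀ j ∈ J, M i j = 0 ∨ M i j = 1 := by
    intro i hi j hj
    by_contra! hne
    have h1 := (hclean i (hGI hi) j hj hne.1).1
    rw [(mem_filter.1 hi).2] at h1
    rcases h1 with h1 | h1
    · exact hne.2 (by linarith)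
    · exact hne.1 (by linarith)
  have hMG' : ∀ i ∈ Ω \ J, i ∉ G → ∀ j ∈ J, M i j = 0 ∨ M i j = -1 := by
    intro i hi hiG j hj
    by_contra! hne
    have h1 := (hclean i hi j hj hne.1).1
    have hc : c i = 0 := (h.const_eq i hi).resolve_right fun h1 => hiG (mem_filter.2 ⟨hi, h1⟩)
    rw [hc] at h1
    rcases h1 with h1 | h1
    · exact hne.1 (by linarith)
    · exact hne.2 (by linarith)
  have hsupp := fun j (hj : j ∈ J) => support_of_sum_eq_zero_or_one (m := fun i => M i j) hGI hℓ
    (by omega) (fun i hi => hMG i hi j hj) (fun i hi hiG => hMG' i hi hiG j hj)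
    (fun x hx hxG => by
      obtain ⟨a, ha, rfl⟩ := hfullA x hx hxG
      rw [← h.column a ha j hj]
      split_ifs <;> simp)
  set G₁ := {i ∈ G | ∃ j ∈ J, M i j ≠ 0} with hG₁
  have hpart : ∀ i ∈ G₁, ∃ j ∈ J, M i j ≠ 0 := fun i hi => (mem_filter.1 hi).2
  choose! p hpJ hpM using hpart
  have hM : ∀ i ∈ Ω \ J, ∀ j ∈ J, M i j = if i ∈ G₁ ∧ j = p i then 1 else 0 := by
    intro i hi j hj
    split_ifs with hij
    · obtain ⟨hi₁, rfl⟩ := hij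
      exact (hMG i (mem_filter.1 hi₁).1 _ hj).resolve_left (hpM i hi₁)
    · by_contra hne
      have hi₁ : i ∈ G₁ := mem_filter.2 ⟨(hsupp j hj).1 i hi hne, j, hj, hne⟩
      exact hij ⟨hi₁, ((hclean i hi j hj hne).2 (p i) (hpJ i hi₁) (hpM i hi₁)).symm⟩
  have hG₁G : G₁ ⊆ G := filter_subset _ _
  have hinj : Set.InjOn p G₁ := by
    intro i hi i' hi' hii'
    have hne := hpM i hi
    have hne' := hpM i' hi'
    rw [← hii'] at hne'
    exact (hsupp (p i) (hpJ i hi)).2 i (hGI (hG₁G hi)) hne i' (hGI (hG₁G hi')) hne'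
  have hcol : ∀ a ∈ 𝒜, ∀ j ∈ J, j ∈ a ↔ ∃ g ∈ G₁, g ∈ a ∧ j = p g := by
    intro a ha j hj
    have h1 := h.column a ha j hj
    rw [sum_congr rfl fun i hi => hM i (sdiff_subset_sdiff (h𝒜 a ha) subset_rfl hi) j hj] at h1
    constructor
    · intro hja
      rw [if_pos hja] at h1
      obtain ⟨i, hi, hne⟩ := exists_ne_zero_of_sum_ne_zero (h1.symm.trans_ne one_ne_zero)
      have hij : i ∈ G₁ ∧ j = p i := by
        by_contra hn
        exact hne (if_neg hn)
      exact ⟨i, hij.1, (mem_sdiff.1 hi).1, hij.2⟩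
    · rintro ⟨g, hg, hga, rfl⟩
      by_contra hja
      rw [if_neg hja] at h1
      have h2 := (sum_eq_zero_iff_of_nonneg fun i _ => by split_ifs <;> norm_num).1 h1.symm g
        (mem_sdiff.2 ⟨hga, (mem_sdiff.1 (hGI (hG₁G hg))).2⟩)
      simp [hg] at h2
  have hrow : ∀ b ∈ ℬ, ∀ i ∈ Ω \ J, i ∈ b ↔ i ∈ G ∧ ¬ (i ∈ G₁ ∧ p i ∈ b) := by
    intro b hb i hi
    have h1 := h.row i hi b hb
    rw [sum_congr rfl fun j hj => hM i hi j (mem_inter.1 hj).2] at h1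
    have h2 : ∑ j ∈ b ∩ J, (if i ∈ G₁ ∧ j = p i then (1 : ℝ) else 0) =
        if i ∈ G₁ ∧ p i ∈ b then 1 else 0 := by
      by_cases hi₁ : i ∈ G₁
      · simp [hi₁, hpJ i hi₁]
      · simp [hi₁]
    have h3 : c i = if i ∈ G then 1 else 0 := by
      split_ifs with hiG
      · exact (mem_filter.1 hiG).2
      · exact (h.const_eq i hi).resolve_right fun h1 => hiG (mem_filter.2 ⟨hi, h1⟩)
    rw [h2, h3] at h1
    have h4 : i ∈ G₁ → i ∈ G := fun h => hG₁G h
    by_cases hib : i ∈ b <;> by_cases hiG : i ∈ G <;> by_cases hi₁ : i ∈ G₁ ∧ p i ∈ b <;>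
      simp [hib, hiG, hi₁] at h1 ⊢
    all_goals norm_num at h1
  have hinterG : ∀ a : Finset α, a ∩ G = (a \ J) ∩ G := by
    intro a
    ext i
    simp only [mem_inter, mem_sdiff]
    exact ⟨fun hi => ⟨⟨hi.1, disjoint_left.1 hdisj hi.2⟩, hi.2⟩, fun hi => ⟨hi.1.1, hi.2⟩⟩
  refine ⟨G, G₁, p, hGI.trans sdiff_subset, h.subset, hdisj, hG₁G, hinj, hpJ, hGcard,
    fun a => ?_, fun b => ?_⟩
  · have hforw : ∀ a ∈ 𝒜, (∀ g ∈ G₁, p g ∈ a ↔ g ∈ a) ∧ ∀ j ∈ J, j ∉ G₁.image p → j ∉ a := by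
      refine fun a ha => ⟨fun g hg => ?_, fun j hj hjp hja => ?_⟩
      · rw [hcol a ha _ (hpJ g hg)]
        exact ⟨fun ⟨g', hg', hga, heq⟩ => hinj hg hg' heq ▸ hga, fun hga => ⟨g, hg, hga, rfl⟩⟩
      · obtain ⟨g, hg, -, rfl⟩ := (hcol a ha j hj).1 hja
        exact hjp (mem_image_of_mem p hg)
    refine ⟨fun ha => ⟨h𝒜 a ha, by rw [hinterG, hGA a ha], hforw a ha⟩, ?_⟩
    rintro ⟨haΩ, haℓ, hmatch, hout⟩
    obtain ⟨a', ha', heq⟩ := hfullA (a \ J) (sdiff_subset_sdiff haΩ subset_rfl) (hinterG a ▸ haℓ)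
    obtain ⟨hmatch', hout'⟩ := hforw a' ha'
    have hoff : ∀ i, i ∉ J → (i ∈ a' ↔ i ∈ a) := fun i hi => by
      have := congrArg (i ∈ ·) heq
      simpa [hi] using this
    suffices a = a' by rwa [this]
    ext i
    by_cases hiJ : i ∈ J
    · by_cases hip : i ∈ G₁.image p
      · obtain ⟨g, hg, rfl⟩ := mem_image.1 hip
        rw [hmatch g hg, hmatch' g hg, hoff g (disjoint_left.1 hdisj (hG₁G hg))]
      · exact iff_of_false (hout i hiJ hip) (hout' i hiJ hip)
    · exact (hoff i hiJ).symm
  · have hforw : ∀ b ∈ ℬ, (∀ g ∈ G₁, g ∈ b ↔ p g ∉ b) ∧ (∀ i ∈ G, i ∉ G₁ → i ∈ b) ∧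
        ∀ i ∈ Ω, i ∉ G → i ∉ J → i ∉ b := by
      refine fun b hb => ⟨fun g hg => ?_, fun i hi hi₁ => ?_, fun i hi hiG hiJ hib => ?_⟩
      · rw [hrow b hb g (hGI (hG₁G hg))]
        simp [hg, hG₁G hg]
      · rw [hrow b hb i (hGI hi)]
        exact ⟨hi, fun h => hi₁ h.1⟩
      · exact hiG ((hrow b hb i (mem_sdiff.2 ⟨hi, hiJ⟩)).1 hib).1
    refine ⟨fun hb => ⟨hℬ b hb, hforw b hb⟩, ?_⟩
    rintro ⟨hbΩ, hmatch, hin, hout⟩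
    obtain ⟨b', hb', heq⟩ := hfullB (b ∩ J) inter_subset_right
    obtain ⟨hmatch', hin', hout'⟩ := hforw b' hb'
    have hon : ∀ i, i ∈ J → (i ∈ b' ↔ i ∈ b) := fun i hi => by
      have := congrArg (i ∈ ·) heq
      simpa [hi] using this
    suffices b = b' by rwa [this]
    ext i
    by_cases hiΩ : i ∈ Ω
    · by_cases hiJ : i ∈ J
      · exact (hon i hiJ).symm
      · by_cases hiG : i ∈ G
        · by_cases hi₁ : i ∈ G₁
          · rw [hmatch i hi₁, hmatch' i hi₁, hon _ (hpJ i hi₁)]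
          · exact iff_of_true (hin i hiG hi₁) (hin' i hiG hi₁)
        · exact iff_of_false (hout i hiΩ hiG hiJ) (hout' i hiΩ hiG hiJ)
    · exact iff_of_false (fun h => hiΩ (hbΩ h)) fun h => hiΩ (hℬ b' hb' h)

end

theorem exists_bijOn_of_card_eq {s t : Finset ℕ} (h : #s = #t) :
    ∃ e : ℕ → ℕ, Set.BijOn e s t := by
  refine s.finite_toSet.exists_bijOn_of_encard_eq ?_
  simp [Set.encard_coe_eq_coe_finsetCard, h]

theorem exists_perm_of_surjOn {n : ℕ} {f : ℕ → ℕ} (hf : Set.SurjOn f (range n) (range n)) :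
    ∃ ρ : Equiv.Perm ℕ, (∀ x ∉ range n, ρ x = x) ∧ ∀ x ∈ range n, ρ x = f x := by
  classical
  have himage : (range n).image f = range n := by
    refine (eq_of_subset_of_card_le (fun y hy => ?_) card_image_le).symm
    obtain ⟨x, hx, rfl⟩ := hf hy
    exact mem_image_of_mem f hx
  have hinj : Set.InjOn f (range n) := card_image_iff.1 (by rw [himage])
  have hmaps : ∀ x ∈ range n, f x ∈ range n := fun x hx => himage ▸ mem_image_of_mem f hx
  have hbij : Function.Bijective fun x => if x ∈ range n then f x else x := by
    refine ⟨fun x y hxy => ?_, fun y => ?_⟩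
    · dsimp only at hxy
      split_ifs at hxy with hx hy hy
      · exact hinj hx hy hxy
      · exact absurd (hxy ▸ hmaps x hx) hy
      · exact absurd (hxy ▸ hmaps y hy) hx
      · exact hxy
    · by_cases hy : y ∈ range n
      · obtain ⟨x, hx, rfl⟩ := hf hy
        exact ⟨x, if_pos hx⟩
      · exact ⟨y, if_neg hy⟩
  exact ⟨Equiv.ofBijective _ hbij, fun x hx => if_neg hx, fun x hx => if_pos hx⟩

/-- A permutation of `[n]` taking initial blocks of `[n]` to the parts of a configuration. -/
theorem exists_perm_blocks {n : ℕ} {G J G₁ : Finset ℕ} {p : ℕ → ℕ} (hG : G ⊆ range n)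
    (hJ : J ⊆ range n) (hdisj : Disjoint G J) (hG₁ : G₁ ⊆ G) (hinj : Set.InjOn p G₁)
    (hmaps : ∀ g ∈ G₁, p g ∈ J) :
    ∃ n', #G + #G₁ ≤ n' ∧ n' ≤ n ∧ ∃ ρ : Equiv.Perm ℕ, (∀ x ∉ range n, ρ x = x) ∧
      (range #G₁).image ρ = G₁ ∧ (Ico #G₁ #G).image ρ = G \ G₁ ∧
      (∀ i < #G₁, ρ (#G + i) = p (ρ i)) ∧
      (Ico (#G + #G₁) n').image ρ = range n \ (G ∪ J) ∧
      (Ico n' n).image ρ = J \ G₁.image p := by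
  have hP : G₁.image p ⊆ J := image_subset_iff.2 hmaps
  have hPcard : #(G₁.image p) = #G₁ := card_image_of_injOn hinj
  have hτκ : #G₁ ≤ #G := card_le_card hG₁
  have hτJ : #G₁ ≤ #J := hPcard ▸ card_le_card hP
  have hX : #(range n \ (G ∪ J)) + (#G + #J) = n := by
    have := card_sdiff_add_card_eq_card (union_subset hG hJ)
    rwa [card_union_of_disjoint hdisj, card_range] at this
  have hY : #(J \ G₁.image p) + #G₁ = #J := by
    have := card_sdiff_add_card_eq_card hP
    rwa [hPcard] at this
  have hZ : #(G \ G₁) + #G₁ = #G := card_sdiff_add_card_eq_card hG₁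
  set X := range n \ (G ∪ J)
  set Y := J \ G₁.image p
  set κ := #G
  set τ := #G₁
  set n' := κ + τ + #X with hn'
  obtain ⟨e₁, he₁⟩ := exists_bijOn_of_card_eq (s := range τ) (t := G₁) (by simp [τ])
  obtain ⟨e₂, he₂⟩ := exists_bijOn_of_card_eq (s := Ico τ κ) (t := G \ G₁) (by
    rw [Nat.card_Ico]; lia)
  obtain ⟨e₃, he₃⟩ := exists_bijOn_of_card_eq (s := Ico (κ + τ) n') (t := X) (by
    rw [Nat.card_Ico]; lia)
  obtain ⟨e₄, he₄⟩ := exists_bijOn_of_card_eq (s := Ico n' n) (t := Y) (by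
    rw [Nat.card_Ico]; lia)
  have hn'n : n' ≤ n := by lia
  set f : ℕ → ℕ := fun i => if i < τ then e₁ i else if i < κ then e₂ i
    else if i < κ + τ then p (e₁ (i - κ)) else if i < n' then e₃ i else e₄ i with hf
  have f₁ : ∀ i ∈ range τ, f i = e₁ i := fun i hi => if_pos (mem_range.1 hi)
  have f₂ : ∀ i ∈ Ico τ κ, f i = e₂ i := fun i hi => by
    rw [mem_Ico] at hi
    simp only [hf]
    rw [if_neg (by lia), if_pos (by lia)]
  have f₃ : ∀ i ∈ Ico (κ + τ) n', f i = e₃ i := fun i hi => by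
    rw [mem_Ico] at hi
    simp only [hf]
    rw [if_neg (by lia), if_neg (by lia), if_neg (by lia), if_pos (by lia)]
  have f₄ : ∀ i ∈ Ico n' n, f i = e₄ i := fun i hi => by
    rw [mem_Ico] at hi
    simp only [hf]
    rw [if_neg (by lia), if_neg (by lia), if_neg (by lia), if_neg (by lia)]
  have f₅ : ∀ i < τ, f (κ + i) = p (e₁ i) := fun i hi => by
    simp only [hf]
    rw [if_neg (by lia), if_neg (by lia), if_pos (by lia), Nat.add_sub_cancel_left]
  have i₁ : (range τ).image f = G₁ := by
    rw [image_congr f₁, ← coe_inj, coe_image, he₁.image_eq]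
  have i₂ : (Ico τ κ).image f = G \ G₁ := by
    rw [image_congr f₂, ← coe_inj, coe_image, he₂.image_eq]
  have i₃ : (Ico (κ + τ) n').image f = X := by
    rw [image_congr f₃, ← coe_inj, coe_image, he₃.image_eq]
  have i₄ : (Ico n' n).image f = Y := by
    rw [image_congr f₄, ← coe_inj, coe_image, he₄.image_eq]
  have hsurj : Set.SurjOn f (range n) (range n) := by
    intro y hy
    suffices h : y ∈ (range n).image f by simpa using h
    have hmono : ∀ {s}, s ⊆ range n → y ∈ s.image f → y ∈ (range n).image f :=
      fun hs h => image_subset_image hs h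
    have hn : range τ ⊆ range n ∧ Ico τ κ ⊆ range n ∧ Ico (κ + τ) n' ⊆ range n ∧
        Ico n' n ⊆ range n := by
      refine ⟨?_, ?_, ?_, ?_⟩ <;> intro i <;> simp only [mem_range, mem_Ico] <;> lia
    by_cases hyG₁ : y ∈ G₁
    · exact hmono hn.1 (i₁ ▸ hyG₁)
    by_cases hyG : y ∈ G
    · exact hmono hn.2.1 (i₂ ▸ mem_sdiff.2 ⟨hyG, hyG₁⟩)
    by_cases hyJ : y ∈ J
    · by_cases hyP : y ∈ G₁.image p
      · obtain ⟨g, hg, rfl⟩ := mem_image.1 hyP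
        obtain ⟨i, hi, rfl⟩ := he₁.surjOn hg
        have hi : i < τ := by simpa using hi
        exact mem_image.2 ⟨κ + i, mem_range.2 (by lia), f₅ i hi⟩
      · exact hmono hn.2.2.2 (i₄ ▸ mem_sdiff.2 ⟨hyJ, hyP⟩)
    · exact hmono hn.2.2.1 (i₃ ▸ mem_sdiff.2 ⟨by simpa using hy, by simp [hyG, hyJ]⟩)
  obtain ⟨ρ, hρout, hρ⟩ := exists_perm_of_surjOn hsurj
  have himage : ∀ s, s ⊆ range n → s.image ρ = s.image f := fun s hs =>
    image_congr fun i hi => hρ i (hs hi)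
  refine ⟨n', by lia, hn'n, ρ, hρout, ?_, ?_, fun i hi => ?_, ?_, ?_⟩
  · rw [himage _ (range_subset_range.2 (by lia)), i₁]
  · rw [himage _ (fun i => by simp only [mem_range, mem_Ico]; lia), i₂]
  · rw [hρ _ (mem_range.2 (by lia)), hρ _ (mem_range.2 (by lia)), f₅ i hi,
      f₁ i (mem_range.2 hi)]
  · rw [himage _ (fun i => by simp only [mem_range, mem_Ico]; lia), i₃]
  · rw [himage _ (fun i => by simp only [mem_range, mem_Ico]; lia), i₄]

/-- Sets meeting `[κ]` in `ℓ` points and respecting the pairs `{i, κ + i}` are exactly the unions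
of `ℓ` blocks with a set of free elements. -/
theorem exists_blocks_iff {ℓ κ τ n' n : ℕ} (hτκ : τ ≤ κ) (hn' : κ + τ ≤ n') (hn : n' ≤ n)
    (A : Finset ℕ) :
    (∃ J ⊆ (range τ).image (fun i => ({i, κ + i} : Finset ℕ)) ∪
        (Ico τ κ).image (fun j => ({j} : Finset ℕ)),
      #J = ℓ ∧ ∃ S ⊆ Ico (κ + τ) n', A = J.sup id ∪ S) ↔
    A ⊆ range n ∧ #(A ∩ range κ) = ℓ ∧ (∀ i < τ, κ + i ∈ A ↔ i ∈ A) ∧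
      ∀ j ∈ Ico n' n, j ∉ A := by
  set T : ℕ → Finset ℕ := fun i => if i < τ then {i, κ + i} else {i} with hT
  have hmemT : ∀ i < κ, ∀ x, x ∈ T i ↔ x = i ∨ i < τ ∧ x = κ + i := by
    intro i _ x
    by_cases hi : i < τ <;> simp [hT, hi]
  have hTinj : Set.InjOn T (range κ) := by
    intro i hi j hj hij
    have hi : i < κ := by simpa using hi
    have hj : j < κ := by simpa using hj
    have := (hmemT j hj i).1 (hij ▸ (hmemT i hi i).2 (Or.inl rfl))
    lia
  have hblocks : (range τ).image (fun i => ({i, κ + i} : Finset ℕ)) ∪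
      (Ico τ κ).image (fun j => ({j} : Finset ℕ)) = (range κ).image T := by
    rw [show range κ = range τ ∪ Ico τ κ by ext i; simp only [mem_union, mem_range, mem_Ico]; lia,
      image_union]
    congr 1
    · exact image_congr fun i hi => (if_pos (by simpa using hi)).symm
    · exact image_congr fun i hi => (if_neg (by simp at hi; lia)).symm
  have hmemsup : ∀ K ⊆ range κ, ∀ x, x ∈ (K.image T).sup id ↔
      x ∈ K ∨ ∃ i ∈ K, i < τ ∧ x = κ + i := by
    intro K hK x
    simp only [mem_sup, mem_image, id]
    constructor
    · rintro ⟨_, ⟨i, hi, rfl⟩, hx⟩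
      rcases (hmemT i (mem_range.1 (hK hi)) x).1 hx with rfl | ⟨h, rfl⟩
      · exact Or.inl hi
      · exact Or.inr ⟨i, hi, h, rfl⟩
    · rintro (hx | ⟨i, hi, h, rfl⟩)
      · exact ⟨_, ⟨x, hx, rfl⟩, (hmemT x (mem_range.1 (hK hx)) x).2 (Or.inl rfl)⟩
      · exact ⟨_, ⟨i, hi, rfl⟩, (hmemT i (mem_range.1 (hK hi)) _).2 (Or.inr ⟨h, rfl⟩)⟩
  rw [hblocks]
  constructor
  · rintro ⟨J, hJ, hJcard, S, hS, rfl⟩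
    obtain ⟨K, hK, rfl⟩ := subset_image_iff.1 hJ
    have hK : K ⊆ range κ := by simpa using hK
    have hS : ∀ x ∈ S, κ + τ ≤ x ∧ x < n' := fun x hx => mem_Ico.1 (hS hx)
    have hKlt : ∀ x ∈ K, x < κ := fun x hx => mem_range.1 (hK hx)
    have hmem : ∀ x, x ∈ (K.image T).sup id ∪ S ↔
        (x ∈ K ∨ ∃ i ∈ K, i < τ ∧ x = κ + i) ∨ x ∈ S := fun x => by
      rw [mem_union, hmemsup K hK]
    refine ⟨fun x hx => ?_, ?_, fun i hi => ?_, fun j hj hjA => ?_⟩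
    · rw [mem_range]
      rcases (hmem x).1 hx with (h | ⟨i, h, hi, rfl⟩) | h
      · have := hKlt x h; lia
      · lia
      · have := hS x h; lia
    · rw [card_image_of_injOn (hTinj.mono (coe_subset.2 hK))] at hJcard
      rw [← hJcard]
      congr 1
      ext x
      rw [mem_inter, hmem, mem_range]
      constructor
      · rintro ⟨(h | ⟨i, h, hi, rfl⟩) | h, hx⟩
        · exact h
        · lia
        · have := hS x h; lia
      · exact fun h => ⟨Or.inl (Or.inl h), hKlt x h⟩
    · rw [hmem, hmem]
      constructor
      · rintro ((h | ⟨j, h, hj, heq⟩) | h)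
        · have := hKlt _ h; lia
        · rw [Nat.add_left_cancel heq]; exact Or.inl (Or.inl h)
        · have := hS _ h; lia
      · rintro ((h | ⟨j, h, hj, heq⟩) | h)
        · exact Or.inl (Or.inr ⟨i, h, hi, rfl⟩)
        · lia
        · have := hS _ h; lia
    · rw [mem_Ico] at hj
      rcases (hmem j).1 hjA with (h | ⟨i, h, hi, rfl⟩) | h
      · have := hKlt j h; lia
      · lia
      · have := hS j h; lia
  · rintro ⟨hA, hcard, hpair, hout⟩
    refine ⟨(A ∩ range κ).image T, image_subset_image inter_subset_right, ?_,
      A ∩ Ico (κ + τ) n', inter_subset_right, ?_⟩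
    · rw [card_image_of_injOn (hTinj.mono (by simp)), hcard]
    · ext x
      rw [mem_union, hmemsup _ inter_subset_right]
      simp only [mem_inter, mem_range, mem_Ico]
      constructor
      · intro hx
        have hxn := mem_range.1 (hA hx)
        by_cases h₁ : x < κ
        · exact Or.inl (Or.inl ⟨hx, h₁⟩)
        by_cases h₂ : x < κ + τ
        · refine Or.inl (Or.inr ⟨x - κ, ⟨(hpair (x - κ) (by lia)).1 ?_, by lia⟩, by lia, by lia⟩)
          rwa [show κ + (x - κ) = x by lia]
        · refine Or.inr ⟨hx, by lia, ?_⟩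
          by_contra h₃
          exact hout x (mem_Ico.2 ⟨by lia, hxn⟩) hx
      · rintro ((h | ⟨i, h, hi, rfl⟩) | h)
        · exact h.1
        · exact (hpair i hi).2 h.1
        · exact h.1

theorem card_inter_pair_eq_one_iff {L : Finset α} {i j : α}
    (hij : i ≠ j) : #(L ∩ {i, j}) = 1 ↔ (i ∈ L ↔ j ∉ L) := by
  by_cases hi : i ∈ L <;> by_cases hj : j ∈ L <;> simp [*]

/-- Sets containing `[τ, κ)` and exactly one element of each pair `{i, κ + i}` are exactly the
unions of a transversal, `[τ, κ)` and a set of free elements. -/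
theorem exists_transversal_iff {κ τ n' n : ℕ} (hτκ : τ ≤ κ) (hn' : κ + τ ≤ n') (hn : n' ≤ n)
    (B : Finset ℕ) :
    (∃ L ⊆ range τ ∪ Ico κ (κ + τ), (∀ i < τ, #(L ∩ {i, κ + i}) = 1) ∧
      ∃ S' ⊆ Ico n' n, B = L ∪ Ico τ κ ∪ S') ↔
    B ⊆ range n ∧ (∀ i < τ, i ∈ B ↔ κ + i ∉ B) ∧ (∀ i ∈ Ico τ κ, i ∈ B) ∧
      ∀ i ∈ Ico (κ + τ) n', i ∉ B := by
  have hpair : ∀ L : Finset ℕ, (∀ i < τ, #(L ∩ {i, κ + i}) = 1) ↔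
      ∀ i < τ, i ∈ L ↔ κ + i ∉ L := fun L =>
    forall₂_congr fun i hi => card_inter_pair_eq_one_iff (by lia)
  constructor
  · rintro ⟨L, hL, hLpair, S, hS, rfl⟩
    rw [hpair] at hLpair
    have hL : ∀ x ∈ L, x < τ ∨ κ ≤ x ∧ x < κ + τ := fun x hx => by simpa using hL hx
    have hS : ∀ x ∈ S, n' ≤ x ∧ x < n := fun x hx => mem_Ico.1 (hS hx)
    simp only [subset_iff, mem_union, mem_Ico, mem_range]
    refine ⟨?_, fun i hi => ?_, fun i hi => Or.inl (Or.inr hi), ?_⟩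
    · rintro x ((h | h) | h)
      · have := hL x h; lia
      · lia
      · exact (hS x h).2
    · have h₁ : i ∉ S := fun h => by have := hS i h; lia
      have h₂ : κ + i ∉ S := fun h => by have := hS _ h; lia
      have h₃ : ¬ (τ ≤ i ∧ i < κ) := by lia
      have h₄ : ¬ (τ ≤ κ + i ∧ κ + i < κ) := by lia
      simp only [h₁, h₂, h₃, h₄, or_false]
      exact hLpair i hi
    · rintro i hi ((h | h) | h)
      · have := hL i h; lia
      · lia
      · have := hS i h; lia
  · rintro ⟨hB, hBpair, hin, hout⟩
    refine ⟨B ∩ (range τ ∪ Ico κ (κ + τ)), inter_subset_right, (hpair _).2 fun i hi => ?_,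
      B ∩ Ico n' n, inter_subset_right, ?_⟩
    · have h₁ : i ∈ range τ ∪ Ico κ (κ + τ) := by simp [hi]
      have h₂ : κ + i ∈ range τ ∪ Ico κ (κ + τ) := by simp [hi]
      simp only [mem_inter, h₁, h₂, and_true]
      exact hBpair i hi
    · ext x
      simp only [mem_union, mem_inter, mem_range, mem_Ico]
      constructor
      · intro hx
        have hxn := mem_range.1 (hB hx)
        have := fun h => hout x h hx
        simp only [mem_Ico] at this
        simp only [hx, true_and]
        lia
      · rintro ((h | h) | h)
        · exact h.1
        · exact hin x (mem_Ico.2 h)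
        · exact h.1

theorem mem_image_image_symm {𝒜 : Finset (Finset α)}
    (ρ : Equiv.Perm α) (A : Finset α) :
    A ∈ 𝒜.image (Finset.image ρ.symm) ↔ A.image ρ ∈ 𝒜 := by
  constructor
  · rintro h
    obtain ⟨a, ha, rfl⟩ := mem_image.1 h
    simpa [image_image] using ha
  · exact fun h => mem_image.2 ⟨_, h, by simp [image_image]⟩

theorem IsExtremal.exists_perm {ℓ n : ℕ} {𝒜 ℬ : Finset (Finset ℕ)} {G J G₁ : Finset ℕ}
    {p : ℕ → ℕ} (h : IsExtremal ℓ (range n) 𝒜 ℬ G J G₁ p) :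
    ∃ κ τ n' : ℕ, (κ = 2 * ℓ - 1 ∨ κ = 2 * ℓ) ∧ τ ≤ κ ∧ κ + τ ≤ n' ∧ n' ≤ n ∧
      ∃ σ : Equiv.Perm ℕ, (∀ x ∉ range n, σ x = x) ∧
      (∀ A, A ∈ 𝒜.image (Finset.image σ) ↔
        ∃ J ⊆ (range τ).image (fun i => ({i, κ + i} : Finset ℕ)) ∪
            (Ico τ κ).image (fun j => ({j} : Finset ℕ)),
          #J = ℓ ∧ ∃ S ⊆ Ico (κ + τ) n', A = J.sup id ∪ S) ∧
      ∀ B, B ∈ ℬ.image (Finset.image σ) ↔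
        ∃ L ⊆ range τ ∪ Ico κ (κ + τ), (∀ i < τ, #(L ∩ {i, κ + i}) = 1) ∧
          ∃ S' ⊆ Ico n' n, B = L ∪ Ico τ κ ∪ S' := by
  obtain ⟨n', hκn', hn'n, ρ, hout, h₁, h₂, hp, hX, hY⟩ := exists_perm_blocks h.subset_left
    h.subset_right h.disjoint h.matched_subset h.injOn h.mapsTo
  have hτκ : #G₁ ≤ #G := card_le_card h.matched_subset
  have hG : (range #G).image ρ = G := by
    rw [show range #G = range #G₁ ∪ Ico #G₁ #G by
      ext i; simp only [mem_union, mem_range, mem_Ico]; lia, image_union, h₁, h₂,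
      union_sdiff_of_subset h.matched_subset]
  have hsub : ∀ A : Finset ℕ, A.image ρ ⊆ range n ↔ A ⊆ range n := by
    intro A
    rw [image_subset_iff]
    refine forall₂_congr fun x _ => ?_
    by_cases hx : x ∈ range n
    · refine iff_of_true (by_contra fun hρ => hρ ?_) hx
      rwa [ρ.injective (hout _ hρ)]
    · rw [hout x hx]
  have hmem : ∀ (A : Finset ℕ) (i : ℕ), ρ i ∈ A.image ρ ↔ i ∈ A := fun A i =>
    ρ.injective.mem_finset_image
  refine ⟨#G, #G₁, n', h.card, hτκ, hκn', hn'n, ρ.symm,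
    fun x hx => by rw [Equiv.symm_apply_eq, hout x hx], fun A => ?_, fun B => ?_⟩
  · rw [mem_image_image_symm, h.mem_left, exists_blocks_iff hτκ hκn' hn'n, hsub]
    refine and_congr_right fun _ => and_congr ?_ (and_congr ?_ ?_)
    · conv_lhs => rw [← hG]
      rw [← image_inter _ _ ρ.injective, card_image_of_injective _ ρ.injective]
    · conv_lhs => rw [← h₁]
      simp only [forall_mem_image, mem_range]
      refine forall₂_congr fun i hi => ?_
      rw [← hp i hi, hmem, hmem]
    · rw [show (∀ j ∈ J, j ∉ G₁.image p → j ∉ A.image ρ) ↔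
        ∀ j ∈ J \ G₁.image p, j ∉ A.image ρ by simp only [mem_sdiff, and_imp], ← hY]
      simp only [forall_mem_image, hmem]
  · rw [mem_image_image_symm, h.mem_right, exists_transversal_iff hτκ hκn' hn'n, hsub]
    refine and_congr_right fun _ => and_congr ?_ (and_congr ?_ ?_)
    · conv_lhs => rw [← h₁]
      simp only [forall_mem_image, mem_range]
      refine forall₂_congr fun i hi => ?_
      rw [← hp i hi, hmem, hmem]
    · rw [show (∀ i ∈ G, i ∉ G₁ → i ∈ B.image ρ) ↔ ∀ i ∈ G \ G₁, i ∈ B.image ρ by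
        simp only [mem_sdiff, and_imp], ← h₂]
      simp only [forall_mem_image, hmem]
    · rw [show (∀ i ∈ range n, i ∉ G → i ∉ J → i ∉ B.image ρ) ↔
        ∀ i ∈ range n \ (G ∪ J), i ∉ B.image ρ by
          simp only [mem_sdiff, mem_union, not_or, and_imp], ← hX]
      simp only [forall_mem_image, hmem]

theorem choose_mul_zpow_eq_midDensity_mul (ℓ n : ℕ) :
    (Nat.choose (2 * ℓ) ℓ : ℝ) * (2 : ℝ) ^ ((n : ℤ) - 2 * (ℓ : ℤ)) =
      midDensity (2 * ℓ) * 2 ^ n := by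
  rw [midDensity_two_mul, Nat.centralBinom, zpow_sub₀ two_ne_zero, zpow_mul, zpow_natCast,
    zpow_natCast]
  norm_num
  ring


theorem exists_isExtremal {ℓ : ℕ} {Ω : Finset α}
    {𝒜 ℬ : Finset (Finset α)} (hℓ : 2 ^ 61 ≤ ℓ) (h𝒜 : ∀ a ∈ 𝒜, a ⊆ Ω) (hℬ : ∀ b ∈ ℬ, b ⊆ Ω)
    (hint : ∀ a ∈ 𝒜, ∀ b ∈ ℬ, #(a ∩ b) = ℓ)
    (hcard : (#𝒜 : ℝ) * #ℬ = midDensity (2 * ℓ) * 2 ^ #Ω) :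
    (∃ G J G₁ p, IsExtremal ℓ Ω 𝒜 ℬ G J G₁ p) ∨ ∃ G J G₁ p, IsExtremal ℓ Ω ℬ 𝒜 G J G₁ p := by
  rcases exists_isCleanFrame_card_le (by lia) h𝒜 hℬ hint hcard with
    ⟨J, M, c, S, η, h, hS⟩ | ⟨J, M, c, S, η, h, hS⟩
  · obtain rfl := h.restriction_eq_empty hℓ h𝒜 hcard hS
    obtain rfl := subset_empty.1 h.subset_restriction
    obtain ⟨G, G₁, p, hp⟩ := h.exists_isExtremal (by lia) h𝒜 hℬ hcard
    exact Or.inl ⟨G, J, G₁, p, hp⟩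
  · rw [mul_comm (#𝒜 : ℝ)] at hcard
    obtain rfl := h.restriction_eq_empty hℓ hℬ hcard hS
    obtain rfl := subset_empty.1 h.subset_restriction
    obtain ⟨G, G₁, p, hp⟩ := h.exists_isExtremal (by lia) hℬ h𝒜 hcard
    exact Or.inr ⟨G, J, G₁, p, hp⟩

end CrossIntersecting

/-- There is a positive integer `ℓ₀` such that for every `ℓ ≥ ℓ₀`: if
`(𝒜, ℬ)` is an `ℓ`-cross-intersecting pair of families of subsets of `[n]` with
`|𝒜|·|ℬ| = binom(2ℓ,ℓ)·2^(n−2ℓ)`, then there are `κ ∈ {2ℓ−1, 2ℓ}`, `τ ≤ κ` and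
`κ+τ ≤ n' ≤ n` such that, after applying a permutation of the elements of `[n]` and
possibly swapping `𝒜` and `ℬ`, the pair has the extremal form described in the paper.
Here `[n]` is realized 0-based as `{0,…,n−1}`: the collection `𝒯` consists of the pairs
`{i, κ+i}` (`i < τ`) and the singletons `{j}` (`τ ≤ j < κ`), `X = {κ+τ,…,n'−1}`,
`Y = {n',…,n−1}`, `𝒜' = { (∪_{T∈J} T) ∪ S : J ⊆ 𝒯, |J| = ℓ, S ⊆ X }` and
`ℬ' = { L ∪ {τ,…,κ−1} ∪ S' : L ⊆ {0,…,τ−1} ∪ {κ,…,κ+τ−1}, |L ∩ {i,κ+i}| = 1 ∀ i < τ,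
S' ⊆ Y }`. -/
theorem stmt_1 :
    ∃ ℓ₀ : ℕ, 0 < ℓ₀ ∧ ∀ ℓ : ℕ, ℓ₀ ≤ ℓ → ∀ n : ℕ,
      ∀ 𝒜 ℬ : Finset (Finset ℕ),
        (∀ A ∈ 𝒜, A ⊆ Finset.range n) → (∀ B ∈ ℬ, B ⊆ Finset.range n) →
        (∀ A ∈ 𝒜, ∀ B ∈ ℬ, (A ∩ B).card = ℓ) →
        (𝒜.card * ℬ.card : ℝ) =
          (Nat.choose (2 * ℓ) ℓ : ℝ) * (2 : ℝ) ^ ((n : ℤ) - 2 * (ℓ : ℤ)) →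
        ∃ κ τ n' : ℕ, (κ = 2 * ℓ - 1 ∨ κ = 2 * ℓ) ∧ τ ≤ κ ∧ κ + τ ≤ n' ∧ n' ≤ n ∧
        ∃ σ : Equiv.Perm ℕ, (∀ x ∉ Finset.range n, σ x = x) ∧
        ∃ 𝒜' ℬ' : Finset (Finset ℕ),
          ((𝒜' = 𝒜.image (Finset.image σ) ∧ ℬ' = ℬ.image (Finset.image σ)) ∨
           (𝒜' = ℬ.image (Finset.image σ) ∧ ℬ' = 𝒜.image (Finset.image σ))) ∧
          (∀ A, A ∈ 𝒜' ↔
            ∃ J ⊆ (Finset.range τ).image (fun i => ({i, κ + i} : Finset ℕ)) ∪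
                   (Finset.Ico τ κ).image (fun j => ({j} : Finset ℕ)),
              J.card = ℓ ∧ ∃ S ⊆ Finset.Ico (κ + τ) n', A = J.sup id ∪ S) ∧
          (∀ B, B ∈ ℬ' ↔
            ∃ L ⊆ Finset.range τ ∪ Finset.Ico κ (κ + τ),
              (∀ i < τ, (L ∩ {i, κ + i}).card = 1) ∧
              ∃ S' ⊆ Finset.Ico n' n, B = L ∪ Finset.Ico τ κ ∪ S') := by
  refine ⟨2 ^ 61, by positivity, fun ℓ hℓ n 𝒜 ℬ h𝒜 hℬ hint hcard => ?_⟩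
  rw [CrossIntersecting.choose_mul_zpow_eq_midDensity_mul, ← Finset.card_range n] at hcard
  rcases CrossIntersecting.exists_isExtremal hℓ h𝒜 hℬ hint (by simpa using hcard) with
    ⟨G, J, G₁, p, h⟩ | ⟨G, J, G₁, p, h⟩
  all_goals
    obtain ⟨κ, τ, n', hκ, hτ, hκn', hn', σ, hσ, hA, hB⟩ := h.exists_perm
  · exact ⟨κ, τ, n', hκ, hτ, hκn', hn', σ, hσ, _, _, Or.inl ⟨rfl, rfl⟩, hA, hB⟩
  · exact ⟨κ, τ, n', hκ, hτ, hκn', hn', σ, hσ, _, _, Or.inr ⟨rfl, rfl⟩, hA, hB⟩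
end

section
/- There exists a positive integer ℓ₀ such that for every ℓ ≥ ℓ₀ and every n, every ℓ-cross-intersecting pair (𝒜, ℬ) of families of subsets of [n] satisfies |𝒜|·|ℬ| ≤ 2^(n+3)/√ℓ (equivalently, (|𝒜|·|ℬ|)²·ℓ ≤ 2^(2n+6)). -/
theorem centralBinom_sq_mul_le (t : ℕ) : t.centralBinom ^ 2 * (2 * t + 1) ≤ 4 ^ (2 * t) := by
  induction t with
  | zero => simp
  | succ t ih =>
    have h := Nat.succ_mul_centralBinom_succ t
    have hpos : 0 < (t + 1) ^ 2 := by positivity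
    refine le_of_mul_le_mul_left ?_ hpos
    calc (t + 1) ^ 2 * ((t + 1).centralBinom ^ 2 * (2 * (t + 1) + 1))
        = ((t + 1) * (t + 1).centralBinom) ^ 2 * (2 * t + 3) := by ring
      _ = (4 * ((2 * t + 1) * (2 * t + 3))) * (t.centralBinom ^ 2 * (2 * t + 1)) := by
          rw [h]; ring
      _ ≤ (4 * (4 * (t + 1) ^ 2)) * 4 ^ (2 * t) :=
          Nat.mul_le_mul (by nlinarith) ih
      _ = (t + 1) ^ 2 * 4 ^ (2 * (t + 1)) := by ring

theorem choose_half_sq_mul_le (m : ℕ) : m.choose (m / 2) ^ 2 * (m + 1) ≤ 4 ^ m := by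
  rcases Nat.even_or_odd' m with ⟨t, rfl | rfl⟩
  · have := centralBinom_sq_mul_le t
    rw [Nat.centralBinom_eq_two_mul_choose] at this
    simpa using this
  · have h := centralBinom_sq_mul_le (t + 1)
    have h2 : (t + 1).centralBinom = 2 * (2 * t + 1).choose t := by
      rw [Nat.centralBinom_eq_two_mul_choose, show 2 * (t + 1) = 2 * t + 1 + 1 by ring,
        Nat.choose_succ_succ, Nat.choose_symm_half]
      ring
    rw [h2] at h
    have h3 : (2 * t + 1) / 2 = t := by omega
    rw [h3]
    have h4 : 4 ^ (2 * (t + 1)) = 4 * 4 ^ (2 * t + 1) := by ring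
    rw [h4] at h
    nlinarith [Nat.zero_le ((2 * t + 1).choose t ^ 2)]

/-- The **Littlewood–Offord** inequality, counting subsets of `J` with a prescribed sum of weights
when the weights are nonzero on `R ⊆ J`. -/
theorem card_le_of_forall_sum_eq {ι : Type*} [DecidableEq ι] {J R : Finset ι} (hRJ : R ⊆ J)
    (w : ι → ℝ) (hw : ∀ j ∈ R, w j ≠ 0) (t : ℝ) (S : Finset (Finset ι))
    (hSJ : ∀ s ∈ S, s ⊆ J) (hS : ∀ s ∈ S, ∑ j ∈ s, w j = t) :
    S.card ≤ R.card.choose (R.card / 2) * 2 ^ (J.card - R.card) := by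
  classical
  have hcard : (J \ R).powerset.card = 2 ^ (J.card - R.card) := by
    rw [Finset.card_powerset, Finset.card_sdiff_of_subset hRJ]
  rw [← hcard]
  refine Finset.card_le_mul_card_image_of_maps_to (f := fun s => s \ R)
    (fun s hs => Finset.mem_powerset.2 (Finset.sdiff_subset_sdiff (hSJ s hs) subset_rfl)) _ ?_
  intro u _
  let T : Finset ι → Finset R := fun s => Finset.univ.filter fun j => (j.1 ∈ s ↔ 0 < w j.1)
  have hsum : ∀ s ∈ S.filter (fun s => s \ R = u), ∑ j ∈ T s, |w j.1| =
      t - ∑ j ∈ u, w j + ∑ j : R, (if w j.1 < 0 then - w j.1 else 0) := by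
    intro s hs
    obtain ⟨hs, hsu⟩ := Finset.mem_filter.1 hs
    have h1 : ∑ j ∈ s ∩ R, w j = t - ∑ j ∈ u, w j := by
      rw [← hS s hs, ← hsu, ← Finset.sum_inter_add_sum_sdiff s R]
      ring
    have h2 : ∑ j ∈ s ∩ R, w j = ∑ j : R, if j.1 ∈ s then w j.1 else 0 := by
      rw [Finset.sum_coe_sort R (fun j => if j ∈ s then w j else 0), ← Finset.sum_filter,
        Finset.filter_mem_eq_inter, Finset.inter_comm]
    rw [← h1, h2, ← Finset.sum_add_distrib, Finset.sum_filter]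
    refine Finset.sum_congr rfl fun j _ => ?_
    rcases lt_or_gt_of_ne (hw j.1 j.2) with h | h
    · by_cases hj : j.1 ∈ s <;> simp [hj, h, not_lt.2 h.le, abs_of_neg h]
    · by_cases hj : j.1 ∈ s <;> simp [hj, h, not_lt.2 h.le, abs_of_pos h]
  have hinj : Set.InjOn T (S.filter (fun s => s \ R = u)) := by
    intro s hs s' hs' hT
    have hs := (Finset.mem_filter.1 hs).2
    have hs' := (Finset.mem_filter.1 hs').2
    ext j
    by_cases hj : j ∈ R
    · have := Finset.ext_iff.1 hT ⟨j, hj⟩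
      simp only [T, Finset.mem_filter, Finset.mem_univ, true_and] at this
      tauto
    · have := Finset.ext_iff.1 (hs.trans hs'.symm) j
      simpa [hj] using this
  rw [← Finset.card_image_of_injOn hinj]
  have hanti : IsAntichain (· ⊆ ·)
      (SetLike.coe ((S.filter (fun s => s \ R = u)).image T)) := by
    intro a ha b hb hab hle
    obtain ⟨s, hs, rfl⟩ := Finset.mem_image.1 ha
    obtain ⟨s', hs', rfl⟩ := Finset.mem_image.1 hb
    obtain ⟨j, hj, hj'⟩ := Finset.exists_of_ssubset (Finset.ssubset_iff_subset_ne.2 ⟨hle, hab⟩)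
    have := Finset.sum_lt_sum_of_subset hle hj hj' (f := fun j : R => |w j.1|)
      (abs_pos.2 (hw j.1 j.2)) (fun _ _ _ => abs_nonneg _)
    rw [hsum s hs, hsum s' hs'] at this
    exact lt_irrefl _ this
  simpa using hanti.sperner

theorem card_sq_mul_le_of_forall_sum_eq {ι : Type*} [DecidableEq ι] {J R : Finset ι} (hRJ : R ⊆ J)
    (w : ι → ℝ) (hw : ∀ j ∈ R, w j ≠ 0) (t : ℝ) (S : Finset (Finset ι))
    (hSJ : ∀ s ∈ S, s ⊆ J) (hS : ∀ s ∈ S, ∑ j ∈ s, w j = t) :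
    S.card ^ 2 * (R.card + 1) ≤ 4 ^ J.card := by
  calc S.card ^ 2 * (R.card + 1)
      ≤ (R.card.choose (R.card / 2) * 2 ^ (J.card - R.card)) ^ 2 * (R.card + 1) := by
        gcongr
        exact card_le_of_forall_sum_eq hRJ w hw t S hSJ hS
    _ = R.card.choose (R.card / 2) ^ 2 * (R.card + 1) * 4 ^ (J.card - R.card) := by
        rw [mul_pow, ← pow_mul, mul_comm (J.card - R.card), pow_mul]
        ring
    _ ≤ 4 ^ R.card * 4 ^ (J.card - R.card) := by
        gcongr
        exact choose_half_sq_mul_le _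
    _ = 4 ^ J.card := by
        rw [← pow_add, Nat.add_sub_cancel' (Finset.card_le_card hRJ)]

/-- A finite family of vectors contains a basis of its span in which every member of the family
has coordinates in `[-1, 1]`. -/
theorem exists_linearIndepOn_abs_coord_le_one {ι E : Type*} [Fintype ι] [DecidableEq ι]
    [AddCommGroup E] [Module ℝ E] (v : ι → E) :
    ∃ (I : Finset ι) (X : ι → ι → ℝ), LinearIndepOn ℝ v (I : Set ι) ∧
      (∀ j, v j = ∑ i ∈ I, X i j • v i) ∧ ∀ i ∈ I, ∀ j, |X i j| ≤ 1 := by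
  classical
  let V := Submodule.span ℝ (Set.range v)
  have : Module.Finite ℝ V := Module.Finite.span_of_finite ℝ (Set.finite_range v)
  let u : ι → V := fun j => ⟨v j, Submodule.subset_span ⟨j, rfl⟩⟩
  have hu : Submodule.span ℝ (Set.range u) = ⊤ := by
    have : Set.range u = (↑) ⁻¹' Set.range v := by
      ext x
      simp [u, Subtype.ext_iff]
    rw [this]
    exact Submodule.span_span_coe_preimage
  obtain ⟨g, hg, hgspan, hgli⟩ := Submodule.exists_fun_fin_finrank_span_eq ℝ (Set.range u)
  choose f₀ hf₀ using hg
  replace hgspan := hgspan.trans hu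
  let e := Module.Basis.mk hgli hgspan.ge
  have : Nonempty (Fin (Module.finrank ℝ (Submodule.span ℝ (Set.range u))) → ι) := ⟨f₀⟩
  obtain ⟨f, hf⟩ := Finite.exists_max fun f => |e.det (u ∘ f)|
  have hdet : e.det (u ∘ f) ≠ 0 := by
    have h0 : u ∘ f₀ = e := by
      ext1 i
      simp [e, hf₀]
    have h1 := hf f₀
    rw [h0, e.det_self, abs_one] at h1
    intro h
    rw [h, abs_zero] at h1
    linarith
  obtain ⟨hli, hsp⟩ := (Module.Basis.is_basis_iff_det e).2 (isUnit_iff_ne_zero.2 hdet)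
  let w := Module.Basis.mk hli hsp.ge
  have hw : ∀ i, w i = u (f i) := fun i => by simp [w]
  have hfinj : Function.Injective f := fun a b h => hli.injective (by simp [h])
  have hcoord : ∀ i j, |w.repr (u j) i| ≤ 1 := by
    intro i j
    have h1 : u ∘ Function.update f i j = Function.update (u ∘ f) i (u j) := by
      rw [Function.comp_update]
    have h2 : e.det (Function.update (u ∘ f) i (u j)) = w.repr (u j) i * e.det (u ∘ f) := by
      conv_lhs => rw [← w.sum_repr (u j)]
      rw [AlternatingMap.map_update_sum, Finset.sum_eq_single i]
      · rw [AlternatingMap.map_update_smul, hw, smul_eq_mul]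
        congr 2
        exact Function.update_eq_self i (u ∘ f)
      · intro b _ hb
        rw [AlternatingMap.map_update_smul, hw, smul_eq_mul]
        have := AlternatingMap.map_update_self e.det (u ∘ f) hb.symm
        simp only [Function.comp_apply] at this
        rw [this, mul_zero]
      · simp
    have h3 := hf (Function.update f i j)
    simp only [h1, h2, abs_mul] at h3
    exact le_of_mul_le_mul_right (by linarith) (abs_pos.2 hdet)
  refine ⟨Finset.univ.image f, fun i j => if h : ∃ a, f a = i then w.repr (u j) h.choose else 0,
    ?_, ?_, ?_⟩
  · have : LinearIndependent ℝ (v ∘ f) := hli.map' V.subtype (Submodule.ker_subtype _)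
    rw [Finset.coe_image, Finset.coe_univ, Set.image_univ]
    exact (linearIndepOn_range_iff hfinj v).2 this
  · intro j
    rw [Finset.sum_image hfinj.injOn]
    have h := congrArg Subtype.val (w.sum_repr (u j))
    rw [AddSubmonoidClass.coe_finsetSum] at h
    refine h.symm.trans (Finset.sum_congr rfl fun a _ => ?_)
    have hex : ∃ b, f b = f a := ⟨a, rfl⟩
    beta_reduce
    rw [dif_pos hex, hfinj hex.choose_spec, hw]
    rfl
  · intro i hi j
    by_cases h : ∃ a, f a = i
    · simp only [dif_pos h]
      exact hcoord _ _
    · simp [h]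

/-- Coordinates with respect to a linearly independent subfamily. -/
theorem LinearIndepOn.coord_eq_ite {ι E : Type*} [DecidableEq ι] [AddCommGroup E] [Module ℝ E]
    {v : ι → E} {I : Finset ι} {X : ι → ι → ℝ} (hv : LinearIndepOn ℝ v (I : Set ι))
    (hX : ∀ j, v j = ∑ i ∈ I, X i j • v i) {i j : ι} (hi : i ∈ I) (hj : j ∈ I) :
    X i j = if i = j then 1 else 0 := by
  have h : ∑ a ∈ I, (X a j - if a = j then 1 else 0) • v a = 0 := by
    simp only [sub_smul, Finset.sum_sub_distrib, ← hX j, ite_smul, one_smul, zero_smul]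
    simp [hj]
  exact sub_eq_zero.1 (linearIndepOn_finset_iff.1 hv _ h i hi)

theorem card_mul_card_sq_mul_le {ι : Type*} [Fintype ι] [DecidableEq ι] {ℓ : ℕ} (hℓ : 0 < ℓ)
    (𝒜 ℬ : Finset (Finset ι)) (h : ∀ A ∈ 𝒜, ∀ B ∈ ℬ, (A ∩ B).card = ℓ) :
    (𝒜.card * ℬ.card) ^ 2 * ℓ ≤ 4 * 4 ^ Fintype.card ι := by
  classical
  rcases 𝒜.eq_empty_or_nonempty with rfl | ⟨a₀, ha₀⟩
  · simp
  rcases ℬ.eq_empty_or_nonempty with rfl | ⟨b₀, hb₀⟩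
  · simp
  let v : ι → (𝒜 → ℝ) := fun j a => if j ∈ a.1 then 1 else 0
  obtain ⟨I, X, hli, hX, hX1⟩ := exists_linearIndepOn_abs_coord_le_one v
  have hXI : ∀ i ∈ I, ∀ j ∈ I, X i j = if i = j then 1 else 0 :=
    fun i hi j hj => hli.coord_eq_ite hX hi hj
  have hXa : ∀ a ∈ 𝒜, ∀ j, (if j ∈ a then (1 : ℝ) else 0) = ∑ i ∈ I ∩ a, X i j := by
    intro a ha j
    have := congrFun (hX j) ⟨a, ha⟩
    simpa [v, Finset.sum_apply, Finset.sum_ite_mem] using this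
  have hinter : ∀ a ∈ 𝒜, ∀ b ∈ ℬ, ∑ i ∈ I ∩ a, ∑ j ∈ b, X i j = ℓ := by
    intro a ha b hb
    rw [Finset.sum_comm, ← Finset.sum_congr rfl fun j _ => hXa a ha j, Finset.sum_boole,
      Finset.filter_mem_eq_inter, Finset.inter_comm, h a ha b hb]
  let c : ι → ℝ := fun i => ∑ j ∈ b₀, X i j
  have hc : ∀ b ∈ ℬ, ∀ i ∈ I, ∑ j ∈ b, X i j = c i := by
    intro b hb i hi
    refine sub_eq_zero.1 (linearIndepOn_finset_iff.1 hli (fun i => ∑ j ∈ b, X i j - c i) ?_ i hi)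
    ext a
    have h1 := hinter a.1 a.2 b hb
    have h2 := hinter a.1 a.2 b₀ hb₀
    simp only [v, Finset.sum_apply, Pi.smul_apply, smul_eq_mul, mul_ite, mul_one, mul_zero,
      Finset.sum_ite_mem, Finset.sum_sub_distrib, Pi.zero_apply, c]
    rw [h1, h2, sub_self]
  have hca : ∀ a ∈ 𝒜, ∑ i ∈ I ∩ a, c i = ℓ := fun a ha => hinter a ha b₀ hb₀
  let R := I.filter fun i => c i ≠ 0
  have hA : 𝒜.card ^ 2 * (R.card + 1) ≤ 4 ^ I.card := by
    have hinj : Set.InjOn (fun a => I ∩ a) (𝒜 : Set (Finset ι)) := by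
      intro a ha a' ha' haa
      ext j
      have h1 := hXa a ha j
      have h2 := hXa a' ha' j
      simp only at haa
      rw [haa, ← h2] at h1
      by_cases hj : j ∈ a <;> by_cases hj' : j ∈ a' <;> simp [hj, hj'] at h1 ⊢
    rw [← Finset.card_image_of_injOn hinj]
    refine card_sq_mul_le_of_forall_sum_eq (Finset.filter_subset _ _) c
      (fun j hj => (Finset.mem_filter.1 hj).2) ℓ _ ?_ ?_
    · simp only [Finset.mem_image]
      rintro _ ⟨a, _, rfl⟩
      exact Finset.inter_subset_left
    · simp only [Finset.mem_image]
      rintro _ ⟨a, ha, rfl⟩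
      exact hca a ha
  obtain ⟨i, hi, hci⟩ : ∃ i ∈ I, (ℓ : ℝ) ≤ c i * R.card := by
    by_contra! hlt
    have h1 : ∑ i ∈ R ∩ a₀, c i = ℓ := by
      rw [← hca a₀ ha₀]
      refine Finset.sum_subset (Finset.inter_subset_inter_right (Finset.filter_subset _ _)) ?_
      intro i hi hi'
      by_contra hne
      simp only [R, Finset.mem_inter, Finset.mem_filter] at hi hi'
      exact hi' ⟨⟨hi.1, hne⟩, hi.2⟩
    have hℓ' : (0 : ℝ) < ℓ := by exact_mod_cast hℓ
    have hne : (R ∩ a₀).Nonempty := by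
      rw [Finset.nonempty_iff_ne_empty]
      intro he
      rw [he, Finset.sum_empty] at h1
      linarith
    have h2 : ∑ i ∈ R ∩ a₀, c i * R.card < ∑ _i ∈ R ∩ a₀, (ℓ : ℝ) :=
      Finset.sum_lt_sum_of_nonempty hne fun i hi =>
        hlt i (Finset.mem_filter.1 (Finset.mem_inter.1 hi).1).1
    rw [← Finset.sum_mul, h1, Finset.sum_const, nsmul_eq_mul] at h2
    have h3 : ((R ∩ a₀).card : ℝ) ≤ R.card := by
      exact_mod_cast Finset.card_le_card Finset.inter_subset_left
    nlinarith
  have hcb : ∀ b ∈ ℬ, ∀ i ∈ I, ∑ j ∈ b \ I, X i j = c i - if i ∈ b then 1 else 0 := by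
    intro b hb i hi
    rw [← hc b hb i hi, ← Finset.sum_inter_add_sum_sdiff b I]
    have : ∑ j ∈ b ∩ I, X i j = if i ∈ b then 1 else 0 := by
      rw [Finset.sum_congr rfl fun j hj => hXI i hi j (Finset.mem_inter.1 hj).2]
      simp [hi]
    rw [this]
    ring
  let R' := Iᶜ.filter fun j => X i j ≠ 0
  have hB : ∀ t : ℝ, (ℬ.filter fun b => (if i ∈ b then (1 : ℝ) else 0) = t).card ^ 2 *
      (R'.card + 1) ≤ 4 ^ Iᶜ.card := by
    intro t
    have hinj : Set.InjOn (fun b => b \ I) (ℬ : Set (Finset ι)) := by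
      intro b hb b' hb' hbb
      simp only at hbb
      ext j
      by_cases hj : j ∈ I
      · have h1 := hcb b hb j hj
        rw [hbb, hcb b' hb' j hj] at h1
        by_cases hj : j ∈ b <;> by_cases hj' : j ∈ b' <;> simp [hj, hj'] at h1 ⊢
        linarith
      · simpa [hj] using Finset.ext_iff.1 hbb j
    rw [← Finset.card_image_of_injOn (hinj.mono (Finset.coe_subset.2 (Finset.filter_subset _ _)))]
    refine card_sq_mul_le_of_forall_sum_eq (Finset.filter_subset _ _) (X i)
      (fun j hj => (Finset.mem_filter.1 hj).2) (c i - t) _ ?_ ?_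
    · simp only [Finset.mem_image]
      rintro _ ⟨b, _, rfl⟩ j hj
      exact Finset.mem_compl.2 (Finset.mem_sdiff.1 hj).2
    · simp only [Finset.mem_image, Finset.mem_filter]
      rintro _ ⟨b, ⟨hb, rfl⟩, rfl⟩
      exact hcb b hb i hi
  have hcR : c i ≤ R'.card + 1 := by
    have h1 : ∑ j ∈ b₀ \ I, X i j ≤ R'.card := by
      calc ∑ j ∈ b₀ \ I, X i j ≤ ∑ j ∈ b₀ \ I, |X i j| :=
            Finset.sum_le_sum fun _ _ => le_abs_self _
        _ ≤ ∑ j ∈ Iᶜ, |X i j| := Finset.sum_le_sum_of_subset_of_nonneg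
            (fun j hj => Finset.mem_compl.2 (Finset.mem_sdiff.1 hj).2)
            fun _ _ _ => abs_nonneg _
        _ = ∑ j ∈ R', |X i j| := by
            refine (Finset.sum_filter_of_ne fun j _ hj => ?_).symm
            exact abs_ne_zero.1 hj
        _ ≤ ∑ _j ∈ R', (1 : ℝ) := Finset.sum_le_sum fun j _ => hX1 i hi j
        _ = R'.card := by simp
    rw [hcb b₀ hb₀ i hi] at h1
    split_ifs at h1 <;> linarith
  have hsplit : ℬ.card = (ℬ.filter fun b => (if i ∈ b then (1 : ℝ) else 0) = 1).card +
      (ℬ.filter fun b => (if i ∈ b then (1 : ℝ) else 0) = 0).card := by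
    rw [← Finset.card_filter_add_card_filter_not (s := ℬ) (fun b => i ∈ b)]
    congr 2 <;> ext b <;> by_cases hb : i ∈ b <;> simp [hb]
  have hBB : ℬ.card ^ 2 * (R'.card + 1) ≤ 4 * 4 ^ Iᶜ.card := by
    have h1 := hB 1
    have h0 := hB 0
    rw [hsplit]
    generalize (ℬ.filter fun b => (if i ∈ b then (1 : ℝ) else 0) = 1).card = x at *
    generalize (ℬ.filter fun b => (if i ∈ b then (1 : ℝ) else 0) = 0).card = y at *
    calc (x + y) ^ 2 * (R'.card + 1) ≤ (2 * (x ^ 2 + y ^ 2)) * (R'.card + 1) := by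
          gcongr
          exact add_sq_le
      _ = 2 * (x ^ 2 * (R'.card + 1) + y ^ 2 * (R'.card + 1)) := by ring
      _ ≤ 4 * 4 ^ Iᶜ.card := by linarith
  have hℓR : ℓ ≤ (R'.card + 1) * (R.card + 1) := by
    have : (ℓ : ℝ) ≤ (R'.card + 1) * (R.card + 1) :=
      hci.trans (by nlinarith [(Nat.cast_nonneg R.card : (0 : ℝ) ≤ R.card)])
    exact_mod_cast this
  calc (𝒜.card * ℬ.card) ^ 2 * ℓ
      ≤ (𝒜.card * ℬ.card) ^ 2 * ((R'.card + 1) * (R.card + 1)) := by gcongr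
    _ = (𝒜.card ^ 2 * (R.card + 1)) * (ℬ.card ^ 2 * (R'.card + 1)) := by ring
    _ ≤ 4 ^ I.card * (4 * 4 ^ Iᶜ.card) := Nat.mul_le_mul hA hBB
    _ = 4 * 4 ^ Fintype.card ι := by
        rw [← Finset.card_add_card_compl I, pow_add]
        ring

/-- There exists a positive integer `ℓ₀` such that for every `ℓ ≥ ℓ₀` and
every `n`, every `ℓ`-cross-intersecting pair `(𝒜, ℬ)` of families of subsets of `[n]`
satisfies `|𝒜|·|ℬ| ≤ 2^(n+3)/√ℓ`, equivalently `(|𝒜|·|ℬ|)²·ℓ ≤ 2^(2n+6)`. -/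
theorem stmt_2 :
    ∃ ℓ₀ : ℕ, 0 < ℓ₀ ∧ ∀ ℓ : ℕ, ℓ₀ ≤ ℓ → ∀ n : ℕ,
      ∀ 𝒜 ℬ : Finset (Finset (Fin n)),
        (∀ A ∈ 𝒜, ∀ B ∈ ℬ, (A ∩ B).card = ℓ) →
        (𝒜.card * ℬ.card) ^ 2 * ℓ ≤ 2 ^ (2 * n + 6) := by
  refine ⟨1, one_pos, fun ℓ hℓ n 𝒜 ℬ h => (card_mul_card_sq_mul_le hℓ 𝒜 ℬ h).trans ?_⟩
  rw [Fintype.card_fin, pow_add, pow_mul]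
  norm_num
  linarith [Nat.zero_le (4 ^ n)]
end

section
/- Let ℓ ≥ 1, let κ ∈ {2ℓ−1, 2ℓ}, τ ∈ {0,…,κ}, and κ+τ ≤ n' ≤ n. Let T be the collection consisting of the τ pairs {1, κ+1}, …, {τ, κ+τ} together with the κ−τ singletons {τ+1}, …, {κ}, let X = {κ+τ+1,…,n'} and Y = {n'+1,…,n}. Define 𝒜 = { (∪_{T∈J} T) ∪ S : J ⊆ T, |J| = ℓ, S ⊆ X } and ℬ = { L ∪ {τ+1,…,κ} ∪ S' : L ⊆ {1,…,τ} ∪ {κ+1,…,κ+τ} with |L ∩ {i, κ+i}| = 1 for every i ∈ {1,…,τ}, S' ⊆ Y }. Then the pair (𝒜, ℬ) is ℓ-cross-intersecting and |𝒜|·|ℬ| = binom(κ, ℓ)·2^(n−κ) = binom(2ℓ, ℓ)·2^(n−2ℓ). -/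
open Finset

/-- The `i`-th block: the pair `{i, κ + i}` if `i < τ`, and the singleton `{i}` otherwise. -/
def pairBlock (κ τ i : ℕ) : Finset ℕ := if i < τ then {i, κ + i} else {i}

theorem mem_pairBlock {κ τ i x : ℕ} :
    x ∈ pairBlock κ τ i ↔ x = i ∨ (i < τ ∧ x = κ + i) := by
  unfold pairBlock
  split_ifs with h <;> simp [h]

theorem pairBlock_injOn (κ τ : ℕ) : Set.InjOn (pairBlock κ τ) (range κ) := by
  intro i hi j hj h
  simp only [coe_range, Set.mem_Iio] at hi hj
  have hi' : i ∈ pairBlock κ τ j := h ▸ mem_pairBlock.2 (Or.inl rfl)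
  rw [mem_pairBlock] at hi'
  omega

theorem image_pairBlock {κ τ : ℕ} (hτ : τ ≤ κ) :
    (range κ).image (pairBlock κ τ) =
      (range τ).image (fun i => ({i, κ + i} : Finset ℕ)) ∪
        (Ico τ κ).image (fun j => ({j} : Finset ℕ)) := by
  have hsplit : range κ = range τ ∪ Ico τ κ := by
    ext x
    simp only [mem_range, mem_union, mem_Ico]
    omega
  rw [hsplit, image_union]
  congr 1
  · exact image_congr fun i hi => if_pos (by simpa using hi)
  · refine image_congr fun i hi => if_neg ?_
    simp only [coe_Ico, Set.mem_Ico] at hi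
    omega

theorem exists_subset_image_pairBlock_iff {κ τ ℓ : ℕ} {p : Finset ℕ → Prop} :
    (∃ J ⊆ (range κ).image (pairBlock κ τ), J.card = ℓ ∧ p (J.sup id)) ↔
      ∃ I ∈ powersetCard ℓ (range κ), p (I.biUnion (pairBlock κ τ)) := by
  have hsup (I : Finset ℕ) :
      (I.image (pairBlock κ τ)).sup id = I.biUnion (pairBlock κ τ) := by
    rw [sup_image, Function.id_comp, sup_eq_biUnion]
  have hcard {I : Finset ℕ} (hI : I ⊆ range κ) : (I.image (pairBlock κ τ)).card = I.card :=
    card_image_of_injOn ((pairBlock_injOn κ τ).mono (by exact_mod_cast hI))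
  constructor
  · rintro ⟨J, hJ, rfl, hp⟩
    obtain ⟨I, hI, rfl⟩ := subset_image_iff.1 hJ
    replace hI : I ⊆ range κ := by exact_mod_cast hI
    exact ⟨I, mem_powersetCard.2 ⟨hI, (hcard hI).symm⟩, hsup I ▸ hp⟩
  · rintro ⟨I, hI, hp⟩
    obtain ⟨hIκ, rfl⟩ := mem_powersetCard.1 hI
    exact ⟨_, image_subset_image hIκ, hcard hIκ, (hsup I).symm ▸ hp⟩

theorem card_inter_pair_eq_one_iff {a b : ℕ} (hab : a ≠ b) (L : Finset ℕ) :
    (L ∩ {a, b}).card = 1 ↔ (b ∈ L ↔ a ∉ L) := by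
  by_cases ha : a ∈ L <;> by_cases hb : b ∈ L <;>
    simp [ha, hb, hab, inter_insert_of_mem, inter_insert_of_notMem, inter_singleton_of_mem,
      inter_singleton_of_notMem]

/-- The union of the blocks indexed by `p.1` together with `p.2`. -/
def blockUnion (κ τ : ℕ) (p : Finset ℕ × Finset ℕ) : Finset ℕ :=
  p.1.biUnion (pairBlock κ τ) ∪ p.2

theorem blockUnion_injOn (κ τ ℓ n' : ℕ) :
    Set.InjOn (blockUnion κ τ)
      (powersetCard ℓ (range κ) ×ˢ (Ico (κ + τ) n').powerset : Finset _) := by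
  rintro ⟨I, S⟩ h ⟨I', S'⟩ h' heq
  simp only [coe_product, Set.mem_prod, mem_coe, mem_powersetCard, mem_powerset] at h h'
  have hmem (x : ℕ) : (∃ i ∈ I, x = i ∨ (i < τ ∧ x = κ + i)) ∨ x ∈ S ↔
      (∃ i ∈ I', x = i ∨ (i < τ ∧ x = κ + i)) ∨ x ∈ S' := by
    simpa [blockUnion, mem_pairBlock] using Finset.ext_iff.1 heq x
  have hI := fun x (hx : x ∈ I) => mem_range.1 (h.1.1 hx)
  have hI' := fun x (hx : x ∈ I') => mem_range.1 (h'.1.1 hx)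
  have hS := fun x (hx : x ∈ S) => mem_Ico.1 (h.2 hx)
  have hS' := fun x (hx : x ∈ S') => mem_Ico.1 (h'.2 hx)
  refine Prod.ext (Finset.ext fun x => ?_) (Finset.ext fun x => ?_) <;>
    · have := hmem x
      grind

/-- The transversal of the pairs `{i, κ + i}`, `i < τ`, that picks `i` exactly for `i ∈ P`. -/
def pairTransversal (κ τ : ℕ) (P : Finset ℕ) : Finset ℕ :=
  P ∪ (range τ \ P).image (κ + ·)

theorem mem_pairTransversal {κ τ x : ℕ} {P : Finset ℕ} :
    x ∈ pairTransversal κ τ P ↔ x ∈ P ∨ ∃ i < τ, i ∉ P ∧ x = κ + i := by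
  simp [pairTransversal, and_assoc, eq_comm]

theorem isTransversal_iff {κ τ : ℕ} (hτ : τ ≤ κ) (L : Finset ℕ) :
    (L ⊆ range τ ∪ Ico κ (κ + τ) ∧ ∀ i < τ, (L ∩ {i, κ + i}).card = 1) ↔
      ∃ P ⊆ range τ, L = pairTransversal κ τ P := by
  have hone {L : Finset ℕ} {i : ℕ} (hi : i < τ) :=
    card_inter_pair_eq_one_iff (a := i) (b := κ + i) (by omega) L
  constructor
  · rintro ⟨hL, h⟩
    refine ⟨L ∩ range τ, inter_subset_right, Finset.ext fun x => ?_⟩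
    simp only [mem_pairTransversal, mem_inter, mem_range]
    constructor
    · intro hx
      have hx' := hL hx
      simp only [mem_union, mem_range, mem_Ico] at hx'
      by_cases hxτ : x < τ
      · exact Or.inl ⟨hx, hxτ⟩
      · obtain ⟨i, rfl⟩ := Nat.exists_eq_add_of_le (show κ ≤ x by omega)
        have hi : i < τ := by omega
        exact Or.inr ⟨i, hi, fun hiL => ((hone hi).1 (h i hi)).1 hx hiL.1, rfl⟩
    · rintro (hx | ⟨i, hi, hiL, rfl⟩)
      · exact hx.1
      · exact ((hone hi).1 (h i hi)).2 fun hL => hiL ⟨hL, hi⟩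
  · rintro ⟨P, hP, rfl⟩
    have hP' := fun x (hx : x ∈ P) => mem_range.1 (hP hx)
    refine ⟨fun x hx => ?_, fun i hi => (hone hi).2 ?_⟩
    · rw [mem_pairTransversal] at hx
      simp only [mem_union, mem_range, mem_Ico]
      grind
    · simp only [mem_pairTransversal]
      grind

/-- The transversal given by `p.1`, together with the singleton blocks and `p.2`. -/
def transversalUnion (κ τ : ℕ) (p : Finset ℕ × Finset ℕ) : Finset ℕ :=
  pairTransversal κ τ p.1 ∪ Ico τ κ ∪ p.2

theorem mem_transversalUnion {κ τ x : ℕ} {p : Finset ℕ × Finset ℕ} :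
    x ∈ transversalUnion κ τ p ↔
      ((x ∈ p.1 ∨ ∃ i < τ, i ∉ p.1 ∧ x = κ + i) ∨ (τ ≤ x ∧ x < κ)) ∨ x ∈ p.2 := by
  simp only [transversalUnion, mem_union, mem_pairTransversal, mem_Ico]

theorem transversalUnion_injOn {κ τ n' n : ℕ} (hτ : τ ≤ κ) (hn' : κ + τ ≤ n') :
    Set.InjOn (transversalUnion κ τ)
      ((range τ).powerset ×ˢ (Ico n' n).powerset : Finset _) := by
  rintro ⟨P, S⟩ h ⟨P', S'⟩ h' heq
  simp only [coe_product, Set.mem_prod, mem_coe, mem_powerset] at h h'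
  have hmem (x : ℕ) := Finset.ext_iff.1 heq x
  simp only [mem_transversalUnion] at hmem
  have hP := fun x (hx : x ∈ P) => mem_range.1 (h.1 hx)
  have hP' := fun x (hx : x ∈ P') => mem_range.1 (h'.1 hx)
  have hS := fun x (hx : x ∈ S) => mem_Ico.1 (h.2 hx)
  have hS' := fun x (hx : x ∈ S') => mem_Ico.1 (h'.2 hx)
  refine Prod.ext (Finset.ext fun x => ?_) (Finset.ext fun x => ?_) <;>
    · have := hmem x
      grind

theorem card_pairBlock_inter_transversalUnion {κ τ n' n i : ℕ} (hτ : τ ≤ κ)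
    (hn' : κ + τ ≤ n') (hi : i < κ) {P S : Finset ℕ} (hP : P ⊆ range τ) (hS : S ⊆ Ico n' n) :
    (pairBlock κ τ i ∩ transversalUnion κ τ (P, S)).card = 1 := by
  have hP := fun x (hx : x ∈ P) => mem_range.1 (hP hx)
  have hS := fun x (hx : x ∈ S) => mem_Ico.1 (hS hx)
  by_cases hiτ : i < τ
  · rw [pairBlock, if_pos hiτ, inter_comm, card_inter_pair_eq_one_iff (by omega)]
    simp only [mem_transversalUnion]
    grind
  · rw [pairBlock, if_neg hiτ, singleton_inter_of_mem, card_singleton]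
    exact mem_transversalUnion.2 (Or.inl (Or.inr ⟨by omega, hi⟩))

theorem card_blockUnion_inter_transversalUnion {κ τ n' n : ℕ} (hτ : τ ≤ κ)
    (hn' : κ + τ ≤ n') {I S P S' : Finset ℕ} (hI : I ⊆ range κ) (hS : S ⊆ Ico (κ + τ) n')
    (hP : P ⊆ range τ) (hS' : S' ⊆ Ico n' n) :
    (blockUnion κ τ (I, S) ∩ transversalUnion κ τ (P, S')).card = I.card := by
  have hdisj : S ∩ transversalUnion κ τ (P, S') = ∅ := by
    refine disjoint_iff_inter_eq_empty.1 (disjoint_left.2 fun x hx hx' => ?_)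
    have hxS := mem_Ico.1 (hS hx)
    have hP := fun x (hx : x ∈ P) => mem_range.1 (hP hx)
    have hS' := fun x (hx : x ∈ S') => mem_Ico.1 (hS' hx)
    rw [mem_transversalUnion] at hx'
    grind
  rw [blockUnion, union_inter_distrib_right, hdisj, union_empty, biUnion_inter, card_biUnion,
    sum_congr rfl fun i hi => card_pairBlock_inter_transversalUnion hτ hn'
      (mem_range.1 (hI hi)) hP hS', sum_const, smul_eq_mul, mul_one]
  intro i hi j hj hij
  have hi := mem_range.1 (hI hi)
  have hj := mem_range.1 (hI hj)
  refine (disjoint_left.2 fun x hx hx' => ?_ :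
    Disjoint (pairBlock κ τ i) (pairBlock κ τ j)).mono inter_subset_left inter_subset_left
  rw [mem_pairBlock] at hx hx'
  omega

theorem choose_two_mul_sub_one {ℓ : ℕ} (hℓ : 1 ≤ ℓ) :
    (2 * ℓ).choose ℓ = 2 * (2 * ℓ - 1).choose ℓ := by
  obtain ⟨m, rfl⟩ := Nat.exists_eq_add_of_le' hℓ
  have h : (2 * m + 1).choose m = (2 * m + 1).choose (m + 1) :=
    Nat.choose_symm_of_eq_add (by omega)
  rw [show 2 * (m + 1) - 1 = 2 * m + 1 by omega, show 2 * (m + 1) = 2 * m + 1 + 1 by omega,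
    Nat.choose_succ_succ, h, Nat.succ_eq_add_one, ← two_mul]


/-- Let `ℓ ≥ 1`, `κ ∈ {2ℓ−1, 2ℓ}`, `τ ∈ {0,…,κ}`, `κ+τ ≤ n' ≤ n`.
With 0-based indexing of `[n]` as `{0,…,n−1}`: let `𝒯` consist of the `τ` pairs
`{i, κ+i}` (`i < τ`) and the `κ−τ` singletons `{j}` (`τ ≤ j < κ`), let
`X = {κ+τ,…,n'−1}` and `Y = {n',…,n−1}`. Define
`𝒜 = { (∪_{T∈J} T) ∪ S : J ⊆ 𝒯, |J| = ℓ, S ⊆ X }` and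
`ℬ = { L ∪ {τ,…,κ−1} ∪ S' : L ⊆ {0,…,τ−1} ∪ {κ,…,κ+τ−1}, |L ∩ {i,κ+i}| = 1 ∀ i < τ,
S' ⊆ Y }`. Then `(𝒜, ℬ)` is `ℓ`-cross-intersecting and
`|𝒜|·|ℬ| = binom(κ,ℓ)·2^(n−κ) = binom(2ℓ,ℓ)·2^(n−2ℓ)`. -/
theorem stmt_4 (ℓ κ τ n' n : ℕ) (hℓ : 1 ≤ ℓ)
    (hκ : κ = 2 * ℓ - 1 ∨ κ = 2 * ℓ) (hτ : τ ≤ κ)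
    (hn' : κ + τ ≤ n') (hn : n' ≤ n)
    (𝒯 : Finset (Finset ℕ))
    (h𝒯 : 𝒯 = (Finset.range τ).image (fun i => ({i, κ + i} : Finset ℕ)) ∪
              (Finset.Ico τ κ).image (fun j => ({j} : Finset ℕ)))
    (𝒜 ℬ : Finset (Finset ℕ))
    (h𝒜 : ∀ A, A ∈ 𝒜 ↔
      ∃ J ⊆ 𝒯, J.card = ℓ ∧ ∃ S ⊆ Finset.Ico (κ + τ) n', A = J.sup id ∪ S)
    (hℬ : ∀ B, B ∈ ℬ ↔
      ∃ L ⊆ Finset.range τ ∪ Finset.Ico κ (κ + τ),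
        (∀ i < τ, (L ∩ {i, κ + i}).card = 1) ∧
        ∃ S' ⊆ Finset.Ico n' n, B = L ∪ Finset.Ico τ κ ∪ S') :
    (∀ A ∈ 𝒜, ∀ B ∈ ℬ, (A ∩ B).card = ℓ) ∧
    (𝒜.card * ℬ.card : ℝ) = (Nat.choose κ ℓ : ℝ) * (2 : ℝ) ^ ((n : ℤ) - (κ : ℤ)) ∧
    (𝒜.card * ℬ.card : ℝ) =
      (Nat.choose (2 * ℓ) ℓ : ℝ) * (2 : ℝ) ^ ((n : ℤ) - 2 * (ℓ : ℤ)) := by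
  have h𝒜' : 𝒜 = (powersetCard ℓ (range κ) ×ˢ (Ico (κ + τ) n').powerset).image
      (blockUnion κ τ) := by
    ext A
    rw [h𝒜, h𝒯, ← image_pairBlock hτ, exists_subset_image_pairBlock_iff
      (p := fun U => ∃ S ⊆ Ico (κ + τ) n', A = U ∪ S)]
    simp only [mem_image, mem_product, mem_powerset, Prod.exists, blockUnion, and_assoc,
      exists_and_left, eq_comm]
  have hℬ' : ℬ = ((range τ).powerset ×ˢ (Ico n' n).powerset).image
      (transversalUnion κ τ) := by
    ext B
    rw [hℬ]
    simp only [mem_image, mem_product, mem_powerset, Prod.exists, transversalUnion]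
    constructor
    · rintro ⟨L, hL, h, S', hS', rfl⟩
      obtain ⟨P, hP, rfl⟩ := (isTransversal_iff hτ L).1 ⟨hL, h⟩
      exact ⟨P, S', ⟨hP, hS'⟩, rfl⟩
    · rintro ⟨P, S', ⟨hP, hS'⟩, rfl⟩
      obtain ⟨hL, h⟩ := (isTransversal_iff hτ _).2 ⟨P, hP, rfl⟩
      exact ⟨_, hL, h, S', hS', rfl⟩
  have hprod : 𝒜.card * ℬ.card = κ.choose ℓ * 2 ^ (n - κ) := by
    rw [h𝒜', hℬ', card_image_of_injOn (blockUnion_injOn κ τ ℓ n'),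
      card_image_of_injOn (transversalUnion_injOn hτ hn')]
    simp only [card_product, card_powersetCard, card_powerset, card_range, Nat.card_Ico]
    rw [mul_assoc, ← pow_add, ← pow_add]
    congr 2
    omega
  have hreal : (𝒜.card * ℬ.card : ℝ) = (κ.choose ℓ : ℝ) * (2 : ℝ) ^ ((n : ℤ) - (κ : ℤ)) := by
    rw [← Nat.cast_sub (by omega : κ ≤ n), zpow_natCast]
    exact_mod_cast hprod
  refine ⟨?_, hreal, ?_⟩
  · subst h𝒜' hℬ'
    simp only [mem_image, mem_product, mem_powersetCard, mem_powerset, Prod.exists]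
    rintro _ ⟨I, S, ⟨⟨hI, rfl⟩, hS⟩, rfl⟩ _ ⟨P, S', ⟨hP, hS'⟩, rfl⟩
    exact card_blockUnion_inter_transversalUnion hτ hn' hI hS hP hS'
  · rw [hreal]
    rcases hκ with rfl | rfl
    · rw [choose_two_mul_sub_one hℓ,
        show (n : ℤ) - ((2 * ℓ - 1 : ℕ) : ℤ) = ((n : ℤ) - 2 * (ℓ : ℤ)) + 1 by omega,
        zpow_add_one₀ two_ne_zero]
      push_cast
      ring
    · push_cast
      rfl
end

section
/- For every ℓ ≥ 0 and every n, every ℓ-cross-intersecting pair (𝒜, ℬ) of families of subsets of [n] satisfies |𝒜|·|ℬ| ≤ 2^n. -/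
/-- The characteristic vector over `𝔽₂` of a subset of `[n]`. -/
def charVec {n : ℕ} (A : Finset (Fin n)) : Fin n → ZMod 2 :=
  fun i => if i ∈ A then 1 else 0

theorem charVec_injective {n : ℕ} : Function.Injective (charVec (n := n)) := by
  intro A B h
  ext i
  have hi := congrFun h i
  by_cases hA : i ∈ A <;> by_cases hB : i ∈ B <;> simp_all [charVec]

theorem charVec_dotProduct {n : ℕ} (A B : Finset (Fin n)) :
    charVec B ⬝ᵥ charVec A = ((A ∩ B).card : ZMod 2) := by
  simp [charVec, dotProduct, Finset.inter_comm]

/-- A subspace and its annihilator have cardinalities whose product is that of the space. -/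
theorem card_mul_card_dualAnnihilator {K V : Type*} [Field K] [Finite K] [AddCommGroup V]
    [Module K V] [FiniteDimensional K V] (W : Submodule K V) :
    Nat.card W * Nat.card W.dualAnnihilator = Nat.card V := by
  rw [Module.natCard_eq_pow_finrank (K := K) (V := W),
    Module.natCard_eq_pow_finrank (K := K) (V := W.dualAnnihilator),
    Module.natCard_eq_pow_finrank (K := K) (V := V), ← pow_add,
    Subspace.finrank_add_finrank_dualAnnihilator_eq]

/-- For every `ℓ ≥ 0` and every `n`, every `ℓ`-cross-intersecting pair
`(𝒜, ℬ)` of families of subsets of `[n]` satisfies `|𝒜|·|ℬ| ≤ 2^n`. -/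
theorem stmt_5 (ℓ n : ℕ) (𝒜 ℬ : Finset (Finset (Fin n)))
    (hcross : ∀ A ∈ 𝒜, ∀ B ∈ ℬ, (A ∩ B).card = ℓ) :
    𝒜.card * ℬ.card ≤ 2 ^ n := by
  obtain rfl | ⟨A₀, hA₀⟩ := 𝒜.eq_empty_or_nonempty
  · simp
  let W : Submodule (ZMod 2) (Fin n → ZMod 2) :=
    Submodule.span (ZMod 2) ((fun A => charVec A - charVec A₀) '' (𝒜 : Set (Finset (Fin n))))
  have : Finite (Module.Dual (ZMod 2) (Fin n → ZMod 2)) :=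
    Module.finite_of_finite (ZMod 2)
  have h𝒜 : 𝒜.card ≤ Nat.card W := by
    rw [← Nat.card_eq_finsetCard 𝒜]
    refine Nat.card_le_card_of_injective
      (fun A : 𝒜 => (⟨charVec A.1 - charVec A₀,
        Submodule.subset_span ⟨A.1, A.2, rfl⟩⟩ : W)) fun A B h => ?_
    exact Subtype.ext (charVec_injective (sub_left_injective (congrArg Subtype.val h)))
  have hmem : ∀ B ∈ ℬ, dotProductEquiv (ZMod 2) (Fin n) (charVec B) ∈ W.dualAnnihilator := by
    intro B hB
    rw [Submodule.mem_dualAnnihilator]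
    intro w hw
    induction hw using Submodule.span_induction with
    | mem x hx =>
      obtain ⟨A, hA, rfl⟩ := hx
      simp [dotProduct_sub, charVec_dotProduct, hcross A hA B hB, hcross A₀ hA₀ B hB]
    | zero => simp
    | add x y _ _ hx hy => rw [map_add, hx, hy, add_zero]
    | smul a x _ hx => rw [map_smul, hx, smul_zero]
  have hℬ : ℬ.card ≤ Nat.card W.dualAnnihilator := by
    rw [← Nat.card_eq_finsetCard ℬ]
    refine Nat.card_le_card_of_injective
      (fun B : ℬ => (⟨_, hmem B.1 B.2⟩ : W.dualAnnihilator)) fun A B h => ?_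
    exact Subtype.ext (charVec_injective
      ((dotProductEquiv (ZMod 2) (Fin n)).injective (congrArg Subtype.val h)))
  calc 𝒜.card * ℬ.card ≤ Nat.card W * Nat.card W.dualAnnihilator := Nat.mul_le_mul h𝒜 hℬ
    _ = 2 ^ n := by rw [card_mul_card_dualAnnihilator]; simp
end

section
/- Let u ≤ n, let U = {1,…,u} and V = [n] \ U. Let 𝒜 be a family of subsets of [n] such that for every two distinct sets A, B ∈ 𝒜, either A ∩ U and B ∩ U are incomparable under inclusion, or A ∩ V and B ∩ V are incomparable under inclusion. Then |𝒜| ≤ binom(u, ⌊u/2⌋)·binom(n−u, ⌊(n−u)/2⌋). -/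
/-- Weighted LYM inequality: if `f` sums to at most `M` along every chain of subsets of `U`, then
so does its average over the levels of the powerset of `U`. -/
theorem sum_div_choose_le_of_chain_sum_le {α : Type*} [DecidableEq α] (f : Finset α → ℚ)
    (U : Finset α) (M : ℚ)
    (h : ∀ C ⊆ U.powerset, IsChain (· ⊆ ·) (C : Set (Finset α)) → ∑ X ∈ C, f X ≤ M) :
    ∑ X ∈ U.powerset, f X / (U.card.choose X.card : ℚ) ≤ M := by
  induction hk : U.card generalizing U M with
  | zero =>
    obtain rfl := Finset.card_eq_zero.mp hk
    simpa using h {∅} (by simp) (by simp)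
  | succ k ih =>
    have coatom : ∀ x ∈ U, ∑ X ∈ (U.erase x).powerset, f X / (k.choose X.card : ℚ) ≤ M - f U := by
      intro x hx
      refine ih (U.erase x) (M - f U) (fun C hC hchain => ?_) (by simp [hx, hk])
      have hsub : ∀ X ∈ C, X ⊆ U.erase x := fun X hX => Finset.mem_powerset.mp (hC hX)
      have hU : U ∉ C := fun hUC => by simpa using hsub U hUC hx
      have key := h (insert U C) ?_ ?_
      · rw [Finset.sum_insert hU] at key
        linarith
      · intro X hX
        rcases Finset.mem_insert.mp hX with rfl | hX
        · simp
        · exact Finset.mem_powerset.mpr ((hsub X hX).trans (Finset.erase_subset _ _))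
      · rw [Finset.coe_insert]
        exact hchain.insert fun X hX _ =>
          Or.inr ((hsub X hX).trans (Finset.erase_subset _ _))
    have total := Finset.sum_le_sum coatom
    rw [Finset.sum_const, hk, nsmul_eq_mul,
      Finset.sum_comm' (t' := U.powerset.erase U) (s' := fun X => U \ X)] at total
    · have level : ∀ X ∈ U.powerset.erase U, ∑ _x ∈ U \ X, f X / (k.choose X.card : ℚ) =
          ((k + 1 : ℕ) : ℚ) * (f X / ((k + 1).choose X.card : ℚ)) := by
        intro X hX
        obtain ⟨hne, hXU⟩ := Finset.mem_erase.mp hX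
        have hXU := Finset.mem_powerset.mp hXU
        have hlt : X.card < k + 1 := hk ▸ Finset.card_lt_card (hXU.ssubset_of_ne hne)
        have e := Nat.choose_mul_succ_eq k X.card
        have p1 : (k.choose X.card : ℚ) ≠ 0 := by
          exact_mod_cast (Nat.choose_pos (by omega)).ne'
        have p2 : ((k + 1).choose X.card : ℚ) ≠ 0 := by
          exact_mod_cast (Nat.choose_pos (by omega)).ne'
        rw [Finset.sum_const, Finset.card_sdiff_of_subset hXU, hk, nsmul_eq_mul]
        have e_cast : (k.choose X.card : ℚ) * ((k + 1 : ℕ) : ℚ) =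
          ((k + 1).choose X.card : ℚ) * ((k + 1 - X.card : ℕ) : ℚ) := by exact_mod_cast e
        field_simp
        linear_combination (-f X) * e_cast
      rw [Finset.sum_congr rfl level, ← Finset.mul_sum] at total
      have := le_of_mul_le_mul_left total (by positivity)
      rw [← Finset.add_sum_erase _ _ (Finset.mem_powerset_self U), hk]
      simp only [Nat.choose_self, Nat.cast_one, div_one]
      linarith
    · intro x X
      simp only [Finset.mem_powerset, Finset.mem_erase, Finset.mem_sdiff, Finset.subset_erase]
      constructor
      · rintro ⟨hx, hXU, hxX⟩
        exact ⟨⟨hx, hxX⟩, fun e => hxX (e ▸ hx), hXU⟩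
      · rintro ⟨⟨hx, hxX⟩, -, hXU⟩
        exact ⟨hx, hXU, hxX⟩

/-- Sperner's theorem for families indexed through a map `π` to subsets of `U` that has at most
`M` preimages over each chain. -/
theorem card_le_mul_choose_of_chain_card_le {α β : Type*} [DecidableEq α] (𝒜 : Finset β)
    (π : β → Finset α) (U : Finset α) (M : ℕ) (hπ : ∀ A ∈ 𝒜, π A ⊆ U)
    (h : ∀ C ⊆ U.powerset, IsChain (· ⊆ ·) (C : Set (Finset α)) →
      (𝒜.filter fun A => π A ∈ C).card ≤ M) :
    𝒜.card ≤ U.card.choose (U.card / 2) * M := by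
  have fiber : ∀ C : Finset (Finset α), ∑ X ∈ C, ((𝒜.filter fun A => π A = X).card : ℚ) =
      ((𝒜.filter fun A => π A ∈ C).card : ℚ) := by
    intro C
    rw [Finset.card_eq_sum_card_fiberwise (f := π) (t := C) (by intro A; simp)]
    push_cast
    refine Finset.sum_congr rfl fun X hX => ?_
    congr 2
    ext A
    simp only [Finset.mem_filter]
    constructor
    · rintro ⟨hA, rfl⟩
      exact ⟨⟨hA, hX⟩, rfl⟩
    · rintro ⟨⟨hA, -⟩, e⟩
      exact ⟨hA, e⟩
  have lym := sum_div_choose_le_of_chain_sum_le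
    (fun X => ((𝒜.filter fun A => π A = X).card : ℚ)) U M fun C hC hchain => by
      rw [fiber]
      exact_mod_cast h C hC hchain
  have hall : 𝒜.filter (fun A => π A ∈ U.powerset) = 𝒜 :=
    Finset.filter_true_of_mem fun A hA => Finset.mem_powerset.mpr (hπ A hA)
  have hpos : (0 : ℚ) < (U.card.choose (U.card / 2) : ℚ) := by
    exact_mod_cast Nat.choose_pos (Nat.div_le_self _ _)
  have hle : (𝒜.card : ℚ) / (U.card.choose (U.card / 2) : ℚ) ≤ M := by
    refine le_trans ?_ lym
    rw [← hall, ← fiber, hall, Finset.sum_div]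
    refine Finset.sum_le_sum fun X hX => ?_
    have hX := Finset.card_le_card (Finset.mem_powerset.mp hX)
    gcongr
    · exact_mod_cast Nat.choose_pos hX
    · exact Nat.choose_le_middle _ _
  rw [div_le_iff₀ hpos, mul_comm] at hle
  exact_mod_cast hle


/-- (Bipartite extension of Sperner's theorem.) Let `u ≤ n`, `U = {1,…,u}`,
`V = [n] \ U` (here realized with 0-based indexing as `U = range u`, `V = Ico u n`).
If every two distinct members `A, B` of `𝒜` are such that either `A ∩ U`, `B ∩ U` are
incomparable or `A ∩ V`, `B ∩ V` are incomparable, then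
`|𝒜| ≤ binom(u, ⌊u/2⌋)·binom(n−u, ⌊(n−u)/2⌋)`. -/
theorem stmt_6 (n u : ℕ) (hu : u ≤ n) (𝒜 : Finset (Finset ℕ))
    (hsub : ∀ A ∈ 𝒜, A ⊆ Finset.range n)
    (h : ∀ A ∈ 𝒜, ∀ B ∈ 𝒜, A ≠ B →
      (¬ A ∩ Finset.range u ⊆ B ∩ Finset.range u ∧
       ¬ B ∩ Finset.range u ⊆ A ∩ Finset.range u) ∨
      (¬ A ∩ Finset.Ico u n ⊆ B ∩ Finset.Ico u n ∧
       ¬ B ∩ Finset.Ico u n ⊆ A ∩ Finset.Ico u n)) :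
    𝒜.card ≤ Nat.choose u (u / 2) * Nat.choose (n - u) ((n - u) / 2) := by
  have main := card_le_mul_choose_of_chain_card_le 𝒜 (fun A => A ∩ Finset.range u)
    (Finset.range u) ((n - u).choose ((n - u) / 2)) (fun A _ => Finset.inter_subset_right)
    fun C _ hC => by
      have inner := card_le_mul_choose_of_chain_card_le
        (𝒜.filter fun A => A ∩ Finset.range u ∈ C) (fun A => A ∩ Finset.Ico u n)
        (Finset.Ico u n) 1 (fun A _ => Finset.inter_subset_right) fun D _ hD => by
          rw [Finset.card_le_one]
          intro A hA B hB
          simp only [Finset.mem_filter] at hA hB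
          by_contra hne
          rcases h A hA.1.1 B hB.1.1 hne with ⟨h₁, h₂⟩ | ⟨h₁, h₂⟩
          · exact (hC.total hA.1.2 hB.1.2).elim h₁ h₂
          · exact (hD.total hA.2 hB.2).elim h₁ h₂
      simpa using inner
  simpa using main
end

section
/- Let u ≤ n, let U = {1,…,u} and V = [n] \ U, and let f : ℕ → ℕ be a monotone increasing function. If 𝒜 is an antichain of subsets of [n] (no member is a subset of another) such that |A ∩ V| = f(|A ∩ U|) for every A ∈ 𝒜, then |𝒜| ≤ binom(u, ⌊u/2⌋)·binom(n−u, ⌊(n−u)/2⌋). -/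
open Finset Numbering in
/-- The LYM inequality for antichains in a product of two power sets whose members lie on the
levels `(i, f i)` with `f` monotone. -/
theorem sum_inv_choose_mul_inv_choose_le_one {α β : Type*} [Fintype α] [Fintype β]
    [DecidableEq α] [DecidableEq β] {f : ℕ → ℕ} (hf : Monotone f)
    {𝒜 : Finset (Finset α × Finset β)}
    (hanti : IsAntichain (· ≤ ·) (𝒜 : Set (Finset α × Finset β)))
    (hfA : ∀ p ∈ 𝒜, #p.2 = f #p.1) :
    ∑ p ∈ 𝒜, ((Fintype.card α).choose #p.1 : ℚ≥0)⁻¹ * ((Fintype.card β).choose #p.2 : ℚ≥0)⁻¹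
      ≤ 1 := by
  have hdisj : (𝒜 : Set (Finset α × Finset β)).PairwiseDisjoint
      fun p ↦ prefixed p.1 ×ˢ prefixed p.2 := by
    intro p hp q hq hpq
    refine Finset.disjoint_left.2 fun ⟨g, h⟩ hgp hgq ↦ ?_
    simp only [mem_product, mem_prefixed] at hgp hgq
    have le_of_card_le {p q : Finset α × Finset β} (hp : p ∈ 𝒜) (hq : q ∈ 𝒜)
        (hgp : IsPrefix g p.1 ∧ IsPrefix h p.2) (hgq : IsPrefix g q.1 ∧ IsPrefix h q.2)
        (hle : #p.1 ≤ #q.1) : p ≤ q :=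
      ⟨hgp.1.subset_of_card_le_card hgq.1 hle,
        hgp.2.subset_of_card_le_card hgq.2 (by rw [hfA p hp, hfA q hq]; exact hf hle)⟩
    obtain hle | hle := Nat.le_total #p.1 #q.1
    · exact hanti hp hq hpq (le_of_card_le hp hq hgp hgq hle)
    · exact hanti hq hp hpq.symm (le_of_card_le hq hp hgq hgp hle)
  calc
    _ = ∑ p ∈ 𝒜, (prefixed p.1 ×ˢ prefixed p.2).dens := by
      refine sum_congr rfl fun p _ ↦ ?_
      rw [← dens_prefixed, ← dens_prefixed]
      simp only [dens, card_product, Fintype.card_prod, Nat.cast_mul]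
      rw [div_mul_div_comm]
    _ = (𝒜.biUnion fun p ↦ prefixed p.1 ×ˢ prefixed p.2).dens := (dens_biUnion hdisj).symm
    _ ≤ 1 := dens_le_one

open Finset in
/-- A Sperner bound for antichains in a product of two power sets whose members lie on the
levels `(i, f i)` with `f` monotone. -/
theorem card_le_choose_mul_choose_of_isAntichain {α β : Type*} [Fintype α] [Fintype β]
    {f : ℕ → ℕ} (hf : Monotone f)
    {𝒜 : Finset (Finset α × Finset β)}
    (hanti : IsAntichain (· ≤ ·) (𝒜 : Set (Finset α × Finset β)))
    (hfA : ∀ p ∈ 𝒜, #p.2 = f #p.1) :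
    #𝒜 ≤ (Fintype.card α).choose (Fintype.card α / 2) *
      (Fintype.card β).choose (Fintype.card β / 2) := by
  classical
  set M := (Fintype.card α).choose (Fintype.card α / 2)
  set N := (Fintype.card β).choose (Fintype.card β / 2)
  have hM : 0 < M := Nat.choose_pos (Nat.div_le_self _ _)
  have hN : 0 < N := Nat.choose_pos (Nat.div_le_self _ _)
  have hpos : (0 : ℚ≥0) < M * N := by positivity
  have hsum : ∑ _p ∈ 𝒜, ((M : ℚ≥0) * N)⁻¹ ≤ 1 := by
    refine (sum_le_sum fun p _ ↦ ?_).trans (sum_inv_choose_mul_inv_choose_le_one hf hanti hfA)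
    have h₁ : 0 < (Fintype.card α).choose #p.1 := Nat.choose_pos p.1.card_le_univ
    have h₂ : 0 < (Fintype.card β).choose #p.2 := Nat.choose_pos p.2.card_le_univ
    rw [mul_inv]
    gcongr
    · exact Nat.choose_le_middle _ _
    · exact Nat.choose_le_middle _ _
  rw [sum_const, nsmul_eq_mul, ← div_eq_mul_inv, div_le_one hpos] at hsum
  exact_mod_cast hsum

/-- Let `u ≤ n`, `U = {1,…,u}`, `V = [n] \ U` (realized with 0-based
indexing as `U = range u`, `V = Ico u n`), and let `f : ℕ → ℕ` be monotone increasing.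
If `𝒜` is an antichain of subsets of `[n]` with `|A ∩ V| = f(|A ∩ U|)` for every `A ∈ 𝒜`,
then `|𝒜| ≤ binom(u, ⌊u/2⌋)·binom(n−u, ⌊(n−u)/2⌋)`. -/
theorem stmt_7 (n u : ℕ) (hu : u ≤ n) (f : ℕ → ℕ) (hf : Monotone f)
    (𝒜 : Finset (Finset ℕ))
    (hsub : ∀ A ∈ 𝒜, A ⊆ Finset.range n)
    (hanti : ∀ A ∈ 𝒜, ∀ B ∈ 𝒜, A ≠ B → ¬ A ⊆ B)
    (hfA : ∀ A ∈ 𝒜, (A ∩ Finset.Ico u n).card = f ((A ∩ Finset.range u).card)) :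
    𝒜.card ≤ Nat.choose u (u / 2) * Nat.choose (n - u) ((n - u) / 2) := by
  classical
  let split (A : Finset ℕ) :
      Finset {x // x ∈ Finset.range u} × Finset {x // x ∈ Finset.Ico u n} :=
    (A.subtype (· ∈ Finset.range u), A.subtype (· ∈ Finset.Ico u n))
  have subset_of_le {A B : Finset ℕ} (hA : A ∈ 𝒜) (hle : split A ≤ split B) : A ⊆ B := by
    intro x hx
    have hxn := Finset.mem_range.1 (hsub A hA hx)
    obtain hxu | hxu := lt_or_ge x u
    · exact Finset.mem_subtype.1
        (hle.1 (Finset.mem_subtype.2 hx : (⟨x, Finset.mem_range.2 hxu⟩ : Subtype _) ∈ _))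
    · exact Finset.mem_subtype.1
        (hle.2 (Finset.mem_subtype.2 hx : (⟨x, Finset.mem_Ico.2 ⟨hxu, hxn⟩⟩ : Subtype _) ∈ _))
  have split_injOn : Set.InjOn split 𝒜 := fun A hA B hB hAB ↦
    (subset_of_le hA hAB.le).antisymm (subset_of_le hB hAB.ge)
  rw [← Finset.card_image_of_injOn split_injOn]
  have key := card_le_choose_mul_choose_of_isAntichain hf (𝒜 := 𝒜.image split) ?_ ?_
  · simpa using key
  · simp only [Finset.coe_image]
    rintro _ ⟨A, hA, rfl⟩ _ ⟨B, hB, rfl⟩ hne hle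
    exact hanti A hA B hB (ne_of_apply_ne split hne) (subset_of_le hA hle)
  · simp only [Finset.forall_mem_image]
    intro A hA
    simpa only [split, Finset.card_subtype, Finset.filter_mem_eq_inter] using hfA A hA
end

section
/- Let u ≤ n, let U = {1,…,u} and V = [n] \ U. Let 𝒜 be a family of subsets of [n] such that for every two distinct sets A, B ∈ 𝒜, either A ∩ U and B ∩ U are incomparable under inclusion, or A ∩ V and B ∩ V are incomparable under inclusion. Then ∑_{A ∈ 𝒜} 1 / ( binom(u, |A ∩ U|) · binom(n−u, |A ∩ V|) ) ≤ 1. -/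
/-- Weighted LYM inequality: if `w` has total weight at most `t` along every chain of subsets
of `U`, then its sum over all subsets, normalized by the level sizes, is at most `t`. -/
theorem sum_powerset_div_choose_le_of_isChain {α : Type*} [DecidableEq α] (w : Finset α → ℝ)
    (U : Finset α) (t : ℝ)
    (hw : ∀ C ⊆ U.powerset, IsChain (· ⊆ ·) (C : Set (Finset α)) → ∑ S ∈ C, w S ≤ t) :
    ∑ S ∈ U.powerset, w S / (U.card.choose S.card : ℝ) ≤ t := by
  induction U using Finset.strongInduction generalizing t with
  | H U ih =>
    rcases U.eq_empty_or_nonempty with rfl | hU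
    · simpa using hw {∅} (by simp) (by simp)
    have hcard : (0 : ℝ) < U.card := by exact_mod_cast hU.card_pos
    have hstep : ∀ x ∈ U, ∑ S ∈ (U.erase x).powerset,
        w S / ((U.erase x).card.choose S.card : ℝ) ≤ t - w U := by
      intro x hx
      refine ih _ (Finset.erase_ssubset hx) _ fun C hC hchain => ?_
      have hsub : ∀ S ∈ C, S ⊆ U.erase x := fun S hS => Finset.mem_powerset.1 (hC hS)
      have hUC : U ∉ C := fun hmem => Finset.notMem_erase x U (hsub U hmem hx)
      have hle := hw (insert U C)
        (Finset.insert_subset (Finset.mem_powerset_self U) fun S hS =>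
          Finset.mem_powerset.2 ((hsub S hS).trans (Finset.erase_subset x U)))
        (by
          rw [Finset.coe_insert]
          exact hchain.insert fun S hS _ =>
            Or.inr ((hsub S hS).trans (Finset.erase_subset x U)))
      rw [Finset.sum_insert hUC] at hle
      linarith
    have hterm : ∀ S ∈ U.ssubsets, w S / (U.card.choose S.card : ℝ) =
        ∑ x ∈ U \ S, w S / ((U.erase x).card.choose S.card : ℝ) / U.card := by
      intro S hS
      have hSU := Finset.mem_ssubsets.1 hS
      have hlt := Finset.card_lt_card hSU
      rw [Finset.sum_congr rfl fun x hx => by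
        rw [Finset.card_erase_of_mem (Finset.mem_sdiff.1 hx).1], Finset.sum_const,
        Finset.card_sdiff_of_subset hSU.subset, nsmul_eq_mul]
      obtain ⟨m, hm⟩ : ∃ m, U.card = m + 1 := ⟨U.card - 1, by omega⟩
      rw [hm] at hlt ⊢
      have hchoose : ((m + 1 : ℕ) : ℝ) * m.choose S.card =
          (m + 1).choose S.card * ((m + 1 - S.card : ℕ) : ℝ) := by
        have := Nat.choose_mul_succ_eq m S.card
        rw [mul_comm] at this
        exact_mod_cast this
      have hpos : (0 : ℝ) < (m + 1).choose S.card := by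
        exact_mod_cast Nat.choose_pos hlt.le
      have hpos' : (0 : ℝ) < m.choose S.card := by
        exact_mod_cast Nat.choose_pos (Nat.le_of_lt_succ hlt)
      rw [Nat.add_sub_cancel, div_div, mul_div_assoc', div_eq_div_iff hpos.ne' (by positivity)]
      linear_combination w S * hchoose
    have hswap : ∑ S ∈ U.ssubsets, w S / (U.card.choose S.card : ℝ) =
        ∑ x ∈ U, (∑ S ∈ (U.erase x).powerset,
          w S / ((U.erase x).card.choose S.card : ℝ)) / U.card := by
      rw [Finset.sum_congr rfl hterm]
      simp_rw [Finset.sum_div]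
      refine Finset.sum_comm' fun S x => ?_
      simp only [Finset.mem_ssubsets, Finset.mem_sdiff, Finset.mem_powerset,
        Finset.subset_erase, Finset.ssubset_iff_subset_ne]
      constructor
      · rintro ⟨⟨hS, -⟩, hx, hxS⟩
        exact ⟨⟨hS, hxS⟩, hx⟩
      · rintro ⟨⟨hS, hxS⟩, hx⟩
        exact ⟨⟨hS, fun heq => hxS (heq ▸ hx)⟩, hx, hxS⟩
    have hsum : ∑ S ∈ U.ssubsets, w S / (U.card.choose S.card : ℝ) ≤ t - w U := by
      rw [hswap, ← Finset.sum_div, div_le_iff₀ hcard]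
      calc _ ≤ ∑ _x ∈ U, (t - w U) := Finset.sum_le_sum hstep
        _ = _ := by rw [Finset.sum_const, nsmul_eq_mul, mul_comm]
    rw [Finset.ssubsets] at hsum
    rw [← Finset.add_sum_erase _ _ (Finset.mem_powerset_self U), Nat.choose_self, Nat.cast_one,
      div_one]
    linarith

/-- Weighted LYM inequality for an indexed family of subsets of `U`. -/
theorem sum_div_choose_le_of_isChain {ι α : Type*} [DecidableEq α] (s : Finset ι)
    (f : ι → Finset α) (g : ι → ℝ) (U : Finset α) (t : ℝ) (hf : ∀ i ∈ s, f i ⊆ U)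
    (hg : ∀ C : Finset (Finset α), IsChain (· ⊆ ·) (C : Set (Finset α)) →
      ∑ i ∈ s with f i ∈ C, g i ≤ t) :
    ∑ i ∈ s, g i / (U.card.choose (f i).card : ℝ) ≤ t := by
  have key := sum_powerset_div_choose_le_of_isChain (fun S => ∑ i ∈ s with f i = S, g i) U t
    fun C _ hC => by
      refine le_trans (le_of_eq ?_) (hg C hC)
      rw [← Finset.sum_fiberwise_of_maps_to (s := {i ∈ s | f i ∈ C}) (t := C) (g := f)
        fun i hi => (Finset.mem_filter.1 hi).2]
      refine Finset.sum_congr rfl fun S hS => Finset.sum_congr ?_ fun _ _ => rfl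
      ext i
      simp only [Finset.mem_filter]
      exact ⟨fun ⟨hi, he⟩ => ⟨⟨hi, he ▸ hS⟩, he⟩, fun ⟨⟨hi, _⟩, he⟩ => ⟨hi, he⟩⟩
  refine le_trans (le_of_eq ?_) key
  rw [← Finset.sum_fiberwise_of_maps_to (t := U.powerset) (g := f)
    fun i hi => Finset.mem_powerset.2 (hf i hi)]
  refine Finset.sum_congr rfl fun S _ => ?_
  rw [Finset.sum_div]
  exact Finset.sum_congr rfl fun i hi => by rw [(Finset.mem_filter.1 hi).2]


/-- (Bipartite LYM inequality.) Let `u ≤ n`, `U = {1,…,u}`, `V = [n] \ U`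
(realized with 0-based indexing as `U = range u`, `V = Ico u n`). If every two distinct
members `A, B` of `𝒜` are such that either `A ∩ U`, `B ∩ U` are incomparable or
`A ∩ V`, `B ∩ V` are incomparable, then
`∑_{A ∈ 𝒜} 1 / (binom(u, |A ∩ U|)·binom(n−u, |A ∩ V|)) ≤ 1`. -/
theorem stmt_8 (n u : ℕ) (hu : u ≤ n) (𝒜 : Finset (Finset ℕ))
    (hsub : ∀ A ∈ 𝒜, A ⊆ Finset.range n)
    (h : ∀ A ∈ 𝒜, ∀ B ∈ 𝒜, A ≠ B →
      (¬ A ∩ Finset.range u ⊆ B ∩ Finset.range u ∧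
       ¬ B ∩ Finset.range u ⊆ A ∩ Finset.range u) ∨
      (¬ A ∩ Finset.Ico u n ⊆ B ∩ Finset.Ico u n ∧
       ¬ B ∩ Finset.Ico u n ⊆ A ∩ Finset.Ico u n)) :
    ∑ A ∈ 𝒜, (1 : ℝ) /
      ((Nat.choose u (A ∩ Finset.range u).card : ℝ) *
       (Nat.choose (n - u) (A ∩ Finset.Ico u n).card : ℝ)) ≤ 1 := by
  have hV := Nat.card_Ico u n
  have hU := Finset.card_range u
  have key := sum_div_choose_le_of_isChain 𝒜 (· ∩ Finset.range u)
    (fun A => 1 / ((n - u).choose (A ∩ Finset.Ico u n).card : ℝ)) (Finset.range u) 1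
    (fun A _ => Finset.inter_subset_right) fun C hC => by
      have inner := sum_div_choose_le_of_isChain {A ∈ 𝒜 | A ∩ Finset.range u ∈ C}
        (· ∩ Finset.Ico u n) (fun _ => 1) (Finset.Ico u n) 1
        (fun A _ => Finset.inter_subset_right) fun D hD => by
          rw [Finset.sum_const, nsmul_eq_mul, mul_one]
          norm_cast
          refine Finset.card_le_one.2 fun A hA B hB => ?_
          simp only [Finset.mem_filter] at hA hB
          by_contra hne
          rcases h A hA.1.1 B hB.1.1 hne with ⟨h₁, h₂⟩ | ⟨h₁, h₂⟩
          · exact (hC.total hA.1.2 hB.1.2).elim h₁ h₂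
          · exact (hD.total hA.2 hB.2).elim h₁ h₂
      rwa [hV] at inner
  rw [hU] at key
  refine le_trans (le_of_eq (Finset.sum_congr rfl fun A _ => ?_)) key
  rw [div_div, mul_comm]
end
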